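/- (Rank-one theorem for higher-order derivatives.) Let Ω ⊂ ℝ^d be an open set, r ∈ ℕ, and let u ∈ L¹(Ω; ℝ^ℓ) be such that its r-th distributional derivative D^r u is representable by a finite Radon measure on Ω with values in the symmetric r-linear maps from ℝ^d to ℝ^ℓ. Then for |(D^r u)^s|-almost every x ∈ Ω there exist a(x) ∈ ℝ^ℓ ∖ {0} and b(x) ∈ ℝ^d ∖ {0} such that d(D^r u)^s/d|(D^r u)^s|(x) = a(x) ⊗ b(x) ⊗ ⋯ ⊗ b(x) (with b(x) appearing r times), i.e. the polar is the symmetric r-linear map (v_1,…,v_r) ↦ a(x) (b(x)·v_1)⋯(b(x)·v_r). -/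

import Mathlib

open MeasureTheory Metric

/-- The partial derivative `∂_j φ` of a scalar function on `ℝ^d`. -/
noncomputable def pderiv' {d : ℕ} (j : Fin d) (φ : EuclideanSpace ℝ (Fin d) → ℝ) :
    EuclideanSpace ℝ (Fin d) → ℝ :=
  fun x => fderiv ℝ φ x (EuclideanSpace.single j 1)

/-- The iterated partial derivative `∂_{i_1} ⋯ ∂_{i_r} φ` along a tuple of directions. -/
noncomputable def pderivSeq {d r : ℕ} (iv : Fin r → Fin d)
    (φ : EuclideanSpace ℝ (Fin d) → ℝ) : EuclideanSpace ℝ (Fin d) → ℝ :=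
  (List.ofFn iv).foldr (fun i ψ => pderiv' i ψ) φ

section
open Set Filter Topology
set_option linter.unusedSectionVars false

/-- The polynomially decaying weight `(1 + |x|²)^{-k}`. -/
noncomputable def japWeight {d : ℕ} (k : ℕ) (x : EuclideanSpace ℝ (Fin d)) : ℝ :=
  ((1 + ‖x‖ ^ 2) ^ k)⁻¹

lemma japWeight_pos {d : ℕ} (k : ℕ) (x : EuclideanSpace ℝ (Fin d)) : 0 < japWeight k x := by
  unfold japWeight; positivity

lemma japWeight_le_one {d : ℕ} (k : ℕ) (x : EuclideanSpace ℝ (Fin d)) : japWeight k x ≤ 1 := by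
  unfold japWeight
  exact inv_le_one_of_one_le₀ (one_le_pow₀ (by nlinarith [sq_nonneg ‖x‖]))

lemma continuous_japWeight {d : ℕ} (k : ℕ) :
    Continuous (japWeight k : EuclideanSpace ℝ (Fin d) → ℝ) := by
  unfold japWeight
  exact Continuous.inv₀ (by fun_prop) (fun x => by positivity)

lemma integrable_japWeight {d k : ℕ} (hk : d < 2 * k) :
    Integrable (japWeight k : EuclideanSpace ℝ (Fin d) → ℝ) := by
  have h := integrable_rpow_neg_one_add_norm_sq (E := EuclideanSpace ℝ (Fin d))
    (μ := volume) (r := 2 * k) (by rw [finrank_euclideanSpace_fin]; exact_mod_cast hk)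
  refine h.congr (Eventually.of_forall fun x => ?_)
  have : (0 : ℝ) ≤ 1 + ‖x‖ ^ 2 := by positivity
  simp only [japWeight]
  rw [show -(2 * (k : ℝ)) / 2 = -(k : ℝ) by ring, Real.rpow_neg this, Real.rpow_natCast]

/-- The Peetre inequality. -/
lemma japWeight_le_mul {d : ℕ} (k : ℕ) (x y : EuclideanSpace ℝ (Fin d)) :
    japWeight k x ≤ 2 ^ k * (1 + ‖x - y‖ ^ 2) ^ k * japWeight k y := by
  unfold japWeight
  have h : 1 + ‖y‖ ^ 2 ≤ 2 * (1 + ‖x - y‖ ^ 2) * (1 + ‖x‖ ^ 2) := by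
    have : ‖y‖ ≤ ‖x‖ + ‖x - y‖ := by
      have := norm_sub_le x (x - y); simpa using this
    have h2 : ‖y‖ ^ 2 ≤ (‖x‖ + ‖x - y‖) ^ 2 := by gcongr
    nlinarith [sq_nonneg (‖x‖ - ‖x - y‖), mul_nonneg (sq_nonneg ‖x‖) (sq_nonneg ‖x - y‖)]
  rw [← mul_pow, ← div_eq_mul_inv, inv_eq_one_div, div_le_div_iff₀ (by positivity) (by positivity),
    one_mul, ← mul_pow]
  gcongr

/-- The constant in `exp_neg_quarter_le`. -/
noncomputable def expConst (n : ℕ) : ℝ := 4 ^ n * n.factorial * Real.exp (1 / 4)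

lemma expConst_pos (n : ℕ) : 0 < expConst n := by unfold expConst; positivity

lemma exp_neg_quarter_mul_le (n : ℕ) {s : ℝ} (hs : 0 ≤ s) :
    Real.exp (-s / 4) * (1 + s) ^ n ≤ expConst n := by
  have h := Real.pow_div_factorial_le_exp ((1 + s) / 4) (by positivity) n
  have h1 : Real.exp ((1 + s) / 4) = Real.exp (1 / 4) * Real.exp (s / 4) := by
    rw [← Real.exp_add]; ring_nf
  have h2 : Real.exp (-s / 4) * Real.exp (s / 4) = 1 := by
    rw [← Real.exp_add]; ring_nf; simp
  have hfac : (0 : ℝ) < n.factorial := by exact_mod_cast n.factorial_pos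
  rw [div_le_iff₀ hfac, div_pow, div_le_iff₀ (by positivity), h1] at h
  calc Real.exp (-s / 4) * (1 + s) ^ n
      ≤ Real.exp (-s / 4) * (Real.exp (1 / 4) * Real.exp (s / 4) * n.factorial * 4 ^ n) := by
        gcongr
    _ = (Real.exp (-s / 4) * Real.exp (s / 4)) * (4 ^ n * n.factorial * Real.exp (1 / 4)) := by
        ring
    _ = expConst n := by rw [h2, one_mul, expConst]

/-- The (unnormalised) heat kernel `t^{-d/2} e^{-|x|²/4t}`. -/
noncomputable def heatK {d : ℕ} (t : ℝ) (x : EuclideanSpace ℝ (Fin d)) : ℝ :=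
  t ^ (-(d : ℝ) / 2) * Real.exp (-(‖x‖ ^ 2 / t) / 4)

/-- The spatial derivative of the heat kernel in direction `i`. -/
noncomputable def heatK1 {d : ℕ} (i : Fin d) (t : ℝ) (x : EuclideanSpace ℝ (Fin d)) : ℝ :=
  -(x i / (2 * t)) * heatK t x

/-- The second spatial derivative of the heat kernel in direction `i`. -/
noncomputable def heatK2 {d : ℕ} (i : Fin d) (t : ℝ) (x : EuclideanSpace ℝ (Fin d)) : ℝ :=
  ((x i) ^ 2 / (4 * t ^ 2) - 1 / (2 * t)) * heatK t x

section heat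
variable {d : ℕ}

lemma heatK_nonneg {t : ℝ} (ht : 0 < t) (x : EuclideanSpace ℝ (Fin d)) : 0 ≤ heatK t x := by
  unfold heatK; positivity

@[fun_prop]
lemma continuous_heatK (t : ℝ) : Continuous (heatK t : EuclideanSpace ℝ (Fin d) → ℝ) := by
  unfold heatK; fun_prop

@[fun_prop]
lemma continuous_heatK1 (i : Fin d) (t : ℝ) : Continuous (heatK1 i t) := by
  unfold heatK1; fun_prop

@[fun_prop]
lemma continuous_heatK2 (i : Fin d) (t : ℝ) : Continuous (heatK2 i t) := by
  unfold heatK2; fun_prop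

lemma heatK_le {t : ℝ} (ht : 0 < t) (x : EuclideanSpace ℝ (Fin d)) :
    heatK t x ≤ t ^ (-(d : ℝ) / 2) := by
  unfold heatK
  refine mul_le_of_le_one_right (by positivity) (Real.exp_le_one_iff.2 ?_)
  have : 0 ≤ ‖x‖ ^ 2 / t := by positivity
  linarith

lemma abs_coord_le (x : EuclideanSpace ℝ (Fin d)) (i : Fin d) : |x i| ≤ ‖x‖ := by
  simpa using PiLp.norm_apply_le x i

lemma norm_sq_mul_heatK_le {t : ℝ} (ht : 0 < t) (x : EuclideanSpace ℝ (Fin d)) :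
    ‖x‖ ^ 2 / t * heatK t x ≤ 4 * t ^ (-(d : ℝ) / 2) := by
  unfold heatK
  set u := ‖x‖ ^ 2 / t
  have hu : 0 ≤ u := by positivity
  have h1 : u * Real.exp (-u / 4) ≤ 4 := by
    have h := Real.add_one_le_exp (u / 4)
    have h2 : Real.exp (-u / 4) * Real.exp (u / 4) = 1 := by
      rw [← Real.exp_add]; ring_nf; simp
    nlinarith [Real.exp_pos (-u / 4)]
  calc u * (t ^ (-(d : ℝ) / 2) * Real.exp (-u / 4))
      = t ^ (-(d : ℝ) / 2) * (u * Real.exp (-u / 4)) := by ring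
    _ ≤ t ^ (-(d : ℝ) / 2) * 4 := by gcongr
    _ = _ := by ring

lemma abs_heatK1_le {t : ℝ} (ht : 0 < t) (i : Fin d) (x : EuclideanSpace ℝ (Fin d)) :
    |heatK1 i t x| ≤ (1 + 1 / t) * t ^ (-(d : ℝ) / 2) := by
  have hK := heatK_nonneg ht x
  have h0 := heatK_le ht x
  have h1 := norm_sq_mul_heatK_le ht x
  have h2 : |x i| / (2 * t) ≤ 1 / t + 1 / 4 * (‖x‖ ^ 2 / t) - (3 / 4) / t := by
    have h3 := abs_coord_le x i
    rw [div_le_iff₀ (by positivity)]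
    field_simp
    nlinarith [sq_nonneg (‖x‖ - 1)]
  unfold heatK1
  rw [abs_mul, abs_neg, abs_div, abs_of_pos (by positivity : 0 < 2 * t), abs_of_nonneg hK]
  have h5 : 0 < 1 / t := by positivity
  calc |x i| / (2 * t) * heatK t x
      ≤ (1 / t + 1 / 4 * (‖x‖ ^ 2 / t)) * heatK t x := by
        gcongr; have : 0 < 3 / 4 / t := by positivity
        linarith
    _ = (1 / t) * heatK t x + 1 / 4 * (‖x‖ ^ 2 / t * heatK t x) := by ring
    _ ≤ (1 / t) * t ^ (-(d : ℝ) / 2) + 1 / 4 * (4 * t ^ (-(d : ℝ) / 2)) := by gcongr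
    _ = _ := by ring

lemma abs_heatK2_le {t : ℝ} (ht : 0 < t) (i : Fin d) (x : EuclideanSpace ℝ (Fin d)) :
    |heatK2 i t x| ≤ 2 / t * t ^ (-(d : ℝ) / 2) := by
  have hK := heatK_nonneg ht x
  have h0 := heatK_le ht x
  have h1 := norm_sq_mul_heatK_le ht x
  have h2 : |(x i) ^ 2 / (4 * t ^ 2) - 1 / (2 * t)| ≤ 1 / (4 * t) * (‖x‖ ^ 2 / t) + 1 / (2 * t) := by
    have h3 : (x i) ^ 2 ≤ ‖x‖ ^ 2 := by
      rw [← sq_abs]; gcongr; exact abs_coord_le x i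
    have h4 : (x i) ^ 2 / (4 * t ^ 2) ≤ 1 / (4 * t) * (‖x‖ ^ 2 / t) := by
      rw [show 1 / (4 * t) * (‖x‖ ^ 2 / t) = ‖x‖ ^ 2 / (4 * t ^ 2) by field_simp]
      gcongr
    have h5 : 0 ≤ (x i) ^ 2 / (4 * t ^ 2) := by positivity
    have h6 : 0 ≤ 1 / (2 * t) := by positivity
    rw [abs_le]; constructor <;> linarith
  unfold heatK2
  rw [abs_mul, abs_of_nonneg hK]
  calc _ ≤ (1 / (4 * t) * (‖x‖ ^ 2 / t) + 1 / (2 * t)) * heatK t x := by gcongr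
    _ = 1 / (4 * t) * (‖x‖ ^ 2 / t * heatK t x) + 1 / (2 * t) * heatK t x := by ring
    _ ≤ 1 / (4 * t) * (4 * t ^ (-(d : ℝ) / 2)) + 1 / (2 * t) * t ^ (-(d : ℝ) / 2) := by gcongr
    _ = (3 / 2) / t * t ^ (-(d : ℝ) / 2) := by field_simp; ring
    _ ≤ _ := by gcongr; norm_num

lemma hasDerivAt_norm_sq_line (x : EuclideanSpace ℝ (Fin d)) (i : Fin d) :
    HasDerivAt (fun s : ℝ => ‖x + s • EuclideanSpace.single i (1 : ℝ)‖ ^ 2) (2 * x i) 0 := by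
  have h : (fun s : ℝ => ‖x + s • EuclideanSpace.single i (1 : ℝ)‖ ^ 2)
      = fun s : ℝ => ‖x‖ ^ 2 + 2 * (s * x i) + s ^ 2 := by
    funext s
    rw [norm_add_sq_real, norm_smul, inner_smul_right, EuclideanSpace.inner_single_right]
    simp
  rw [h]
  have := ((((hasDerivAt_id (0 : ℝ)).mul_const (x i)).const_mul 2).const_add (‖x‖ ^ 2)).add
    ((hasDerivAt_id (0 : ℝ)).pow 2)
  convert! this using 1
  simp

lemma hasLineDerivAt_coord (x : EuclideanSpace ℝ (Fin d)) (i : Fin d) :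
    HasLineDerivAt ℝ (fun x : EuclideanSpace ℝ (Fin d) => x i) 1 x (EuclideanSpace.single i 1) := by
  unfold HasLineDerivAt
  have := (hasDerivAt_id (0 : ℝ)).const_add (x i)
  convert! this using 1
  funext s
  simp

lemma hasLineDerivAt_heatK (t : ℝ) (i : Fin d) (x : EuclideanSpace ℝ (Fin d)) :
    HasLineDerivAt ℝ (heatK t) (heatK1 i t x) x (EuclideanSpace.single i 1) := by
  unfold HasLineDerivAt heatK1 heatK
  have := ((((hasDerivAt_norm_sq_line x i).div_const t).neg.div_const 4).exp).const_mul
    (t ^ (-(d : ℝ) / 2))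
  convert! this using 1
  simp only [Pi.neg_apply, zero_smul, add_zero]
  ring

lemma hasLineDerivAt_heatK1 (t : ℝ) (i : Fin d) (x : EuclideanSpace ℝ (Fin d)) :
    HasLineDerivAt ℝ (heatK1 i t) (heatK2 i t x) x (EuclideanSpace.single i 1) := by
  have h1 := hasLineDerivAt_heatK t i x
  have h2 := hasLineDerivAt_coord x i
  unfold HasLineDerivAt at *
  have := ((h2.div_const (2 * t)).neg).mul h1
  convert! this using 1
  simp only [Pi.neg_apply, zero_smul, add_zero, heatK1, heatK2]
  ring

lemma hasDerivAt_heatK_time {t : ℝ} (ht : 0 < t) (x : EuclideanSpace ℝ (Fin d)) :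
    HasDerivAt (fun t => heatK t x) (∑ i, heatK2 i t x) t := by
  unfold heatK2
  rw [← Finset.sum_mul]
  have hsum : ∑ i, ((x i) ^ 2 / (4 * t ^ 2) - 1 / (2 * t)) =
      ‖x‖ ^ 2 / (4 * t ^ 2) - d / (2 * t) := by
    rw [Finset.sum_sub_distrib, ← Finset.sum_div, EuclideanSpace.real_norm_sq_eq]
    simp; ring
  rw [hsum]
  unfold heatK
  have h1 := Real.hasDerivAt_rpow_const (x := t) (p := -(d : ℝ) / 2) (Or.inl ht.ne')
  have h2 := ((((hasDerivAt_id t).inv ht.ne').const_mul (‖x‖ ^ 2)).neg.div_const 4).exp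
  have := h1.mul h2
  convert! this using 1
  rw [Real.rpow_sub_one ht.ne']
  simp only [id, Pi.neg_apply, Pi.inv_apply, div_eq_mul_inv]
  field_simp
  ring
end heat

section heat
variable {d : ℕ}

lemma heatK_mul_norm_pow_le (j : ℕ) {t : ℝ} (ht : 0 < t) (ht1 : t ≤ 1)
    (x : EuclideanSpace ℝ (Fin d)) :
    heatK t x * ‖x‖ ^ (2 * (d + j)) ≤ expConst (d + j) * t ^ j := by
  have hs : 0 ≤ ‖x‖ ^ 2 / t := by positivity
  have h1 := exp_neg_quarter_mul_le (d + j) hs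
  have h2 : Real.exp (-(‖x‖ ^ 2 / t) / 4) * (‖x‖ ^ 2 / t) ^ (d + j) ≤ expConst (d + j) := by
    refine le_trans ?_ h1
    gcongr
    linarith
  have h3 : t ^ (-(d : ℝ) / 2) ≤ (t ^ d)⁻¹ := by
    rw [← Real.rpow_natCast, ← Real.rpow_neg ht.le]
    refine Real.rpow_le_rpow_of_exponent_ge ht ht1 ?_
    have : (0 : ℝ) ≤ d := by positivity
    linarith
  unfold heatK
  have h4 : ‖x‖ ^ (2 * (d + j)) = (‖x‖ ^ 2 / t) ^ (d + j) * (t ^ d * t ^ j) := by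
    rw [← pow_add, ← mul_pow, div_mul_cancel₀ _ ht.ne', pow_mul]
  rw [h4]
  calc _ = t ^ (-(d : ℝ) / 2) * t ^ d * t ^ j *
        (Real.exp (-(‖x‖ ^ 2 / t) / 4) * (‖x‖ ^ 2 / t) ^ (d + j)) := by ring
    _ ≤ (t ^ d)⁻¹ * t ^ d * t ^ j * expConst (d + j) := by gcongr
    _ = _ := by rw [inv_mul_cancel₀ (by positivity)]; ring

lemma abs_heatK1_mul_norm_pow_le (j : ℕ) {t : ℝ} (ht : 0 < t) (ht1 : t ≤ 1) (i : Fin d)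
    (x : EuclideanSpace ℝ (Fin d)) :
    |heatK1 i t x| * ‖x‖ ^ (2 * (d + (j + 1))) ≤ expConst (d + (j + 1)) * ‖x‖ := by
  have h := heatK_mul_norm_pow_le (j + 1) ht ht1 x
  unfold heatK1
  rw [abs_mul, abs_neg, abs_div, abs_of_pos (by positivity : 0 < 2 * t),
    abs_of_nonneg (heatK_nonneg ht x)]
  calc _ = |x i| / (2 * t) * (heatK t x * ‖x‖ ^ (2 * (d + (j + 1)))) := by ring
    _ ≤ ‖x‖ / (2 * t) * (expConst (d + (j + 1)) * t ^ (j + 1)) := by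
        have := abs_coord_le x i
        have := mul_nonneg (heatK_nonneg ht x) (by positivity : 0 ≤ ‖x‖ ^ (2 * (d + (j + 1))))
        gcongr
    _ = expConst (d + (j + 1)) * ‖x‖ * (t ^ j / 2) := by field_simp; ring
    _ ≤ expConst (d + (j + 1)) * ‖x‖ * 1 := by
        have := (expConst_pos (d + (j + 1))).le
        gcongr
        have := pow_le_one₀ (n := j) ht.le ht1
        linarith
    _ = _ := by ring

/-- Far away from the origin the heat kernel and its gradient are small compared
with the weight. -/
lemma exists_heatK_far_le (d : ℕ) : ∃ C : ℝ, 0 < C ∧ ∀ L : ℝ, 1 ≤ L → ∀ t : ℝ, 0 < t → t ≤ 1 →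
    ∀ x y : EuclideanSpace ℝ (Fin d), ‖x‖ ≤ 2 * L → 4 * L ≤ ‖y‖ →
      heatK t (x - y) ≤ C / L * japWeight (d + 2) y ∧
      ∀ i, |heatK1 i t (x - y)| ≤ C / L * japWeight (d + 2) y := by
  set k := d + 2 with hk
  refine ⟨expConst (d + 3) * 8 ^ k, mul_pos (expConst_pos _) (by positivity), ?_⟩
  intro L hL t ht ht1 x y hx hy
  set z := x - y with hz
  have hzy : ‖y‖ / 2 ≤ ‖z‖ := by
    have : ‖y‖ ≤ ‖x‖ + ‖z‖ := by
      have := norm_sub_le x z; simpa [hz] using this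
    linarith
  have hzL : L ≤ ‖z‖ := by linarith
  have hz1 : 1 ≤ ‖z‖ := hL.trans hzL
  have hz0 : 0 < ‖z‖ := by linarith
  have hw : (‖z‖ ^ (2 * k))⁻¹ ≤ 8 ^ k * japWeight k y := by
    unfold japWeight
    rw [← div_eq_mul_inv, ← div_pow, pow_mul, ← inv_pow]
    gcongr
    rw [inv_eq_one_div, div_le_div_iff₀ (by positivity) (by positivity)]
    nlinarith [norm_nonneg y]
  have hE := expConst_pos (d + 3)
  have key : ∀ a : ℝ, a * ‖z‖ ^ (2 * (d + 3)) ≤ expConst (d + 3) * ‖z‖ →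
      a ≤ expConst (d + 3) * 8 ^ k / L * japWeight k y := by
    intro a ha
    have h1 : a * ‖z‖ ^ (2 * k) * ‖z‖ ≤ expConst (d + 3) := by
      have : a * ‖z‖ ^ (2 * (d + 3)) = (a * ‖z‖ ^ (2 * k) * ‖z‖) * ‖z‖ := by
        rw [hk]; ring
      rw [this] at ha
      exact le_of_mul_le_mul_right ha hz0
    have h2 : a ≤ expConst (d + 3) / ‖z‖ * (‖z‖ ^ (2 * k))⁻¹ := by
      rw [← div_eq_mul_inv, le_div_iff₀ (by positivity), le_div_iff₀ hz0]
      exact h1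
    calc a ≤ expConst (d + 3) / ‖z‖ * (‖z‖ ^ (2 * k))⁻¹ := h2
      _ ≤ expConst (d + 3) / L * (8 ^ k * japWeight k y) := by gcongr
      _ = _ := by ring
  constructor
  · apply key
    have := heatK_mul_norm_pow_le 3 ht ht1 z
    refine this.trans ?_
    gcongr
    exact (pow_le_one₀ ht.le ht1).trans hz1
  · intro i
    exact key _ (abs_heatK1_mul_norm_pow_le 2 ht ht1 i z)

lemma exists_integral_weight_mul_heatK_le (d : ℕ) : ∃ N : ℝ, 0 < N ∧ ∀ t : ℝ, 0 < t → t ≤ 1 →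
    ∀ y : EuclideanSpace ℝ (Fin d),
      ∫ x, japWeight (d + 2) x * heatK t (x - y) ≤ N * japWeight (d + 2) y := by
  set k := d + 2 with hk
  have hintg : Integrable (japWeight k : EuclideanSpace ℝ (Fin d) → ℝ) :=
    integrable_japWeight (by omega)
  have hI : 0 ≤ ∫ z : EuclideanSpace ℝ (Fin d), japWeight k z :=
    integral_nonneg fun z => (japWeight_pos k z).le
  have hE := expConst_pos (k + k)
  refine ⟨2 ^ k * expConst (k + k) * ((∫ z : EuclideanSpace ℝ (Fin d), japWeight k z) + 1),
    by positivity, ?_⟩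
  intro t ht ht1 y
  have hst : 0 < √t := Real.sqrt_pos.2 ht
  have h1 : ∫ x, japWeight k x * heatK t (x - y) =
      ∫ x, japWeight k (x + y) * heatK t x := by
    rw [← integral_add_right_eq_self _ y]
    simp
  have h2 : ∫ x, japWeight k (x + y) * heatK t x =
      ∫ z : EuclideanSpace ℝ (Fin d), japWeight k (√t • z + y) * Real.exp (-(‖z‖ ^ 2) / 4) := by
    have := Measure.integral_comp_smul_of_nonneg (μ := (volume : Measure (EuclideanSpace ℝ (Fin d))))
      (fun x => japWeight k (x + y) * heatK t x) (√t) (hR := hst.le)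
    rw [finrank_euclideanSpace_fin] at this
    have h3 : ∀ z : EuclideanSpace ℝ (Fin d), heatK t (√t • z) =
        (√t ^ d)⁻¹ * Real.exp (-(‖z‖ ^ 2) / 4) := by
      intro z
      unfold heatK
      rw [norm_smul, Real.norm_of_nonneg hst.le, mul_pow, Real.sq_sqrt ht.le,
        mul_div_cancel_left₀ _ ht.ne', show √t ^ d = t ^ ((d : ℝ) / 2) by
          rw [Real.sqrt_eq_rpow, ← Real.rpow_natCast, ← Real.rpow_mul ht.le]
          congr 1
          ring, ← Real.rpow_neg ht.le]
      congr 2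
      ring
    simp only [h3] at this
    rw [show (fun z : EuclideanSpace ℝ (Fin d) => japWeight k (√t • z + y) * ((√t ^ d)⁻¹ *
        Real.exp (-(‖z‖ ^ 2) / 4))) = fun z => (√t ^ d)⁻¹ * (japWeight k (√t • z + y) *
        Real.exp (-(‖z‖ ^ 2) / 4)) by funext z; ring, integral_const_mul, smul_eq_mul] at this
    exact (mul_left_cancel₀ (by positivity) this).symm
  rw [h1, h2]
  have h4 : ∀ z : EuclideanSpace ℝ (Fin d), japWeight k (√t • z + y) * Real.exp (-(‖z‖ ^ 2) / 4) ≤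
      2 ^ k * expConst (k + k) * japWeight k y * japWeight k z := by
    intro z
    have hp := japWeight_le_mul k (√t • z + y) y
    have h5 : ‖√t • z + y - y‖ ^ 2 ≤ ‖z‖ ^ 2 := by
      rw [add_sub_cancel_right, norm_smul, Real.norm_of_nonneg hst.le, mul_pow, Real.sq_sqrt ht.le]
      nlinarith [sq_nonneg ‖z‖]
    have h6 := exp_neg_quarter_mul_le (k + k) (sq_nonneg ‖z‖)
    have hwy := (japWeight_pos k y).le
    calc _ ≤ (2 ^ k * (1 + ‖z‖ ^ 2) ^ k * japWeight k y) * Real.exp (-(‖z‖ ^ 2) / 4) := by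
          gcongr
          refine hp.trans ?_
          gcongr
      _ = 2 ^ k * japWeight k y * (Real.exp (-(‖z‖ ^ 2) / 4) * (1 + ‖z‖ ^ 2) ^ (k + k)) *
          japWeight k z := by
          unfold japWeight; field_simp; ring
      _ ≤ 2 ^ k * japWeight k y * expConst (k + k) * japWeight k z := by
          have := (japWeight_pos k z).le
          gcongr
      _ = _ := by ring
  calc _ ≤ ∫ z : EuclideanSpace ℝ (Fin d),
        2 ^ k * expConst (k + k) * japWeight k y * japWeight k z := by
        refine integral_mono_of_nonneg (Eventually.of_forall fun z => ?_) (hintg.const_mul _)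
          (Eventually.of_forall h4)
        exact mul_nonneg (japWeight_pos _ _).le (Real.exp_pos _).le
    _ = 2 ^ k * expConst (k + k) * (∫ z : EuclideanSpace ℝ (Fin d), japWeight k z)
          * japWeight k y := by rw [integral_const_mul]; ring
    _ ≤ _ := by
        have hwy := (japWeight_pos k y).le
        gcongr
        linarith

lemma heatK_one_ge {z : EuclideanSpace ℝ (Fin d)} (hz : ‖z‖ ≤ 3) :
    Real.exp (-9 / 4) ≤ heatK 1 z := by
  unfold heatK
  rw [Real.one_rpow, one_mul, div_one]
  gcongr
  nlinarith [norm_nonneg z]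

lemma exists_heatK_one_le (d : ℕ) : ∃ C : ℝ, 0 < C ∧ ∀ x y : EuclideanSpace ℝ (Fin d), ‖x‖ ≤ 1 →
    heatK 1 (x - y) ≤ C * japWeight (d + 2) y := by
  set k := d + 2
  have hE := expConst_pos k
  refine ⟨4 ^ k * expConst k, by positivity, fun x y hx => ?_⟩
  have hp := japWeight_le_mul k x y
  have h1 : (2 ^ k : ℝ)⁻¹ ≤ japWeight k x := by
    unfold japWeight
    gcongr
    nlinarith [norm_nonneg x]
  have h2 := exp_neg_quarter_mul_le k (sq_nonneg ‖x - y‖)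
  have hwy := japWeight_pos k y
  have h3 : 1 ≤ 4 ^ k * (1 + ‖x - y‖ ^ 2) ^ k * japWeight k y := by
    have h4 : (2 ^ k : ℝ) * (2 ^ k : ℝ)⁻¹ ≤ 2 ^ k * (2 ^ k * (1 + ‖x - y‖ ^ 2) ^ k * japWeight k y) := by
      gcongr; exact h1.trans hp
    rw [mul_inv_cancel₀ (by positivity)] at h4
    calc 1 ≤ _ := h4
      _ = (2 * 2) ^ k * (1 + ‖x - y‖ ^ 2) ^ k * japWeight k y := by rw [mul_pow]; ring
      _ = _ := by norm_num
  unfold heatK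
  rw [Real.one_rpow, one_mul, div_one]
  calc Real.exp (-‖x - y‖ ^ 2 / 4) ≤
      Real.exp (-‖x - y‖ ^ 2 / 4) * (4 ^ k * (1 + ‖x - y‖ ^ 2) ^ k * japWeight k y) :=
        le_mul_of_one_le_right (Real.exp_pos _).le h3
    _ = 4 ^ k * (Real.exp (-‖x - y‖ ^ 2 / 4) * (1 + ‖x - y‖ ^ 2) ^ k) * japWeight k y := by ring
    _ ≤ _ := by gcongr

end heat

section
variable {d : ℕ} {E : Type*} [NormedAddCommGroup E] [NormedSpace ℝ E]

/-- Convolution of a scalar kernel with the vector measure `F ρ`. -/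
noncomputable def mconv (ρ : Measure (EuclideanSpace ℝ (Fin d)))
    (F : EuclideanSpace ℝ (Fin d) → E) (g : EuclideanSpace ℝ (Fin d) → ℝ)
    (x : EuclideanSpace ℝ (Fin d)) : E := ∫ y, g (x - y) • F y ∂ρ

variable {ρ : Measure (EuclideanSpace ℝ (Fin d))} [IsFiniteMeasure ρ]
  {F : EuclideanSpace ℝ (Fin d) → E} {g g' : EuclideanSpace ℝ (Fin d) → ℝ}

lemma aestronglyMeasurable_mconv_integrand (hF : StronglyMeasurable F) (hg : Continuous g)
    (x : EuclideanSpace ℝ (Fin d)) : AEStronglyMeasurable (fun y => g (x - y) • F y) ρ :=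
  ((hg.comp (by fun_prop : Continuous fun y => x - y)).stronglyMeasurable.smul hF).aestronglyMeasurable

lemma norm_smul_le_of_abs_le {C : ℝ} {a : ℝ} {e : E} (ha : |a| ≤ C) (he : ‖e‖ ≤ 1) : ‖a • e‖ ≤ C := by
  rw [norm_smul, Real.norm_eq_abs]
  exact (mul_le_mul ha he (norm_nonneg _) ((abs_nonneg a).trans ha)).trans_eq (mul_one C)

lemma integrable_mconv_integrand (hF : StronglyMeasurable F) (hF1 : ∀ y, ‖F y‖ ≤ 1)
    (hg : Continuous g) {C : ℝ} (hC : ∀ x, |g x| ≤ C) (x : EuclideanSpace ℝ (Fin d)) :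
    Integrable (fun y => g (x - y) • F y) ρ :=
  Integrable.of_bound (aestronglyMeasurable_mconv_integrand hF hg x) C
    (ae_of_all _ fun y => norm_smul_le_of_abs_le (hC _) (hF1 y))

lemma continuous_mconv (hF : StronglyMeasurable F) (hF1 : ∀ y, ‖F y‖ ≤ 1)
    (hg : Continuous g) {C : ℝ} (hC : ∀ x, |g x| ≤ C) : Continuous (mconv ρ F g) := by
  unfold mconv
  refine continuous_of_dominated (bound := fun _ => C)
    (fun x => aestronglyMeasurable_mconv_integrand hF hg x)
    (fun x => ae_of_all _ fun y => norm_smul_le_of_abs_le (hC _) (hF1 y)) (integrable_const C)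
    (ae_of_all _ fun y => ?_)
  exact (hg.comp (by fun_prop : Continuous fun x => x - y)).smul continuous_const

lemma norm_mconv_le (hF1 : ∀ y, ‖F y‖ ≤ 1) {C : ℝ} (hC : ∀ x, |g x| ≤ C)
    (x : EuclideanSpace ℝ (Fin d)) : ‖mconv ρ F g x‖ ≤ C * ρ.real univ := by
  unfold mconv
  exact norm_integral_le_of_norm_le_const
    (ae_of_all _ fun y => norm_smul_le_of_abs_le (hC _) (hF1 y))

lemma hasLineDerivAt_mconv (hF : StronglyMeasurable F) (hF1 : ∀ y, ‖F y‖ ≤ 1)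
    (hg : Continuous g) {C : ℝ} (hC : ∀ x, |g x| ≤ C)
    (hg' : Continuous g') {C' : ℝ} (hC' : ∀ x, |g' x| ≤ C') {v : EuclideanSpace ℝ (Fin d)}
    (h : ∀ x, HasLineDerivAt ℝ g (g' x) x v) (x : EuclideanSpace ℝ (Fin d)) :
    HasLineDerivAt ℝ (mconv ρ F g) (mconv ρ F g' x) x v := by
  unfold HasLineDerivAt mconv
  have key := hasDerivAt_integral_of_dominated_loc_of_deriv_le (μ := ρ) (𝕜 := ℝ)
    (F := fun (s : ℝ) y => g (x + s • v - y) • F y)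
    (F' := fun (s : ℝ) y => g' (x + s • v - y) • F y) (x₀ := 0) (s := univ)
    (bound := fun _ => C') univ_mem
    (Eventually.of_forall fun s => aestronglyMeasurable_mconv_integrand hF hg _)
    (integrable_mconv_integrand hF hF1 hg hC _)
    (aestronglyMeasurable_mconv_integrand hF hg' _)
    (ae_of_all _ fun y s _ => norm_smul_le_of_abs_le (hC' _) (hF1 y)) (integrable_const C')
    (ae_of_all _ fun y s _ => ?_)
  · simpa using key.2
  · have h1 := (h (x + s • v - y)).scomp_of_eq s (h := fun r : ℝ => r - s) (h' := 1)
      ((hasDerivAt_id s).sub_const s) (by simp)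
    have h2 : HasDerivAt (fun r : ℝ => g (x + r • v - y)) (g' (x + s • v - y)) s := by
      convert! h1 using 1
      · funext r
        simp only [Function.comp]
        congr 1
        module
      · simp
    exact h2.smul_const (F y)

lemma hasDerivAt_mconv_time (hF : StronglyMeasurable F) (hF1 : ∀ y, ‖F y‖ ≤ 1) {t : ℝ} (ht : 0 < t)
    (x : EuclideanSpace ℝ (Fin d)) :
    HasDerivAt (fun s => mconv ρ F (heatK s) x) (∑ i, mconv ρ F (heatK2 i t) x) t := by
  have hpos : ∀ s ∈ Ioi (t / 2), 0 < s := fun s hs => (half_pos ht).trans hs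
  have hc : ∀ s, Continuous fun z : EuclideanSpace ℝ (Fin d) => ∑ i, heatK2 i s z := fun s =>
    continuous_finsetSum _ fun i _ => continuous_heatK2 i s
  have key := hasDerivAt_integral_of_dominated_loc_of_deriv_le (μ := ρ) (𝕜 := ℝ)
    (F := fun (s : ℝ) y => heatK s (x - y) • F y)
    (F' := fun (s : ℝ) y => (∑ i, heatK2 i s (x - y)) • F y) (x₀ := t) (s := Ioi (t / 2))
    (bound := fun _ => d * (2 / (t / 2) * (t / 2) ^ (-(d : ℝ) / 2))) (Ioi_mem_nhds (half_lt_self ht))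
    (Eventually.of_forall fun s => aestronglyMeasurable_mconv_integrand hF (continuous_heatK s) _)
    (integrable_mconv_integrand hF hF1 (continuous_heatK t)
      (fun z => (abs_of_nonneg (heatK_nonneg ht z)).trans_le (heatK_le ht z)) _)
    (aestronglyMeasurable_mconv_integrand hF (hc t) _)
    (ae_of_all _ fun y s hs => norm_smul_le_of_abs_le ?_ (hF1 y)) (integrable_const _)
    (ae_of_all _ fun y s hs => (hasDerivAt_heatK_time (hpos s hs) (x - y)).smul_const (F y))
  · have h2 := key.2
    unfold mconv
    rw [← integral_finsetSum]
    · simpa only [Finset.sum_smul] using h2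
    · intro i _
      exact integrable_mconv_integrand hF hF1 (continuous_heatK2 i t) (abs_heatK2_le ht i) _
  · refine (Finset.abs_sum_le_sum_abs _ _).trans ?_
    calc ∑ i, |heatK2 i s (x - y)| ≤ ∑ i : Fin d, 2 / (t / 2) * (t / 2) ^ (-(d : ℝ) / 2) := by
          refine Finset.sum_le_sum fun i _ => (abs_heatK2_le (hpos s hs) i _).trans ?_
          have hs' : t / 2 ≤ s := le_of_lt hs
          have : s ^ (-(d : ℝ) / 2) ≤ (t / 2) ^ (-(d : ℝ) / 2) :=
            Real.rpow_le_rpow_of_nonpos (half_pos ht) hs' (by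
              have : (0 : ℝ) ≤ d := Nat.cast_nonneg d
              linarith)
          have hp := hpos s hs
          gcongr
      _ = _ := by simp

end

section
variable {d : ℕ} {E : Type*} [NormedAddCommGroup E] [NormedSpace ℝ E]
variable {ρ : Measure (EuclideanSpace ℝ (Fin d))} [IsFiniteMeasure ρ]
  {F : EuclideanSpace ℝ (Fin d) → E} {g : EuclideanSpace ℝ (Fin d) → ℝ}

lemma norm_mconv_le_mconv_norm (hg0 : ∀ x, 0 ≤ g x) (x : EuclideanSpace ℝ (Fin d)) :
    ‖mconv ρ F g x‖ ≤ mconv ρ (fun y => ‖F y‖) g x := by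
  unfold mconv
  refine (norm_integral_le_integral_norm _).trans_eq ?_
  simp [norm_smul, abs_of_nonneg (hg0 _)]

lemma mconv_nonneg {B : EuclideanSpace ℝ (Fin d) → ℝ} (hB0 : ∀ y, 0 ≤ B y) (hg0 : ∀ x, 0 ≤ g x)
    (x : EuclideanSpace ℝ (Fin d)) : 0 ≤ mconv ρ B g x :=
  integral_nonneg fun y => mul_nonneg (hg0 _) (hB0 y)

lemma norm_mconv_sub_le {F' : EuclideanSpace ℝ (Fin d) → E} (hF : StronglyMeasurable F)
    (hF1 : ∀ y, ‖F y‖ ≤ 1) (hF' : StronglyMeasurable F') (hF1' : ∀ y, ‖F' y‖ ≤ 1)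
    {B : EuclideanSpace ℝ (Fin d) → ℝ} (hB : StronglyMeasurable B)
    (hB1 : ∀ y, ‖B y‖ ≤ 1) {c : ℝ} (h : ∀ y, ‖F y - F' y‖ ≤ c * B y) (hg : Continuous g)
    {C : ℝ} (hC : ∀ x, |g x| ≤ C) (hg0 : ∀ x, 0 ≤ g x) (x : EuclideanSpace ℝ (Fin d)) :
    ‖mconv ρ F g x - mconv ρ F' g x‖ ≤ c * mconv ρ B g x := by
  unfold mconv
  rw [← integral_sub (integrable_mconv_integrand hF hF1 hg hC x)
    (integrable_mconv_integrand hF' hF1' hg hC x), ← integral_const_mul]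
  refine norm_integral_le_of_norm_le ((integrable_mconv_integrand hB hB1 hg hC x).const_mul c)
    (ae_of_all _ fun y => ?_)
  rw [← smul_sub, norm_smul, Real.norm_of_nonneg (hg0 _), smul_eq_mul, mul_left_comm]
  exact mul_le_mul_of_nonneg_left (h y) (hg0 _)

lemma mconv_const [CompleteSpace E] (M : E) (x : EuclideanSpace ℝ (Fin d)) :
    mconv ρ (fun _ => M) g x = mconv ρ (fun _ => (1 : ℝ)) g x • M := by
  unfold mconv
  simp [integral_smul_const]

lemma integrable_weight_mul_mconv {B : EuclideanSpace ℝ (Fin d) → ℝ} (hB : StronglyMeasurable B)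
    (hB1 : ∀ y, ‖B y‖ ≤ 1) (hg : Continuous g) {C : ℝ} (hC : ∀ x, |g x| ≤ C) :
    Integrable (fun x => japWeight (d + 2) x * mconv ρ B g x) := by
  refine (integrable_japWeight (by omega)).mul_bdd (c := C * ρ.real univ)
    (continuous_mconv hB hB1 hg hC).aestronglyMeasurable
    (ae_of_all _ fun x => norm_mconv_le hB1 hC x)

lemma integral_weight_mul_mconv_le {N : ℝ} {t : ℝ} (ht : 0 < t)
    (hN : ∀ y : EuclideanSpace ℝ (Fin d),
      ∫ x, japWeight (d + 2) x * heatK t (x - y) ≤ N * japWeight (d + 2) y)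
    {B : EuclideanSpace ℝ (Fin d) → ℝ} (hB : StronglyMeasurable B) (hB0 : ∀ y, 0 ≤ B y)
    (hB1 : ∀ y, ‖B y‖ ≤ 1) :
    ∫ x, japWeight (d + 2) x * mconv ρ B (heatK t) x ≤ N * ∫ y, japWeight (d + 2) y * B y ∂ρ := by
  unfold mconv
  simp_rw [← integral_const_mul]
  have hC : ∀ z : EuclideanSpace ℝ (Fin d), |heatK t z| ≤ t ^ (-(d : ℝ) / 2) := fun z =>
    (abs_of_nonneg (heatK_nonneg ht z)).trans_le (heatK_le ht z)
  have hw : Integrable (japWeight (d + 2) : EuclideanSpace ℝ (Fin d) → ℝ) :=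
    integrable_japWeight (by omega)
  have hintg : Integrable (Function.uncurry fun (x y : EuclideanSpace ℝ (Fin d)) =>
      japWeight (d + 2) x * heatK t (x - y) • B y) (volume.prod ρ) := by
    have h1 : Integrable (fun p : EuclideanSpace ℝ (Fin d) × EuclideanSpace ℝ (Fin d) =>
      japWeight (d + 2) p.1) (volume.prod ρ) := hw.comp_fst ρ
    have h2 : AEStronglyMeasurable (fun p : EuclideanSpace ℝ (Fin d) × EuclideanSpace ℝ (Fin d) =>
        heatK t (p.1 - p.2) • B p.2) (volume.prod ρ) := by
      refine StronglyMeasurable.aestronglyMeasurable ?_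
      exact ((continuous_heatK t).comp (by fun_prop :
        Continuous fun p : EuclideanSpace ℝ (Fin d) × EuclideanSpace ℝ (Fin d) =>
          p.1 - p.2)).stronglyMeasurable.smul (hB.comp_measurable measurable_snd)
    have h3 := h1.mul_bdd (c := t ^ (-(d : ℝ) / 2)) h2
      (ae_of_all _ fun p => norm_smul_le_of_abs_le (hC _) (hB1 _))
    exact h3
  rw [integral_integral_swap hintg]
  have hBw : Integrable (fun y => N * (japWeight (d + 2) y * B y)) ρ := by
    refine Integrable.const_mul (Integrable.of_bound
      ((continuous_japWeight _).stronglyMeasurable.mul hB).aestronglyMeasurable 1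
      (ae_of_all _ fun y => ?_)) N
    rw [Pi.mul_apply, norm_mul, Real.norm_of_nonneg (japWeight_pos _ _).le]
    exact mul_le_one₀ (japWeight_le_one _ _) (norm_nonneg _) (hB1 y)
  refine integral_mono hintg.integral_prod_right hBw fun y => ?_
  have : ∀ x, japWeight (d + 2) x * heatK t (x - y) • B y =
      (japWeight (d + 2) x * heatK t (x - y)) * B y := fun x => by rw [smul_eq_mul]; ring
  simp only [this]
  rw [integral_mul_const, ← mul_assoc]
  exact mul_le_mul_of_nonneg_right (hN y) (hB0 y)

end

section
variable {d : ℕ}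

lemma contDiff_heatK (t : ℝ) {n : WithTop ℕ∞} :
    ContDiff ℝ n (heatK t : EuclideanSpace ℝ (Fin d) → ℝ) := by
  unfold heatK
  exact contDiff_const.mul (((contDiff_norm_sq ℝ).div_const t).neg.div_const 4).exp

lemma exists_defect_le (d : ℕ) : ∃ C : ℝ, 0 < C ∧ ∀ (ρ : Measure (EuclideanSpace ℝ (Fin d)))
    [IsFiniteMeasure ρ] (L : ℝ), 1 ≤ L → ∀ t : ℝ, 0 < t → t ≤ 1 → ∀ x : EuclideanSpace ℝ (Fin d),
    ‖x‖ ≤ 2 * L → ∀ (F₁ F₂ : EuclideanSpace ℝ (Fin d) → ℝ), StronglyMeasurable F₁ →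
    (∀ y, ‖F₁ y‖ ≤ 1) → StronglyMeasurable F₂ → (∀ y, ‖F₂ y‖ ≤ 1) → ∀ i₁ i₂ : Fin d,
    (∀ φ : EuclideanSpace ℝ (Fin d) → ℝ, ContDiff ℝ (⊤ : ℕ∞) φ → HasCompactSupport φ →
      tsupport φ ⊆ ball 0 (9 * L) →
      ∫ y, pderiv' i₁ φ y * F₁ y ∂ρ = ∫ y, pderiv' i₂ φ y * F₂ y ∂ρ) →
    |mconv ρ F₁ (heatK1 i₁ t) x - mconv ρ F₂ (heatK1 i₂ t) x| ≤
      C / L * ∫ y, japWeight (d + 2) y ∂ρ := by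
  obtain ⟨C₀, hC₀, hfar⟩ := exists_heatK_far_le d
  let θ : ContDiffBump (0 : EuclideanSpace ℝ (Fin d)) := ⟨1, 2, one_pos, one_lt_two⟩
  have hθs : ContDiff ℝ (⊤ : ℕ∞) θ := θ.contDiff
  obtain ⟨D, hD⟩ := (θ.hasCompactSupport.fderiv (𝕜 := ℝ)).exists_bound_of_continuous
    (hθs.continuous_fderiv (by simp))
  have hD0 : 0 ≤ D := (norm_nonneg _).trans (hD 0)
  refine ⟨2 * ((1 + D) * C₀), by positivity, ?_⟩
  intro ρ _ L hL t ht ht1 x hx F₁ F₂ hF₁ hF₁1 hF₂ hF₂1 i₁ i₂ hcl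
  have hL0 : 0 < L := one_pos.trans_le hL
  set η : EuclideanSpace ℝ (Fin d) → ℝ := fun y => θ ((4 * L)⁻¹ • y) with hη
  have hηs : ContDiff ℝ (⊤ : ℕ∞) η := hθs.comp (contDiff_const_smul _)
  have hη1 : ∀ y, ‖y‖ ≤ 4 * L → η y = 1 := by
    intro y hy
    refine θ.one_of_mem_closedBall ?_
    rw [mem_closedBall_zero_iff, norm_smul, norm_inv, Real.norm_of_nonneg (by positivity)]
    change _ ≤ (1 : ℝ)
    rw [inv_mul_le_iff₀ (by positivity)]
    linarith
  have hη0 : ∀ y, 8 * L ≤ ‖y‖ → η y = 0 := by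
    intro y hy
    refine θ.zero_of_le_dist ?_
    rw [dist_zero_right, norm_smul, norm_inv, Real.norm_of_nonneg (by positivity)]
    change (2 : ℝ) ≤ _
    rw [le_inv_mul_iff₀ (by positivity)]
    linarith
  set φ : EuclideanSpace ℝ (Fin d) → ℝ := fun y => η y * heatK t (x - y) with hφ
  have hφs : ContDiff ℝ (⊤ : ℕ∞) φ :=
    hηs.mul ((contDiff_heatK t).comp (contDiff_const.sub contDiff_id))
  have hsup : tsupport φ ⊆ closedBall 0 (8 * L) := by
    refine closure_minimal (fun y hy => ?_) isClosed_closedBall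
    rw [mem_closedBall_zero_iff]
    by_contra! h
    exact hy (by simp [hφ, hη0 y h.le])
  have hφc : HasCompactSupport φ :=
    (isCompact_closedBall 0 (8 * L)).of_isClosed_subset (isClosed_tsupport _) hsup
  have hsup' : tsupport φ ⊆ ball 0 (9 * L) :=
    hsup.trans (closedBall_subset_ball (by linarith))
  have hder : ∀ (i : Fin d) y, pderiv' i φ y =
      pderiv' i η y * heatK t (x - y) - η y * heatK1 i t (x - y) := by
    intro i y
    have h1 : HasLineDerivAt ℝ η (pderiv' i η y) y (EuclideanSpace.single i 1) :=
      ((hηs.differentiable (by simp)) y).hasFDerivAt.hasLineDerivAt _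
    have h2 : HasLineDerivAt ℝ φ (pderiv' i φ y) y (EuclideanSpace.single i 1) :=
      ((hφs.differentiable (by simp)) y).hasFDerivAt.hasLineDerivAt _
    have h3 : HasLineDerivAt ℝ (fun y => heatK t (x - y)) (- heatK1 i t (x - y)) y
        (EuclideanSpace.single i 1) := by
      have h4 := (hasLineDerivAt_heatK t i (x - y))
      unfold HasLineDerivAt at h4 ⊢
      have h5 := h4.scomp_of_eq 0 (h := fun r : ℝ => -r) (h' := -1) (hasDerivAt_neg (0 : ℝ)) (by simp)
      convert! h5 using 1
      · funext r
        simp only [Function.comp]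
        congr 1
        module
      · simp
    have h4 := HasDerivAt.mul h1 h3
    refine h2.unique (h4.congr_deriv ?_)
    simp
    ring
  have hpη : ∀ (i : Fin d) y, |pderiv' i η y| ≤ D := by
    intro i y
    have h1 : HasLineDerivAt ℝ η (pderiv' i η y) y (EuclideanSpace.single i 1) :=
      ((hηs.differentiable (by simp)) y).hasFDerivAt.hasLineDerivAt _
    have h5 : HasFDerivAt θ (fderiv ℝ θ ((4 * L)⁻¹ • y)) ((4 * L)⁻¹ • y) :=
      (hθs.differentiable (by simp) _).hasFDerivAt
    have h2 : HasFDerivAt η ((fderiv ℝ θ ((4 * L)⁻¹ • y)).comp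
        ((4 * L)⁻¹ • ContinuousLinearMap.id ℝ (EuclideanSpace ℝ (Fin d)))) y :=
      HasFDerivAt.comp (g := θ) y h5
        (((4 * L)⁻¹ • ContinuousLinearMap.id ℝ (EuclideanSpace ℝ (Fin d))).hasFDerivAt (x := y))
    rw [h1.unique (h2.hasLineDerivAt _)]
    simp only [ContinuousLinearMap.comp_apply, _root_.smul_apply,
      ContinuousLinearMap.id_apply, map_smul, smul_eq_mul]
    rw [abs_mul, abs_of_nonneg (by positivity : (0 : ℝ) ≤ (4 * L)⁻¹)]
    have h3 : |fderiv ℝ θ ((4 * L)⁻¹ • y) (EuclideanSpace.single i 1)| ≤ D := by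
      refine ((fderiv ℝ θ ((4 * L)⁻¹ • y)).le_opNorm _).trans ?_
      simpa using hD _
    have h4 : (4 * L)⁻¹ ≤ 1 := inv_le_one_of_one_le₀ (by linarith)
    calc (4 * L)⁻¹ * _ ≤ 1 * D := by gcongr
      _ = D := one_mul D
  have hpη0 : ∀ (i : Fin d) y, ‖y‖ < 4 * L → pderiv' i η y = 0 := by
    intro i y hy
    have : η =ᶠ[𝓝 y] fun _ => 1 := by
      filter_upwards [isOpen_ball.mem_nhds (mem_ball_zero_iff.2 hy)] with z hz
      exact hη1 z (mem_ball_zero_iff.1 hz).le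
    unfold pderiv'
    rw [this.fderiv_eq]
    simp
  have hη01 : ∀ y, |1 - η y| ≤ 1 := by
    intro y
    rw [abs_of_nonneg (sub_nonneg.2 θ.le_one)]
    linarith [(θ.nonneg : 0 ≤ θ ((4 * L)⁻¹ • y))]
  have herr : ∀ (i : Fin d) y, |pderiv' i φ y + heatK1 i t (x - y)| ≤
      (1 + D) * (C₀ / L * japWeight (d + 2) y) := by
    intro i y
    rw [hder]
    have hp : 0 ≤ C₀ / L * japWeight (d + 2) y := mul_nonneg (by positivity) (japWeight_pos _ _).le
    rcases lt_or_ge ‖y‖ (4 * L) with hy | hy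
    · rw [hpη0 i y hy, hη1 y hy.le]
      simp
      positivity
    · obtain ⟨k1, k2⟩ := hfar L hL t ht ht1 x y hx hy
      rw [show pderiv' i η y * heatK t (x - y) - η y * heatK1 i t (x - y) + heatK1 i t (x - y) =
        pderiv' i η y * heatK t (x - y) + (1 - η y) * heatK1 i t (x - y) by ring]
      refine (abs_add_le _ _).trans ?_
      rw [abs_mul, abs_mul, abs_of_nonneg (heatK_nonneg ht _)]
      have e1 := mul_le_mul (hpη i y) k1 (heatK_nonneg ht _) hD0
      have e2 := mul_le_mul (hη01 y) (k2 i) (abs_nonneg _) zero_le_one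
      linarith
  have hwint : Integrable (japWeight (d + 2)) ρ := Integrable.of_bound
    (continuous_japWeight _).aestronglyMeasurable 1 (ae_of_all _ fun y => by
      rw [Real.norm_of_nonneg (japWeight_pos _ _).le]; exact japWeight_le_one _ _)
  have hφ'c : ∀ i : Fin d, Continuous (pderiv' i φ) := fun i =>
    (hφs.continuous_fderiv (by simp)).clm_apply continuous_const
  have hφint : ∀ (i : Fin d) (F : EuclideanSpace ℝ (Fin d) → ℝ), StronglyMeasurable F →
      (∀ y, ‖F y‖ ≤ 1) → Integrable (fun y => pderiv' i φ y * F y) ρ := by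
    intro i F hF hF1
    obtain ⟨A, hA⟩ := (hφc.fderiv (𝕜 := ℝ)).exists_bound_of_continuous
      (hφs.continuous_fderiv (by simp))
    refine Integrable.of_bound ((hφ'c i).stronglyMeasurable.mul hF).aestronglyMeasurable A
      (ae_of_all _ fun y => ?_)
    refine norm_smul_le_of_abs_le (E := ℝ) ?_ (hF1 y)
    refine ((fderiv ℝ φ y).le_opNorm _).trans ?_
    simpa using hA _
  have hone : ∀ (i : Fin d) (F : EuclideanSpace ℝ (Fin d) → ℝ), StronglyMeasurable F →
      (∀ y, ‖F y‖ ≤ 1) → |mconv ρ F (heatK1 i t) x + ∫ y, pderiv' i φ y * F y ∂ρ| ≤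
        (1 + D) * (C₀ / L * ∫ y, japWeight (d + 2) y ∂ρ) := by
    intro i F hF hF1
    unfold mconv
    rw [← integral_add (integrable_mconv_integrand hF hF1 (continuous_heatK1 i t)
      (abs_heatK1_le ht i) x) (hφint i F hF hF1), ← integral_const_mul, ← integral_const_mul,
      ← Real.norm_eq_abs]
    refine norm_integral_le_of_norm_le ((hwint.const_mul _).const_mul _) (ae_of_all _ fun y => ?_)
    rw [smul_eq_mul, ← add_mul, add_comm]
    exact norm_smul_le_of_abs_le (E := ℝ) (herr i y) (hF1 y)
  have e1 := hone i₁ F₁ hF₁ hF₁1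
  have e2 := hone i₂ F₂ hF₂ hF₂1
  rw [hcl φ hφs hφc hsup'] at e1
  have e3 := abs_sub (mconv ρ F₁ (heatK1 i₁ t) x + ∫ y, pderiv' i₂ φ y * F₂ y ∂ρ)
    (mconv ρ F₂ (heatK1 i₂ t) x + ∫ y, pderiv' i₂ φ y * F₂ y ∂ρ)
  rw [add_sub_add_right_eq_sub] at e3
  refine e3.trans ((add_le_add e1 e2).trans_eq ?_)
  field_simp
  ring

end

section
variable {d : ℕ}

lemma hasDerivAt_max_zero_pow (n : ℕ) (s : ℝ) :
    HasDerivAt (fun s : ℝ => (max s 0) ^ (n + 2)) ((n + 2) * (max s 0) ^ (n + 1)) s := by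
  rcases lt_trichotomy s 0 with hs | hs | hs
  · rw [max_eq_right hs.le]
    have h : (fun s : ℝ => (max s 0) ^ (n + 2)) =ᶠ[𝓝 s] fun _ => 0 := by
      filter_upwards [Iio_mem_nhds hs] with r hr
      rw [max_eq_right (le_of_lt hr)]
      simp
    simpa using (hasDerivAt_const s (0 : ℝ)).congr_of_eventuallyEq h
  · subst hs
    rw [hasDerivAt_iff_isLittleO]
    simp only [max_self, ne_eq, Nat.add_eq_zero_iff, OfNat.ofNat_ne_zero, and_false,
      not_false_eq_true, zero_pow, sub_zero, one_ne_zero, mul_zero, smul_zero]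
    have h1 : (fun x : ℝ => (max x 0) ^ (n + 2)) =O[𝓝 0] fun x : ℝ => x ^ (n + 2) := by
      refine Asymptotics.IsBigO.of_bound 1 (Eventually.of_forall fun x => ?_)
      rw [one_mul, norm_pow, norm_pow]
      refine pow_le_pow_left₀ (norm_nonneg _) ?_ _
      rw [Real.norm_eq_abs, Real.norm_eq_abs, abs_of_nonneg (le_max_right _ _)]
      exact max_le (le_abs_self x) (abs_nonneg x)
    refine h1.trans_isLittleO ?_
    have := Asymptotics.isLittleO_pow_pow (𝕜 := ℝ) (m := 1) (n := n + 2) (by omega)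
    simpa using this
  · rw [max_eq_left hs.le]
    have h : (fun s : ℝ => (max s 0) ^ (n + 2)) =ᶠ[𝓝 s] fun s => s ^ (n + 2) := by
      filter_upwards [Ioi_mem_nhds hs] with r hr
      rw [max_eq_left (le_of_lt hr)]
    simpa using (hasDerivAt_pow (n + 2) s).congr_of_eventuallyEq h

lemma hasLineDerivAt_japWeight (k : ℕ) (x : EuclideanSpace ℝ (Fin d)) (i : Fin d) :
    HasLineDerivAt ℝ (japWeight k) (-2 * k * x i * ((1 + ‖x‖ ^ 2)⁻¹) ^ (k + 1)) x
      (EuclideanSpace.single i 1) := by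
  have h := ((hasDerivAt_norm_sq_line x i).const_add 1).inv (by simp; positivity)
  have h2 := h.pow k
  unfold HasLineDerivAt
  refine (h2.congr_deriv ?_).congr_of_eventuallyEq (Eventually.of_forall fun s => ?_)
  · rcases k with _ | k
    · simp
    · simp
      have : (1 + ‖x‖ ^ 2) ≠ 0 := by positivity
      field_simp
      ring
  · simp [japWeight, inv_pow]

lemma hasLineDerivAt_japWeight_deriv (k : ℕ) (x : EuclideanSpace ℝ (Fin d)) (i : Fin d) :
    HasLineDerivAt ℝ (fun x : EuclideanSpace ℝ (Fin d) =>
        -2 * k * x i * ((1 + ‖x‖ ^ 2)⁻¹) ^ (k + 1))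
      (-2 * k * ((1 + ‖x‖ ^ 2)⁻¹) ^ (k + 1) +
        4 * k * (k + 1) * (x i) ^ 2 * ((1 + ‖x‖ ^ 2)⁻¹) ^ (k + 2)) x
      (EuclideanSpace.single i 1) := by
  have h1 := (hasLineDerivAt_coord x i)
  have h2 := (hasLineDerivAt_japWeight (k + 1) x i)
  unfold HasLineDerivAt at *
  have h3 := (h1.const_mul (-2 * k : ℝ)).mul h2
  refine (h3.congr_deriv ?_).congr_of_eventuallyEq (Eventually.of_forall fun s => ?_)
  · simp [japWeight, inv_pow]
    ring
  · simp [japWeight, inv_pow]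

lemma hasDerivAt_max_sub_pow (n : ℕ) (η s : ℝ) :
    HasDerivAt (fun s : ℝ => (max (s - η) 0) ^ (n + 2)) ((n + 2) * (max (s - η) 0) ^ (n + 1)) s :=
  (hasDerivAt_max_zero_pow n (s - η)).comp_sub_const s η

lemma exists_cutoff (d : ℕ) : ∃ C c : ℝ, 0 < C ∧ 0 < c ∧ ∀ L : ℝ, 1 ≤ L →
    ∃ (ζ : EuclideanSpace ℝ (Fin d) → ℝ) (ζ₁ ζ₂ : Fin d → EuclideanSpace ℝ (Fin d) → ℝ),
      Continuous ζ ∧ (∀ i, Continuous (ζ₁ i)) ∧ (∀ i, Continuous (ζ₂ i)) ∧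
      (∀ i x, HasLineDerivAt ℝ ζ (ζ₁ i x) x (EuclideanSpace.single i 1)) ∧
      (∀ i x, HasLineDerivAt ℝ (ζ₁ i) (ζ₂ i x) x (EuclideanSpace.single i 1)) ∧
      (∀ x, 0 ≤ ζ x) ∧ (∀ x, ζ x ≤ japWeight (d + 2) x) ∧
      (∀ x, 2 * L < ‖x‖ → ζ x = 0 ∧ ∀ i, ζ₁ i x = 0 ∧ ζ₂ i x = 0) ∧
      (∀ i x, ζ₂ i x ≤ C * (ζ x + japWeight (d + 2) x / L)) ∧
      (∀ x, ‖x‖ ≤ 1 → c ≤ ζ x) := by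
  set k := d + 2 with hk
  refine ⟨96 * k ^ 2 + 6 * (2 * k + 4 * k * (k + 1)), ((2 ^ (k + 1))⁻¹) ^ 3, by positivity,
    by positivity, ?_⟩
  intro L hL
  have hL0 : 0 < L := one_pos.trans_le hL
  set η : ℝ := ((1 + (2 * L) ^ 2) ^ k)⁻¹ with hη
  have hη0 : 0 < η := by positivity
  have hη1 : η ≤ (2 ^ (k + 1))⁻¹ := by
    rw [hη]
    refine inv_anti₀ (by positivity) ?_
    calc (2 : ℝ) ^ (k + 1) ≤ 2 ^ (2 * k) := pow_le_pow_right₀ one_le_two (by omega)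
      _ = 4 ^ k := by rw [pow_mul]; norm_num
      _ ≤ _ := pow_le_pow_left₀ (by norm_num) (by nlinarith) k
  have hη2 : η ^ 2 ≤ 1 / L := by
    have h1 : η ≤ 1 / L := by
      rw [hη, one_div]
      refine inv_anti₀ hL0 ?_
      calc L ≤ 1 + (2 * L) ^ 2 := by nlinarith
        _ = (1 + (2 * L) ^ 2) ^ 1 := (pow_one _).symm
        _ ≤ _ := pow_le_pow_right₀ (by nlinarith) (by omega)
    have h2 : η ≤ 1 := hη1.trans (inv_le_one_of_one_le₀ (one_le_pow₀ one_le_two))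
    nlinarith
  set m : EuclideanSpace ℝ (Fin d) → ℝ := fun x => max (japWeight k x - η) 0 with hm
  set w1 : Fin d → EuclideanSpace ℝ (Fin d) → ℝ := fun i x =>
    -2 * k * x i * ((1 + ‖x‖ ^ 2)⁻¹) ^ (k + 1) with hw1
  set w2 : Fin d → EuclideanSpace ℝ (Fin d) → ℝ := fun i x =>
    -2 * k * ((1 + ‖x‖ ^ 2)⁻¹) ^ (k + 1) +
        4 * k * (k + 1) * (x i) ^ 2 * ((1 + ‖x‖ ^ 2)⁻¹) ^ (k + 2) with hw2
  have hq : Continuous fun x : EuclideanSpace ℝ (Fin d) => (1 + ‖x‖ ^ 2)⁻¹ :=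
    Continuous.inv₀ (by fun_prop) fun x => by positivity
  have hmc : Continuous m := ((continuous_japWeight k).sub continuous_const).max continuous_const
  have hw1c : ∀ i, Continuous (w1 i) := fun i => by
    have : Continuous fun x : EuclideanSpace ℝ (Fin d) => x i := by fun_prop
    exact (continuous_const.mul this).mul (hq.pow _)
  have hw2c : ∀ i, Continuous (w2 i) := fun i => by
    have : Continuous fun x : EuclideanSpace ℝ (Fin d) => x i := by fun_prop
    exact (continuous_const.mul (hq.pow _)).add ((continuous_const.mul (this.pow 2)).mul (hq.pow _))
  have hm0 : ∀ x, 0 ≤ m x := fun x => le_max_right _ _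
  have hmw : ∀ x, m x ≤ japWeight k x := fun x =>
    max_le (by linarith) (japWeight_pos k x).le
  have hmz : ∀ x, 2 * L < ‖x‖ → m x = 0 := by
    intro x hx
    refine max_eq_right (sub_nonpos.2 ?_)
    rw [hη, japWeight]
    exact inv_anti₀ (by positivity) (pow_le_pow_left₀ (by positivity) (by gcongr) k)
  have hqx : ∀ (i : Fin d) (x : EuclideanSpace ℝ (Fin d)), (x i) ^ 2 * (1 + ‖x‖ ^ 2)⁻¹ ≤ 1 := by
    intro i x
    rw [← div_eq_mul_inv, div_le_one (by positivity)]
    have := sq_le_sq' (abs_le.1 (abs_coord_le x i)).1 (abs_le.1 (abs_coord_le x i)).2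
    linarith
  have hwq : ∀ x : EuclideanSpace ℝ (Fin d), ((1 + ‖x‖ ^ 2)⁻¹) ^ k = japWeight k x := fun x => by
    rw [japWeight, inv_pow]
  have hq0 : ∀ x : EuclideanSpace ℝ (Fin d), 0 < (1 + ‖x‖ ^ 2)⁻¹ := fun x => by positivity
  have hq1 : ∀ x : EuclideanSpace ℝ (Fin d), (1 + ‖x‖ ^ 2)⁻¹ ≤ 1 := fun x =>
    inv_le_one_of_one_le₀ (by nlinarith [sq_nonneg ‖x‖])
  have hw1b : ∀ i x, (w1 i x) ^ 2 ≤ 4 * k ^ 2 * (japWeight k x) ^ 2 := by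
    intro i x
    have h1 : (w1 i x) ^ 2 = 4 * k ^ 2 * (japWeight k x) ^ 2 *
        ((x i ^ 2 * (1 + ‖x‖ ^ 2)⁻¹) * (1 + ‖x‖ ^ 2)⁻¹) := by
      rw [hw1, ← hwq]
      ring
    rw [h1]
    refine mul_le_of_le_one_right (by positivity) ?_
    exact mul_le_one₀ (hqx i x) (hq0 x).le (hq1 x)
  have hw2b : ∀ i x, w2 i x ≤ (2 * k + 4 * k * (k + 1)) * japWeight k x := by
    intro i x
    have h1 : w2 i x = japWeight k x * (-2 * k * (1 + ‖x‖ ^ 2)⁻¹ +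
        4 * k * (k + 1) * ((x i ^ 2 * (1 + ‖x‖ ^ 2)⁻¹) * (1 + ‖x‖ ^ 2)⁻¹)) := by
      rw [hw2, ← hwq]
      ring
    rw [h1, mul_comm]
    refine mul_le_mul_of_nonneg_right ?_ (japWeight_pos k x).le
    have e1 := mul_le_one₀ (hqx i x) (hq0 x).le (hq1 x)
    have e2 : (0 : ℝ) ≤ 2 * k * (1 + ‖x‖ ^ 2)⁻¹ := mul_nonneg (by positivity) (hq0 x).le
    have e3 : 4 * k * (k + 1) * ((x i ^ 2 * (1 + ‖x‖ ^ 2)⁻¹) * (1 + ‖x‖ ^ 2)⁻¹) ≤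
      4 * (k : ℝ) * (k + 1) * 1 := mul_le_mul_of_nonneg_left e1 (by positivity)
    have e4 : (0 : ℝ) ≤ 2 * k := by positivity
    linarith
  refine ⟨fun x => m x ^ 3, fun i x => 3 * m x ^ 2 * w1 i x,
    fun i x => 6 * m x * w1 i x ^ 2 + 3 * m x ^ 2 * w2 i x, hmc.pow 3,
    fun i => (continuous_const.mul (hmc.pow 2)).mul (hw1c i),
    fun i => ((continuous_const.mul hmc).mul ((hw1c i).pow 2)).add
      ((continuous_const.mul (hmc.pow 2)).mul (hw2c i)), ?_, ?_, fun x => pow_nonneg (hm0 x) 3, ?_,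
    ?_, ?_, ?_⟩
  · intro i x
    have h1 := hasLineDerivAt_japWeight k x i
    have h2 := (hasDerivAt_max_sub_pow 1 η (japWeight k x)).comp_of_eq 0 h1 (by simp)
    refine h2.congr_deriv ?_
    simp only [hm, hw1, Nat.cast_one]
    ring
  · intro i x
    have h1 := hasLineDerivAt_japWeight k x i
    have h2 := (hasDerivAt_max_sub_pow 0 η (japWeight k x)).comp_of_eq 0 h1 (by simp)
    have h3 := hasLineDerivAt_japWeight_deriv k x i
    have h4 := (h2.const_mul 3).mul h3
    refine h4.congr_deriv ?_
    simp [hm, hw1, hw2]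
    ring
  · intro x
    have h1 : m x ≤ 1 := (hmw x).trans (japWeight_le_one _ _)
    calc m x ^ 3 ≤ m x := pow_le_of_le_one (hm0 x) h1 (by norm_num)
      _ ≤ _ := hmw x
  · intro x hx
    simp [hmz x hx]
  · intro i x
    set W := japWeight k x with hW
    have hW0 : 0 < W := japWeight_pos k x
    have a1 : 6 * m x * w1 i x ^ 2 ≤ 6 * m x * (4 * k ^ 2 * W ^ 2) :=
      mul_le_mul_of_nonneg_left (hw1b i x) (mul_nonneg (by norm_num) (hm0 x))
    have a2 : 3 * m x ^ 2 * w2 i x ≤ 3 * m x ^ 2 * ((2 * k + 4 * k * (k + 1)) * W) :=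
      mul_le_mul_of_nonneg_left (hw2b i x) (by positivity)
    have a3 : m x * W ^ 2 ≤ 4 * (m x ^ 3 + W / L) ∧ m x ^ 2 * W ≤ 2 * (m x ^ 3 + W / L) := by
      have hWL : 0 ≤ W / L := by positivity
      have hm0x := hm0 x
      rcases le_total (2 * η) W with h | h
      · have h2 : W ≤ 2 * m x := by
          have : m x = W - η := max_eq_left (by linarith)
          linarith
        constructor
        · have : m x * W ^ 2 ≤ m x * (2 * m x) ^ 2 := by gcongr
          nlinarith
        · have : m x ^ 2 * W ≤ m x ^ 2 * (2 * m x) := by gcongr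
          nlinarith
      · have h2 : m x ≤ η := max_le (by linarith) hη0.le
        have h3 : η ^ 2 * W ≤ W / L := by
          calc η ^ 2 * W ≤ 1 / L * W := by gcongr
            _ = W / L := by ring
        have h4 : 0 ≤ m x ^ 3 := pow_nonneg hm0x 3
        constructor
        · have : m x * W ^ 2 ≤ η * (2 * η * W) := by
            rw [pow_two]
            gcongr
          nlinarith
        · have : m x ^ 2 * W ≤ η ^ 2 * W := by gcongr
          nlinarith
    have a4 : (0 : ℝ) ≤ 2 * k + 4 * k * (k + 1) := by positivity
    have a5 := mul_le_mul_of_nonneg_left a3.1 (by positivity : (0 : ℝ) ≤ 24 * k ^ 2)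
    have a6 := mul_le_mul_of_nonneg_left a3.2 (mul_nonneg (by norm_num : (0 : ℝ) ≤ 3) a4)
    calc 6 * m x * w1 i x ^ 2 + 3 * m x ^ 2 * w2 i x
        ≤ 6 * m x * (4 * k ^ 2 * W ^ 2) + 3 * m x ^ 2 * ((2 * k + 4 * k * (k + 1)) * W) :=
          add_le_add a1 a2
      _ = 24 * k ^ 2 * (m x * W ^ 2) + 3 * (2 * k + 4 * k * (k + 1)) * (m x ^ 2 * W) := by ring
      _ ≤ _ := (add_le_add a5 a6).trans_eq (by ring)
  · intro x hx
    refine pow_le_pow_left₀ (by positivity) ?_ 3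
    refine le_trans ?_ (le_max_left _ _)
    have h1 : (2 ^ k)⁻¹ ≤ japWeight k x := by
      rw [japWeight]
      refine inv_anti₀ (by positivity) (pow_le_pow_left₀ (by positivity) ?_ k)
      nlinarith [norm_nonneg x]
    have h2 : ((2 : ℝ) ^ k)⁻¹ = 2 * (2 ^ (k + 1))⁻¹ := by
      rw [pow_succ 2 k, mul_inv]
      ring
    linarith

end

section
variable {E : Type*} [NormedAddCommGroup E] [InnerProductSpace ℝ E]

/-- A smooth approximation of the norm. -/
noncomputable def smoothNorm (ε : ℝ) (Y : E) : ℝ := √(ε ^ 2 + ‖Y‖ ^ 2)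

lemma smoothNorm_pos {ε : ℝ} (hε : 0 < ε) (Y : E) : 0 < smoothNorm ε Y :=
  Real.sqrt_pos.2 (by positivity)

lemma sq_smoothNorm (ε : ℝ) (Y : E) : smoothNorm ε Y ^ 2 = ε ^ 2 + ‖Y‖ ^ 2 :=
  Real.sq_sqrt (by positivity)

lemma norm_le_smoothNorm (ε : ℝ) (Y : E) : ‖Y‖ ≤ smoothNorm ε Y :=
  Real.le_sqrt_of_sq_le (by nlinarith [sq_nonneg ε])

lemma smoothNorm_le {ε : ℝ} (hε : 0 ≤ ε) (Y : E) : smoothNorm ε Y ≤ ε + ‖Y‖ :=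
  Real.sqrt_le_iff.2 ⟨by positivity, by nlinarith [norm_nonneg Y]⟩

lemma contDiff_smoothNorm {ε : ℝ} (hε : 0 < ε) {n : WithTop ℕ∞} :
    ContDiff ℝ n (smoothNorm ε : E → ℝ) :=
  (contDiff_const.add (contDiff_norm_sq ℝ)).sqrt fun Y => by positivity

lemma hasFDerivAt_smoothNorm {ε : ℝ} (hε : 0 < ε) (Y : E) :
    HasFDerivAt (smoothNorm ε) ((smoothNorm ε Y)⁻¹ • innerSL ℝ Y) Y := by
  have h1 := ((hasStrictFDerivAt_norm_sq Y).hasFDerivAt.const_add (ε ^ 2)).sqrt (by positivity)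
  refine h1.congr_fderiv ?_
  ext X
  simp [smoothNorm]
  ring

lemma norm_fderiv_smoothNorm_le {ε : ℝ} (hε : 0 < ε) (Y : E) : ‖fderiv ℝ (smoothNorm ε) Y‖ ≤ 1 := by
  rw [(hasFDerivAt_smoothNorm hε Y).fderiv, norm_smul, innerSL_apply_norm, norm_inv,
    Real.norm_of_nonneg (smoothNorm_pos hε Y).le, inv_mul_le_iff₀ (smoothNorm_pos hε Y), mul_one]
  exact norm_le_smoothNorm ε Y

lemma fderiv_fderiv_smoothNorm {ε : ℝ} (hε : 0 < ε) (Y X : E) :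
    fderiv ℝ (fderiv ℝ (smoothNorm ε)) Y X X =
      (smoothNorm ε Y)⁻¹ * (‖X‖ ^ 2 - (inner ℝ Y X) ^ 2 / (ε ^ 2 + ‖Y‖ ^ 2)) := by
  have h0 : fderiv ℝ (smoothNorm ε : E → ℝ) = fun Y => (smoothNorm ε Y)⁻¹ • innerSL ℝ Y :=
    funext fun Y => (hasFDerivAt_smoothNorm hε Y).fderiv
  have hp := smoothNorm_pos hε Y
  have h1 := (hasDerivAt_inv hp.ne').comp_hasFDerivAt Y (hasFDerivAt_smoothNorm hε Y)
  have h2 := h1.smul ((innerSL ℝ (E := E)).hasFDerivAt (x := Y))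
  have h3 : fderiv ℝ (fun Y : E => (smoothNorm ε Y)⁻¹ • innerSL ℝ Y) Y = _ := h2.fderiv
  rw [h0, h3]
  rw [← sq_smoothNorm]
  have e1 : innerSL ℝ X X = ‖X‖ ^ 2 := real_inner_self_eq_norm_sq X
  have e2 : innerSL ℝ Y X = inner ℝ Y X := rfl
  simp
  field_simp
  rw [e1, e2]
  ring

/-- A quadratic estimate on a narrow cone around `M`, provided the form `|X|² - ⟨M, X⟩²` is
controlled from below up to the defect. -/
lemma cone_lower_bound {ι : Type*} [Fintype ι] {M Y : E} (hM : ‖M‖ = 1) {c₀ D ε : ℝ}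
    (hc₀ : 0 < c₀) (hε : 0 < ε) (X : ι → E)
    (hell : c₀ * ∑ i, ‖X i‖ ^ 2 ≤ ∑ i, ‖X i‖ ^ 2 - ∑ i, (inner ℝ M (X i)) ^ 2 + D)
    (hY : ‖Y - ‖Y‖ • M‖ ≤ c₀ / 4 * ‖Y‖) :
    c₀ / 2 * ∑ i, ‖X i‖ ^ 2 - D ≤
      ∑ i, (‖X i‖ ^ 2 - (inner ℝ Y (X i)) ^ 2 / (ε ^ 2 + ‖Y‖ ^ 2)) := by
  have h1 : ∀ i, (inner ℝ Y (X i)) ^ 2 / (ε ^ 2 + ‖Y‖ ^ 2) ≤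
      (inner ℝ M (X i)) ^ 2 + c₀ / 2 * ‖X i‖ ^ 2 := by
    intro i
    rw [div_le_iff₀ (by positivity)]
    have e1 : inner ℝ (Y - ‖Y‖ • M) (X i) = inner ℝ Y (X i) - ‖Y‖ * inner ℝ M (X i) := by
      rw [inner_sub_left, real_inner_smul_left]
    have e2 : |inner ℝ Y (X i) - ‖Y‖ * inner ℝ M (X i)| ≤ c₀ / 4 * ‖Y‖ * ‖X i‖ := by
      rw [← e1]
      exact (abs_real_inner_le_norm _ _).trans (by gcongr)
    have e3 : |inner ℝ Y (X i) + ‖Y‖ * inner ℝ M (X i)| ≤ 2 * ‖Y‖ * ‖X i‖ := by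
      have k1 := abs_real_inner_le_norm Y (X i)
      have k2 := abs_real_inner_le_norm M (X i)
      rw [hM, one_mul] at k2
      refine (abs_add_le _ _).trans ?_
      rw [abs_mul, abs_norm]
      nlinarith [norm_nonneg Y]
    have e4 : (inner ℝ Y (X i)) ^ 2 - ‖Y‖ ^ 2 * (inner ℝ M (X i)) ^ 2 ≤
        c₀ / 2 * ‖Y‖ ^ 2 * ‖X i‖ ^ 2 := by
      calc (inner ℝ Y (X i)) ^ 2 - ‖Y‖ ^ 2 * (inner ℝ M (X i)) ^ 2
          = (inner ℝ Y (X i) - ‖Y‖ * inner ℝ M (X i)) *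
            (inner ℝ Y (X i) + ‖Y‖ * inner ℝ M (X i)) := by ring
        _ ≤ |inner ℝ Y (X i) - ‖Y‖ * inner ℝ M (X i)| *
            |inner ℝ Y (X i) + ‖Y‖ * inner ℝ M (X i)| := by
            rw [← abs_mul]; exact le_abs_self _
        _ ≤ (c₀ / 4 * ‖Y‖ * ‖X i‖) * (2 * ‖Y‖ * ‖X i‖) := by gcongr
        _ = _ := by ring
    have e5 : 0 ≤ ((inner ℝ M (X i)) ^ 2 + c₀ / 2 * ‖X i‖ ^ 2) * ε ^ 2 := by positivity
    nlinarith
  have h2 : ∑ i, (inner ℝ Y (X i)) ^ 2 / (ε ^ 2 + ‖Y‖ ^ 2) ≤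
      ∑ i, (inner ℝ M (X i)) ^ 2 + c₀ / 2 * ∑ i, ‖X i‖ ^ 2 := by
    rw [Finset.mul_sum, ← Finset.sum_add_distrib]
    exact Finset.sum_le_sum fun i _ => h1 i
  rw [Finset.sum_sub_distrib]
  linarith

lemma inner_sq_div_le (ε : ℝ) (Y X : E) :
    (inner ℝ Y X) ^ 2 / (ε ^ 2 + ‖Y‖ ^ 2) ≤ ‖X‖ ^ 2 := by
  refine div_le_of_le_mul₀ (by positivity) (by positivity) ?_
  have := sq_le_sq' (abs_le.1 (abs_real_inner_le_norm Y X)).1 (abs_le.1 (abs_real_inner_le_norm Y X)).2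
  nlinarith [sq_nonneg (ε * ‖X‖)]

open Manifold ContDiff in
lemma exists_cone_bump [FiniteDimensional ℝ E] {M : E} (hM : ‖M‖ = 1) {c a₁ a₂ : ℝ} (hc : 0 < c)
    (ha₁ : 0 < a₁) : ∃ ψ : E → ℝ, ContDiff ℝ ∞ ψ ∧ (∀ Y, 0 ≤ ψ Y) ∧ (∀ Y, ψ Y ≤ 1) ∧
      (∀ s ∈ Icc a₁ a₂, ψ (s • M) = 1) ∧ (∀ Y, ‖Y‖ < a₁ / 2 → ψ Y = 0) ∧
      tsupport ψ ⊆ {Y | ‖Y - ‖Y‖ • M‖ ≤ c * ‖Y‖ ∧ ‖Y‖ ≤ a₂ + 1} := by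
  set T : Set E := {Y | ‖Y - ‖Y‖ • M‖ < c * ‖Y‖} ∩ {Y | a₁ / 2 < ‖Y‖} ∩ {Y | ‖Y‖ < a₂ + 1} with hT
  have hTo : IsOpen T := ((isOpen_lt (by fun_prop) (by fun_prop)).inter
    (isOpen_lt (by fun_prop) (by fun_prop))).inter (isOpen_lt (by fun_prop) (by fun_prop))
  set S : Set E := (fun s : ℝ => s • M) '' Icc a₁ a₂ with hS
  have hSc : IsClosed S := (isCompact_Icc.image (by fun_prop)).isClosed
  have hST : Disjoint Tᶜ S := by
    rw [disjoint_compl_left_iff_subset]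
    rintro _ ⟨s, ⟨hs1, hs2⟩, rfl⟩
    have hs0 : 0 < s := ha₁.trans_le hs1
    have hn : ‖s • M‖ = s := by rw [norm_smul, hM, mul_one, Real.norm_of_nonneg hs0.le]
    refine ⟨⟨?_, ?_⟩, ?_⟩
    · simp only [mem_ofPred_eq, hn, sub_self, norm_zero]
      positivity
    · simp only [mem_ofPred_eq, hn]
      linarith
    · simp only [mem_ofPred_eq, hn]
      linarith
  obtain ⟨f, hf0, hf1, hf⟩ := exists_contMDiffMap_zero_one_of_isClosed (n := ⊤) 𝓘(ℝ, E)
    hTo.isClosed_compl hSc hST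
  refine ⟨f, f.contMDiff.contDiff, fun Y => (hf Y).1, fun Y => (hf Y).2,
    fun s hs => hf1 ⟨s, hs, rfl⟩, ?_, ?_⟩
  · intro Y hY
    exact hf0 fun h => absurd h.1.2 (not_lt.2 hY.le)
  · have hcl : IsClosed {Y : E | ‖Y - ‖Y‖ • M‖ ≤ c * ‖Y‖ ∧ ‖Y‖ ≤ a₂ + 1} :=
      IsClosed.and (isClosed_le (by fun_prop) (by fun_prop)) (isClosed_le (by fun_prop) (by fun_prop))
    refine closure_minimal (fun Y hY => ?_) hcl
    have : Y ∈ T := by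
      by_contra h
      exact hY (hf0 h)
    exact ⟨le_of_lt this.1.1, le_of_lt this.2⟩

end

section
variable {E : Type*} [NormedAddCommGroup E] [InnerProductSpace ℝ E]

open ContDiff in
lemma exists_energy_density [FiniteDimensional ℝ E] {d : ℕ} {M : E} (hM : ‖M‖ = 1)
    {c₀ a₁ a₂ : ℝ} (hc₀ : 0 < c₀) (ha₁ : 0 < a₁) (ha₂ : a₁ ≤ a₂) (df : (Fin d → E) → ℝ)
    (hdf : ∀ X, 0 ≤ df X)
    (hell : ∀ X : Fin d → E,
      c₀ * ∑ i, ‖X i‖ ^ 2 ≤ ∑ i, ‖X i‖ ^ 2 - ∑ i, (inner ℝ M (X i)) ^ 2 + df X) :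
    ∃ (ψ : E → ℝ) (A C H : ℝ), 0 ≤ A ∧ 0 ≤ C ∧ 0 ≤ H ∧ Continuous ψ ∧ (∀ Y, 0 ≤ ψ Y) ∧
      (∀ Y, ψ Y ≤ 1) ∧
      (∀ s ∈ Icc a₁ a₂, ψ (s • M) = 1) ∧ (∀ Y, ‖Y‖ < a₁ / 2 → ψ Y = 0) ∧
      (∀ Y Z, |ψ Y - ψ Z| ≤ A * ‖Y - Z‖) ∧
      ∀ ε : ℝ, 0 < ε → ε ≤ 1 → ∃ G : E → ℝ, ContDiff ℝ 2 G ∧ (∀ Y, ψ Y ≤ G Y) ∧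
        (∀ Y, G Y ≤ C * (ε + ‖Y‖ - inner ℝ M Y) + ψ Y) ∧ (∀ Y, ‖fderiv ℝ G Y‖ ≤ 2 * C + A) ∧
        ∀ Y (X : Fin d → E), - (H * df X) ≤ ∑ i, fderiv ℝ (fderiv ℝ G) Y (X i) (X i) := by
  obtain ⟨ψ, hψs, hψ0, hψ1, hψM, hψz, hψt⟩ :=
    exists_cone_bump hM (by positivity : 0 < c₀ / 4) ha₁ (a₂ := a₂)
  have ha₂0 : 0 < a₂ := ha₁.trans_le ha₂
  have hψ's : ContDiff ℝ ∞ (fderiv ℝ ψ) := hψs.fderiv_right (by simp)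
  have hψc : HasCompactSupport ψ := by
    refine (isCompact_closedBall (0 : E) (a₂ + 1)).of_isClosed_subset (isClosed_tsupport _) ?_
    exact fun Y hY => mem_closedBall_zero_iff.2 (hψt hY).2
  obtain ⟨A, hA⟩ := (hψc.fderiv (𝕜 := ℝ)).exists_bound_of_continuous hψ's.continuous
  have hψ''c : Continuous (fderiv ℝ (fderiv ℝ ψ)) := hψ's.continuous_fderiv (by simp)
  have hψ''0 : ∀ Y ∉ tsupport ψ, fderiv ℝ (fderiv ℝ ψ) Y = 0 := by
    intro Y hY
    have h : fderiv ℝ ψ =ᶠ[𝓝 Y] fun _ => 0 := by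
      filter_upwards [(isClosed_tsupport ψ).isOpen_compl.mem_nhds hY] with Z hZ
      exact image_eq_zero_of_notMem_tsupport fun h => hZ (tsupport_fderiv_subset ℝ h)
    rw [h.fderiv_eq]
    simp
  have hψn : Continuous fun Y => ‖fderiv ℝ (fderiv ℝ ψ) Y‖ :=
    (continuous_norm (E := E →L[ℝ] E →L[ℝ] ℝ)).comp hψ''c
  obtain ⟨B, hB'⟩ := (isCompact_closedBall (0 : E) (a₂ + 1)).exists_bound_of_continuousOn
    hψn.continuousOn
  have hB0 : 0 ≤ B := (norm_nonneg _).trans (hB' 0 (by simp; positivity))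
  have hB : ∀ Y, ‖fderiv ℝ (fderiv ℝ ψ) Y‖ ≤ B := by
    intro Y
    by_cases hY : Y ∈ tsupport ψ
    · exact (le_abs_self _).trans (hB' Y (mem_closedBall_zero_iff.2 (hψt hY).2))
    · rw [hψ''0 Y hY]
      exact (norm_zero (E := E →L[ℝ] E →L[ℝ] ℝ)).trans_le hB0
  have hA0 : 0 ≤ A := (norm_nonneg _).trans (hA 0)
  have hB'0 : 0 < a₂ + 2 := by positivity
  refine ⟨ψ, A, 2 * (a₂ + 2) * B / c₀, 2 * (a₂ + 2) * B / c₀ / (a₂ + 2), hA0, by positivity,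
    by positivity, hψs.continuous, hψ0, hψ1, hψM, hψz, ?_, ?_⟩
  · intro Y Z
    have := Convex.norm_image_sub_le_of_norm_fderiv_le (𝕜 := ℝ) (f := ψ) (s := univ)
      (fun x _ => hψs.differentiable (by simp) x) (fun x _ => hA x) convex_univ (mem_univ Z)
      (mem_univ Y)
    exact this
  intro ε hε hε1
  set C := 2 * (a₂ + 2) * B / c₀ with hC
  have hC0 : 0 ≤ C := by positivity
  have hNs : ContDiff ℝ ∞ (smoothNorm ε : E → ℝ) := contDiff_smoothNorm hε
  have hNM : ∀ Y, inner ℝ M Y ≤ smoothNorm ε Y := fun Y => by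
    have h1 := real_inner_le_norm M Y
    rw [hM, one_mul] at h1
    exact h1.trans (norm_le_smoothNorm ε Y)
  have hNd : Differentiable ℝ (smoothNorm ε : E → ℝ) := hNs.differentiable (by simp)
  have hG' : ∀ Y, HasFDerivAt (fun Y => C * (smoothNorm ε Y - inner ℝ M Y) + ψ Y)
      (C • (fderiv ℝ (smoothNorm ε) Y - innerSL ℝ M) + fderiv ℝ ψ Y) Y := fun Y =>
    (((hNd Y).hasFDerivAt.sub (innerSL ℝ M).hasFDerivAt).const_mul C).add
      (hψs.differentiable (by simp) Y).hasFDerivAt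
  refine ⟨fun Y => C * (smoothNorm ε Y - inner ℝ M Y) + ψ Y, ?_, ?_, ?_, ?_, ?_⟩
  · refine ContDiff.of_le ?_ (by norm_cast : (2 : WithTop ℕ∞) ≤ ∞)
    exact (contDiff_const.mul (hNs.sub (innerSL ℝ M).contDiff)).add hψs
  · intro Y
    have := mul_nonneg hC0 (sub_nonneg.2 (hNM Y))
    linarith
  · intro Y
    have h1 := smoothNorm_le hε.le Y
    exact add_le_add_left (mul_le_mul_of_nonneg_left (sub_le_sub_right h1 _) hC0) _
  · intro Y
    rw [(hG' Y).fderiv]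
    refine (norm_add_le _ _).trans (add_le_add ?_ (hA Y))
    rw [norm_smul, Real.norm_of_nonneg hC0, mul_comm]
    refine mul_le_mul_of_nonneg_right ?_ hC0
    refine (norm_sub_le _ _).trans ?_
    rw [innerSL_apply_norm, hM]
    linarith [norm_fderiv_smoothNorm_le hε Y]
  · intro Y X
    have h1 : fderiv ℝ (fun Y => C * (smoothNorm ε Y - inner ℝ M Y) + ψ Y) = fun Y =>
      C • (fderiv ℝ (smoothNorm ε) Y - innerSL ℝ M) + fderiv ℝ ψ Y := funext fun Y => (hG' Y).fderiv
    have h2 : HasFDerivAt (fun Y => C • (fderiv ℝ (smoothNorm ε) Y - innerSL ℝ M) + fderiv ℝ ψ Y)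
        (C • fderiv ℝ (fderiv ℝ (smoothNorm ε)) Y + fderiv ℝ (fderiv ℝ ψ) Y) Y := by
      have hN's : ContDiff ℝ ∞ (fderiv ℝ (smoothNorm ε : E → ℝ)) := hNs.fderiv_right (by simp)
      exact (((hN's.differentiable (by simp) Y).hasFDerivAt.sub_const _).const_smul C).add
        (hψ's.differentiable (by simp) Y).hasFDerivAt
    rw [h1, h2.fderiv]
    simp only [_root_.add_apply, _root_.smul_apply, smul_eq_mul,
      fderiv_fderiv_smoothNorm hε]
    rw [Finset.sum_add_distrib, ← Finset.mul_sum, ← Finset.mul_sum]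
    set q := ∑ i, (‖X i‖ ^ 2 - (inner ℝ Y (X i)) ^ 2 / (ε ^ 2 + ‖Y‖ ^ 2)) with hq
    have hq0 : 0 ≤ q := Finset.sum_nonneg fun i _ => sub_nonneg.2 (inner_sq_div_le ε Y (X i))
    have hNp := smoothNorm_pos hε Y
    have hdX := hdf X
    by_cases hY : Y ∈ tsupport ψ
    · obtain ⟨hY1, hY2⟩ := hψt hY
      have h3 := cone_lower_bound hM hc₀ hε X (hell X) hY1
      have h4 : -(B * ∑ i, ‖X i‖ ^ 2) ≤ ∑ i, fderiv ℝ (fderiv ℝ ψ) Y (X i) (X i) := by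
        rw [Finset.mul_sum, ← Finset.sum_neg_distrib]
        refine Finset.sum_le_sum fun i _ => ?_
        refine (neg_le_neg ?_).trans (neg_abs_le _)
        rw [← Real.norm_eq_abs]
        refine ((fderiv ℝ (fderiv ℝ ψ) Y).le_opNorm₂ (X i) (X i)).trans ?_
        rw [mul_assoc, ← pow_two]
        exact mul_le_mul_of_nonneg_right (hB Y) (by positivity)
      have h5 : (a₂ + 2)⁻¹ ≤ (smoothNorm ε Y)⁻¹ :=
        inv_anti₀ hNp ((smoothNorm_le hε.le Y).trans (by linarith))
      have h6 : C * ((a₂ + 2)⁻¹ * (c₀ / 2 * ∑ i, ‖X i‖ ^ 2 - df X)) ≤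
          C * ((smoothNorm ε Y)⁻¹ * q) := by
        refine mul_le_mul_of_nonneg_left ?_ hC0
        calc (a₂ + 2)⁻¹ * (c₀ / 2 * ∑ i, ‖X i‖ ^ 2 - df X) ≤ (a₂ + 2)⁻¹ * q := by gcongr
          _ ≤ _ := by gcongr
      have h7 : C * ((a₂ + 2)⁻¹ * (c₀ / 2 * ∑ i, ‖X i‖ ^ 2 - df X)) =
          B * ∑ i, ‖X i‖ ^ 2 - C / (a₂ + 2) * df X := by
        rw [hC]
        field_simp
      linarith
    · have h3 := hψ''0 Y hY
      simp only [h3, _root_.zero_apply, Finset.sum_const_zero, add_zero]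
      have h4 : 0 ≤ C * ((smoothNorm ε Y)⁻¹ * q) := by positivity
      have h5 : 0 ≤ C / (a₂ + 2) * df X := by positivity
      linarith

end

section
variable {d : ℕ}

lemma integral_mul_second_lineDeriv {ζ ζ₁ ζ₂ p p₁ p₂ : EuclideanSpace ℝ (Fin d) → ℝ}
    {v : EuclideanSpace ℝ (Fin d)} {R : ℝ}
    (hζ : Continuous ζ) (hζ₁ : Continuous ζ₁) (hζ₂ : Continuous ζ₂)
    (hp : Continuous p) (hp₁ : Continuous p₁) (hp₂ : Continuous p₂)
    (h0 : ∀ x, R < ‖x‖ → ζ x = 0) (h0₁ : ∀ x, R < ‖x‖ → ζ₁ x = 0) (h0₂ : ∀ x, R < ‖x‖ → ζ₂ x = 0)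
    (hd : ∀ x, HasLineDerivAt ℝ ζ (ζ₁ x) x v) (hd₁ : ∀ x, HasLineDerivAt ℝ ζ₁ (ζ₂ x) x v)
    (hpd : ∀ x, HasLineDerivAt ℝ p (p₁ x) x v) (hpd₁ : ∀ x, HasLineDerivAt ℝ p₁ (p₂ x) x v) :
    ∫ x, ζ x * p₂ x = ∫ x, ζ₂ x * p x := by
  have hcs : ∀ f : EuclideanSpace ℝ (Fin d) → ℝ, (∀ x, R < ‖x‖ → f x = 0) → HasCompactSupport f :=
    fun f hf => HasCompactSupport.of_support_subset_isCompact (isCompact_closedBall 0 R) fun x hx => by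
      rw [mem_closedBall_zero_iff]
      by_contra h
      exact hx (hf x (not_le.1 h))
  have hi : ∀ f g : EuclideanSpace ℝ (Fin d) → ℝ, Continuous f → Continuous g →
      (∀ x, R < ‖x‖ → f x = 0) → Integrable fun x => f x * g x := fun f g hf hg h =>
    (hf.mul hg).integrable_of_hasCompactSupport (hcs _ fun x hx => by simp [h x hx])
  have e1 := integral_bilinear_hasLineDerivAt_right_eq_neg_left_of_integrable (μ := volume)
    (B := ContinuousLinearMap.mul ℝ ℝ) (f := ζ) (f' := ζ₁) (g := p₁) (g' := p₂) (v := v)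
    (hi _ _ hζ₁ hp₁ h0₁) (hi _ _ hζ hp₂ h0) (hi _ _ hζ hp₁ h0) (fun x _ => hd x) (fun x _ => hpd₁ x)
  have e2 := integral_bilinear_hasLineDerivAt_right_eq_neg_left_of_integrable (μ := volume)
    (B := ContinuousLinearMap.mul ℝ ℝ) (f := ζ₁) (f' := ζ₂) (g := p) (g' := p₁) (v := v)
    (hi _ _ hζ₂ hp h0₂) (hi _ _ hζ₁ hp₁ h0₁) (hi _ _ hζ₁ hp h0₁) (fun x _ => hd₁ x) (fun x _ => hpd x)
  simp only [ContinuousLinearMap.mul_apply'] at e1 e2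
  rw [e1, e2, neg_neg]

variable {E : Type*} [NormedAddCommGroup E] [NormedSpace ℝ E]
variable {ρ : Measure (EuclideanSpace ℝ (Fin d))} [IsFiniteMeasure ρ]
  {F : EuclideanSpace ℝ (Fin d) → E}

lemma continuous_mconv_heatK (hF : StronglyMeasurable F) (hF1 : ∀ y, ‖F y‖ ≤ 1) {t : ℝ}
    (ht : 0 < t) : Continuous (mconv ρ F (heatK t)) :=
  continuous_mconv hF hF1 (continuous_heatK t)
    (fun z => (abs_of_nonneg (heatK_nonneg ht z)).trans_le (heatK_le ht z))

lemma continuous_mconv_heatK1 (hF : StronglyMeasurable F) (hF1 : ∀ y, ‖F y‖ ≤ 1) {t : ℝ}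
    (ht : 0 < t) (i : Fin d) : Continuous (mconv ρ F (heatK1 i t)) :=
  continuous_mconv hF hF1 (continuous_heatK1 i t) (abs_heatK1_le ht i)

lemma continuous_mconv_heatK2 (hF : StronglyMeasurable F) (hF1 : ∀ y, ‖F y‖ ≤ 1) {t : ℝ}
    (ht : 0 < t) (i : Fin d) : Continuous (mconv ρ F (heatK2 i t)) :=
  continuous_mconv hF hF1 (continuous_heatK2 i t) (abs_heatK2_le ht i)

lemma hasDerivAt_energy (hF : StronglyMeasurable F) (hF1 : ∀ y, ‖F y‖ ≤ 1)
    {ζ : EuclideanSpace ℝ (Fin d) → ℝ} (hζ : Continuous ζ) {R : ℝ}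
    (h0 : ∀ x, R < ‖x‖ → ζ x = 0) {G : E → ℝ} (hG : ContDiff ℝ 1 G) {K : ℝ}
    (hK : ∀ Y, ‖fderiv ℝ G Y‖ ≤ K) {t : ℝ} (ht : 0 < t) :
    HasDerivAt (fun s => ∫ x, ζ x * G (mconv ρ F (heatK s) x))
      (∫ x, ζ x * fderiv ℝ G (mconv ρ F (heatK t) x) (∑ i, mconv ρ F (heatK2 i t) x)) t := by
  have hpos : ∀ s ∈ Ioi (t / 2), 0 < s := fun s hs => (half_pos ht).trans hs
  have hcs : ∀ f : EuclideanSpace ℝ (Fin d) → ℝ, HasCompactSupport fun x => ζ x * f x :=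
    fun f => HasCompactSupport.of_support_subset_isCompact (isCompact_closedBall 0 R) fun x hx => by
      rw [mem_closedBall_zero_iff]
      by_contra h
      exact hx (by simp [h0 x (not_le.1 h)])
  have hc : ∀ s, 0 < s → Continuous fun x => ζ x * G (mconv ρ F (heatK s) x) := fun s hs =>
    hζ.mul (hG.continuous.comp (continuous_mconv_heatK hF hF1 hs))
  have hc' : Continuous fun x =>
      ζ x * fderiv ℝ G (mconv ρ F (heatK t) x) (∑ i, mconv ρ F (heatK2 i t) x) :=
    hζ.mul (((hG.continuous_fderiv (by simp)).comp (continuous_mconv_heatK hF hF1 ht)).clm_apply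
      (continuous_finsetSum _ fun i _ => continuous_mconv_heatK2 hF hF1 ht i))
  set D : ℝ := d * (2 / (t / 2) * (t / 2) ^ (-(d : ℝ) / 2) * ρ.real univ)
  refine (hasDerivAt_integral_of_dominated_loc_of_deriv_le (μ := volume) (𝕜 := ℝ)
    (F := fun (s : ℝ) x => ζ x * G (mconv ρ F (heatK s) x))
    (F' := fun (s : ℝ) x =>
      ζ x * fderiv ℝ G (mconv ρ F (heatK s) x) (∑ i, mconv ρ F (heatK2 i s) x))
    (x₀ := t) (s := Ioi (t / 2)) (bound := fun x => |ζ x * 1| * (K * D)) (Ioi_mem_nhds (half_lt_self ht))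
    ?_ ((hc t ht).integrable_of_hasCompactSupport (hcs _)) hc'.aestronglyMeasurable
    (ae_of_all _ fun x s hs => ?_) ?_ (ae_of_all _ fun x s hs => ?_)).2
  · filter_upwards [Ioi_mem_nhds (half_lt_self ht)] with s hs
    exact (hc s (hpos s hs)).aestronglyMeasurable
  · rw [norm_mul, mul_one, Real.norm_eq_abs]
    refine mul_le_mul_of_nonneg_left ?_ (abs_nonneg _)
    refine (ContinuousLinearMap.le_opNorm _ _).trans ?_
    have hK0 : 0 ≤ K := (norm_nonneg _).trans (hK 0)
    refine mul_le_mul (hK _) ?_ (norm_nonneg _) hK0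
    refine (norm_sum_le _ _).trans ?_
    calc ∑ i, ‖mconv ρ F (heatK2 i s) x‖
        ≤ ∑ i : Fin d, 2 / (t / 2) * (t / 2) ^ (-(d : ℝ) / 2) * ρ.real univ := by
          refine Finset.sum_le_sum fun i _ => (norm_mconv_le hF1 (abs_heatK2_le (hpos s hs) i) x).trans ?_
          have hs' : t / 2 ≤ s := le_of_lt hs
          have : s ^ (-(d : ℝ) / 2) ≤ (t / 2) ^ (-(d : ℝ) / 2) :=
            Real.rpow_le_rpow_of_nonpos (half_pos ht) hs' (by
              have : (0 : ℝ) ≤ d := Nat.cast_nonneg d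
              linarith)
          have hp := hpos s hs
          gcongr
      _ = _ := by simp [D]
  · exact ((hζ.mul continuous_const).integrable_of_hasCompactSupport (hcs fun _ => 1)).abs.mul_const _
  · have h1 := (hG.differentiable (by simp) (mconv ρ F (heatK s) x)).hasFDerivAt
    exact (h1.comp_hasDerivAt s (hasDerivAt_mconv_time hF hF1 (hpos s hs) x)).const_mul (ζ x)

lemma energy_deriv_eq (hF : StronglyMeasurable F) (hF1 : ∀ y, ‖F y‖ ≤ 1)
    {ζ : EuclideanSpace ℝ (Fin d) → ℝ} {ζ₁ ζ₂ : Fin d → EuclideanSpace ℝ (Fin d) → ℝ}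
    (hζ : Continuous ζ) (hζ₁ : ∀ i, Continuous (ζ₁ i)) (hζ₂ : ∀ i, Continuous (ζ₂ i)) {R : ℝ}
    (h0 : ∀ x, R < ‖x‖ → ζ x = 0 ∧ ∀ i, ζ₁ i x = 0 ∧ ζ₂ i x = 0)
    (hd : ∀ i x, HasLineDerivAt ℝ ζ (ζ₁ i x) x (EuclideanSpace.single i 1))
    (hd₁ : ∀ i x, HasLineDerivAt ℝ (ζ₁ i) (ζ₂ i x) x (EuclideanSpace.single i 1))
    {G : E → ℝ} (hG : ContDiff ℝ 2 G) {t : ℝ} (ht : 0 < t) :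
    ∫ x, ζ x * fderiv ℝ G (mconv ρ F (heatK t) x) (∑ i, mconv ρ F (heatK2 i t) x) =
      ∫ x, ((∑ i, ζ₂ i x) * G (mconv ρ F (heatK t) x) -
        ζ x * ∑ i, fderiv ℝ (fderiv ℝ G) (mconv ρ F (heatK t) x) (mconv ρ F (heatK1 i t) x)
          (mconv ρ F (heatK1 i t) x)) := by
  have hu := continuous_mconv_heatK (ρ := ρ) hF hF1 ht
  have hu1 := continuous_mconv_heatK1 (ρ := ρ) hF hF1 ht
  have hu2 := continuous_mconv_heatK2 (ρ := ρ) hF hF1 ht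
  have hG1 : ContDiff ℝ 1 (fderiv ℝ G) := hG.fderiv_right (by norm_num)
  have cG := hG.continuous.comp hu
  have cG1 : ∀ g : EuclideanSpace ℝ (Fin d) → E, Continuous g →
      Continuous fun x => fderiv ℝ G (mconv ρ F (heatK t) x) (g x) := fun g hg =>
    (hG1.continuous.comp hu).clm_apply hg
  have cG2 : ∀ g : EuclideanSpace ℝ (Fin d) → E, Continuous g →
      Continuous fun x => fderiv ℝ (fderiv ℝ G) (mconv ρ F (heatK t) x) (g x) (g x) := fun g hg =>
    (((hG1.continuous_fderiv (by simp)).comp hu).clm_apply hg).clm_apply hg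
  have hi : ∀ f g : EuclideanSpace ℝ (Fin d) → ℝ, Continuous f → Continuous g →
      (∀ x, R < ‖x‖ → f x = 0) → Integrable fun x => f x * g x := fun f g hf hg h =>
    (hf.mul hg).integrable_of_hasCompactSupport
      (HasCompactSupport.of_support_subset_isCompact (isCompact_closedBall 0 R) fun x hx => by
        rw [mem_closedBall_zero_iff]
        by_contra h'
        exact hx (by simp [h x (not_le.1 h')]))
  have lu : ∀ i x, HasLineDerivAt ℝ (mconv ρ F (heatK t)) (mconv ρ F (heatK1 i t) x) x
      (EuclideanSpace.single i 1) := fun i x =>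
    hasLineDerivAt_mconv hF hF1 (continuous_heatK t)
      (fun z => (abs_of_nonneg (heatK_nonneg ht z)).trans_le (heatK_le ht z)) (continuous_heatK1 i t)
      (abs_heatK1_le ht i) (fun x => hasLineDerivAt_heatK t i x) x
  have lu1 : ∀ i x, HasLineDerivAt ℝ (mconv ρ F (heatK1 i t)) (mconv ρ F (heatK2 i t) x) x
      (EuclideanSpace.single i 1) := fun i x =>
    hasLineDerivAt_mconv hF hF1 (continuous_heatK1 i t)
      (abs_heatK1_le ht i) (continuous_heatK2 i t) (abs_heatK2_le ht i)
      (fun x => hasLineDerivAt_heatK1 t i x) x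
  have key : ∀ i, ∫ x, ζ x * (fderiv ℝ (fderiv ℝ G) (mconv ρ F (heatK t) x)
        (mconv ρ F (heatK1 i t) x) (mconv ρ F (heatK1 i t) x) +
        fderiv ℝ G (mconv ρ F (heatK t) x) (mconv ρ F (heatK2 i t) x)) =
      ∫ x, ζ₂ i x * G (mconv ρ F (heatK t) x) := fun i => by
    refine integral_mul_second_lineDeriv (R := R)
      (p₁ := fun x => fderiv ℝ G (mconv ρ F (heatK t) x) (mconv ρ F (heatK1 i t) x))
      hζ (hζ₁ i) (hζ₂ i) cG (cG1 _ (hu1 i))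
      ((cG2 _ (hu1 i)).add (cG1 _ (hu2 i))) (fun x hx => (h0 x hx).1)
      (fun x hx => ((h0 x hx).2 i).1) (fun x hx => ((h0 x hx).2 i).2) (hd i) (hd₁ i) ?_ ?_
    · intro x
      have h1 := (hG.differentiable (by simp) (mconv ρ F (heatK t) x)).hasFDerivAt
      exact h1.comp_hasDerivAt_of_eq (0 : ℝ) (lu i x) (by simp)
    · intro x
      have h1 := (hG1.differentiable (by simp) (mconv ρ F (heatK t) x)).hasFDerivAt
      have h2 := h1.comp_hasDerivAt_of_eq (0 : ℝ) (lu i x) (by simp)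
      have h3 := h2.clm_apply (lu1 i x)
      unfold HasLineDerivAt
      simpa using h3
  have hA : ∀ i, Integrable fun x => ζ x * fderiv ℝ (fderiv ℝ G) (mconv ρ F (heatK t) x)
        (mconv ρ F (heatK1 i t) x) (mconv ρ F (heatK1 i t) x) := fun i =>
    hi _ _ hζ (cG2 _ (hu1 i)) fun x hx => (h0 x hx).1
  have hB : ∀ i, Integrable fun x => ζ x * fderiv ℝ G (mconv ρ F (heatK t) x)
        (mconv ρ F (heatK2 i t) x) := fun i =>
    hi _ _ hζ (cG1 _ (hu2 i)) fun x hx => (h0 x hx).1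
  have hZ : ∀ i, Integrable fun x => ζ₂ i x * G (mconv ρ F (heatK t) x) := fun i =>
    hi _ _ (hζ₂ i) cG fun x hx => ((h0 x hx).2 i).2
  have e1 : ∀ i, ∫ x, ζ x * fderiv ℝ G (mconv ρ F (heatK t) x) (mconv ρ F (heatK2 i t) x) =
      ∫ x, (ζ₂ i x * G (mconv ρ F (heatK t) x) - ζ x * fderiv ℝ (fderiv ℝ G) (mconv ρ F (heatK t) x)
        (mconv ρ F (heatK1 i t) x) (mconv ρ F (heatK1 i t) x)) := fun i => by
    rw [integral_sub (hZ i) (hA i), ← key i]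
    simp only [mul_add]
    rw [integral_add (hA i) (hB i)]
    ring
  simp only [map_sum, Finset.mul_sum, Finset.sum_mul]
  rw [integral_finsetSum _ fun i _ => hB i, Finset.sum_congr rfl fun i _ => e1 i]
  refine (integral_finsetSum _ fun i _ => (hZ i).sub (hA i)).symm.trans ?_
  simp only [Pi.sub_apply, Finset.sum_sub_distrib]

end

section

lemma le_exp_mul_of_deriv_le {Q Q' : ℝ → ℝ} {k β s : ℝ} (hk : 0 ≤ k) (hβ : 0 ≤ β) (hs : 0 < s)
    (hs1 : s ≤ 1) (hQ0 : ∀ t, 0 ≤ Q t) (hQ : ∀ t, 0 < t → HasDerivAt Q (Q' t) t)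
    (h : ∀ t, 0 < t → t ≤ 1 → Q' t ≤ k * Q t + β) : Q 1 ≤ Real.exp k * (Q s + β) := by
  have hd : ∀ t, 0 < t → HasDerivAt (fun t => Real.exp (-k * t) * Q t - β * t)
      (Real.exp (-k * t) * (-k) * Q t + Real.exp (-k * t) * Q' t - β) t := fun t ht => by
    have h1 : HasDerivAt (fun t : ℝ => Real.exp (-k * t)) (Real.exp (-k * t) * (-k)) t := by
      simpa using ((hasDerivAt_id t).const_mul (-k)).exp
    have h2 : HasDerivAt (fun t : ℝ => β * t) β t := by simpa using (hasDerivAt_id t).const_mul β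
    exact (h1.mul (hQ t ht)).sub h2
  have hanti : AntitoneOn (fun t => Real.exp (-k * t) * Q t - β * t) (Icc s 1) := by
    refine antitoneOn_of_hasDerivWithinAt_nonpos (convex_Icc s 1)
      (fun t ht => (hd t (hs.trans_le ht.1)).continuousAt.continuousWithinAt)
      (fun t ht => (hd t (hs.trans_le (interior_subset ht).1)).hasDerivWithinAt) fun t ht => ?_
    have ht' := interior_subset ht
    have h3 := h t (hs.trans_le ht'.1) ht'.2
    have h4 : Real.exp (-k * t) ≤ 1 := Real.exp_le_one_iff.2 (by nlinarith [ht'.1])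
    have h5 := Real.exp_pos (-k * t)
    nlinarith [mul_le_mul_of_nonneg_left h3 h5.le, mul_le_mul_of_nonneg_right h4 hβ]
  have h6 := hanti ⟨le_rfl, hs1⟩ ⟨hs1, le_rfl⟩ hs1
  simp only [mul_one] at h6
  have h7 : Real.exp (-k * s) * Q s ≤ Q s :=
    mul_le_of_le_one_left (hQ0 s) (Real.exp_le_one_iff.2 (by nlinarith))
  have h8 : Real.exp (-k) * Q 1 ≤ Q s + β := by nlinarith
  calc Q 1 = Real.exp k * (Real.exp (-k) * Q 1) := by
        rw [← mul_assoc, ← Real.exp_add]; simp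
    _ ≤ _ := mul_le_mul_of_nonneg_left h8 (Real.exp_pos k).le

variable {d : ℕ} {E : Type*} [NormedAddCommGroup E] [NormedSpace ℝ E]
variable {ρ : Measure (EuclideanSpace ℝ (Fin d))} [IsFiniteMeasure ρ]
  {F : EuclideanSpace ℝ (Fin d) → E}

lemma integrable_japWeight_of_finite (k : ℕ) : Integrable (japWeight (d := d) k) ρ :=
  Integrable.of_bound (continuous_japWeight k).aestronglyMeasurable 1
    (ae_of_all _ fun x => by
      rw [Real.norm_of_nonneg (japWeight_pos k x).le]; exact japWeight_le_one k x)

lemma integrable_weight_mul_comp_mconv (hF : StronglyMeasurable F) (hF1 : ∀ y, ‖F y‖ ≤ 1)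
    {G : E → ℝ} (hG : Continuous G) (hG0 : ∀ Y, 0 ≤ G Y) {Γ : ℝ}
    (hΓ : ∀ Y, G Y ≤ Γ * (1 + ‖Y‖)) {t : ℝ} (ht : 0 < t) :
    Integrable fun x => japWeight (d + 2) x * G (mconv ρ F (heatK t) x) := by
  have hΓ0 : 0 ≤ Γ := by simpa using (hG0 0).trans (hΓ 0)
  refine (integrable_japWeight (by omega)).mul_bdd
    (c := Γ * (1 + t ^ (-(d : ℝ) / 2) * ρ.real univ))
    (hG.comp (continuous_mconv_heatK hF hF1 ht)).aestronglyMeasurable (ae_of_all _ fun x => ?_)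
  rw [Real.norm_of_nonneg (hG0 _)]
  refine (hΓ _).trans (mul_le_mul_of_nonneg_left ?_ hΓ0)
  gcongr
  exact norm_mconv_le hF1 (fun z => (abs_of_nonneg (heatK_nonneg ht z)).trans_le (heatK_le ht z)) x

lemma integral_weight_mul_comp_mconv_le (hF : StronglyMeasurable F) (hF1 : ∀ y, ‖F y‖ ≤ 1)
    {G : E → ℝ} (hG : Continuous G) (hG0 : ∀ Y, 0 ≤ G Y) {Γ : ℝ}
    (hΓ : ∀ Y, G Y ≤ Γ * (1 + ‖Y‖)) {t N : ℝ} (ht : 0 < t) (hN0 : 0 ≤ N)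
    (hN : ∀ y : EuclideanSpace ℝ (Fin d),
      ∫ x, japWeight (d + 2) x * heatK t (x - y) ≤ N * japWeight (d + 2) y)
    (hρ : ∫ y, japWeight (d + 2) y ∂ρ ≤ 1) :
    ∫ x, japWeight (d + 2) x * G (mconv ρ F (heatK t) x) ≤
      Γ * ((∫ x : EuclideanSpace ℝ (Fin d), japWeight (d + 2) x) + N) := by
  have hΓ0 : 0 ≤ Γ := by simpa using (hG0 0).trans (hΓ 0)
  have hFn : StronglyMeasurable fun y => ‖F y‖ := hF.norm
  have hFn1 : ∀ y, ‖‖F y‖‖ ≤ 1 := fun y => by simpa using hF1 y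
  have hw : Integrable (japWeight (d := d) (d + 2)) := integrable_japWeight (by omega)
  have hi := integrable_weight_mul_mconv (ρ := ρ) hFn hFn1 (continuous_heatK t)
    (fun z => (abs_of_nonneg (heatK_nonneg ht z)).trans_le (heatK_le ht z))
  have h1 := integral_weight_mul_mconv_le (ρ := ρ) ht hN hFn (fun y => norm_nonneg _) hFn1
  have h2 : ∫ y, japWeight (d + 2) y * ‖F y‖ ∂ρ ≤ 1 := by
    refine (integral_mono_of_nonneg (ae_of_all _ fun y => mul_nonneg (japWeight_pos _ y).le
      (norm_nonneg _)) (integrable_japWeight_of_finite _) (ae_of_all _ fun y => ?_)).trans hρ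
    exact mul_le_of_le_one_right (japWeight_pos _ y).le (hF1 y)
  calc ∫ x, japWeight (d + 2) x * G (mconv ρ F (heatK t) x)
      ≤ ∫ x, Γ * (japWeight (d + 2) x +
          japWeight (d + 2) x * mconv ρ (fun y => ‖F y‖) (heatK t) x) := by
        refine integral_mono (integrable_weight_mul_comp_mconv hF hF1 hG hG0 hΓ ht)
          ((hw.add hi).const_mul Γ) fun x => ?_
        have h3 := norm_mconv_le_mconv_norm (ρ := ρ) (F := F) (heatK_nonneg ht) x
        have h4 := mul_le_mul_of_nonneg_left ((hΓ (mconv ρ F (heatK t) x)).trans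
          (mul_le_mul_of_nonneg_left (add_le_add_right h3 1) hΓ0)) (japWeight_pos (d + 2) x).le
        exact h4.trans_eq (by ring)
    _ = Γ * ((∫ x : EuclideanSpace ℝ (Fin d), japWeight (d + 2) x) +
          ∫ x, japWeight (d + 2) x * mconv ρ (fun y => ‖F y‖) (heatK t) x) := by
        rw [integral_const_mul, integral_add hw hi]
    _ ≤ _ := by
        gcongr
        exact h1.trans ((mul_le_mul_of_nonneg_left h2 hN0).trans_eq (mul_one N))

lemma energy_le (hF : StronglyMeasurable F) (hF1 : ∀ y, ‖F y‖ ≤ 1)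
    {ζ : EuclideanSpace ℝ (Fin d) → ℝ} {ζ₁ ζ₂ : Fin d → EuclideanSpace ℝ (Fin d) → ℝ}
    (hζ : Continuous ζ) (hζ₁ : ∀ i, Continuous (ζ₁ i)) (hζ₂ : ∀ i, Continuous (ζ₂ i)) {L : ℝ}
    (hL : 1 ≤ L) (h0 : ∀ x, 2 * L < ‖x‖ → ζ x = 0 ∧ ∀ i, ζ₁ i x = 0 ∧ ζ₂ i x = 0)
    (hd : ∀ i x, HasLineDerivAt ℝ ζ (ζ₁ i x) x (EuclideanSpace.single i 1))
    (hd₁ : ∀ i x, HasLineDerivAt ℝ (ζ₁ i) (ζ₂ i x) x (EuclideanSpace.single i 1))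
    (hζ0 : ∀ x, 0 ≤ ζ x) (hζw : ∀ x, ζ x ≤ japWeight (d + 2) x) {C : ℝ} (hC : 0 ≤ C)
    (hζC : ∀ i x, ζ₂ i x ≤ C * (ζ x + japWeight (d + 2) x / L))
    {G : E → ℝ} (hG : ContDiff ℝ 2 G) (hG0 : ∀ Y, 0 ≤ G Y) {Γ K H δ N : ℝ}
    (hΓ : ∀ Y, G Y ≤ Γ * (1 + ‖Y‖)) (hK : ∀ Y, ‖fderiv ℝ G Y‖ ≤ K)
    {df : (Fin d → E) → ℝ} (hH : 0 ≤ H) (hδ : 0 ≤ δ)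
    (hGH : ∀ Y X, -(H * df X) ≤ ∑ i, fderiv ℝ (fderiv ℝ G) Y (X i) (X i))
    (hdf : ∀ t, 0 < t → t ≤ 1 → ∀ x, ‖x‖ ≤ 2 * L → df (fun i => mconv ρ F (heatK1 i t) x) ≤ δ)
    (hN0 : 0 ≤ N) (hN : ∀ t, 0 < t → t ≤ 1 → ∀ y : EuclideanSpace ℝ (Fin d),
      ∫ x, japWeight (d + 2) x * heatK t (x - y) ≤ N * japWeight (d + 2) y)
    (hρ : ∫ y, japWeight (d + 2) y ∂ρ ≤ 1) {s : ℝ} (hs : 0 < s) (hs1 : s ≤ 1) :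
    ∫ x, ζ x * G (mconv ρ F (heatK 1) x) ≤ Real.exp (d * C) *
      ((∫ x, ζ x * G (mconv ρ F (heatK s) x)) +
        (d * C / L * (Γ * ((∫ x : EuclideanSpace ℝ (Fin d), japWeight (d + 2) x) + N)) +
          H * δ * ∫ x : EuclideanSpace ℝ (Fin d), japWeight (d + 2) x)) := by
  have hΓ0 : 0 ≤ Γ := by simpa using (hG0 0).trans (hΓ 0)
  have hL0 : 0 < L := one_pos.trans_le hL
  have hW0 : 0 ≤ ∫ x : EuclideanSpace ℝ (Fin d), japWeight (d + 2) x :=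
    integral_nonneg fun x => (japWeight_pos _ x).le
  have hw : Integrable (japWeight (d := d) (d + 2)) := integrable_japWeight (by omega)
  refine le_exp_mul_of_deriv_le (Q := fun t => ∫ x, ζ x * G (mconv ρ F (heatK t) x)) (by positivity)
    (by positivity) hs hs1 (fun t => integral_nonneg fun x => mul_nonneg (hζ0 x) (hG0 _))
    (fun t ht => hasDerivAt_energy hF hF1 hζ (fun x hx => (h0 x hx).1) (hG.of_le (by norm_num)) hK ht)
    fun t ht ht1 => ?_
  rw [energy_deriv_eq hF hF1 hζ hζ₁ hζ₂ h0 hd hd₁ hG ht]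
  have hwG := integrable_weight_mul_comp_mconv (ρ := ρ) hF hF1 hG.continuous hG0 hΓ ht
  have hwGle := integral_weight_mul_comp_mconv_le (ρ := ρ) hF hF1 hG.continuous hG0 hΓ ht hN0
    (hN t ht ht1) hρ
  have cG : Continuous fun x => G (mconv ρ F (heatK t) x) :=
    hG.continuous.comp (continuous_mconv_heatK hF hF1 ht)
  have hζG : Integrable fun x => ζ x * G (mconv ρ F (heatK t) x) :=
    hwG.mono' (hζ.mul cG).aestronglyMeasurable (ae_of_all _ fun x => by
      rw [Real.norm_of_nonneg (mul_nonneg (hζ0 x) (hG0 _))]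
      exact mul_le_mul_of_nonneg_right (hζw x) (hG0 _))
  have cG2 : ∀ i, Continuous fun x => fderiv ℝ (fderiv ℝ G) (mconv ρ F (heatK t) x)
      (mconv ρ F (heatK1 i t) x) (mconv ρ F (heatK1 i t) x) := fun i => by
    have hG1 : ContDiff ℝ 1 (fderiv ℝ G) := hG.fderiv_right (by norm_num)
    have hu1 := continuous_mconv_heatK1 (ρ := ρ) hF hF1 ht i
    exact (((hG1.continuous_fderiv (by simp)).comp
      (continuous_mconv_heatK (ρ := ρ) hF hF1 ht)).clm_apply hu1).clm_apply hu1
  calc ∫ x, ((∑ i, ζ₂ i x) * G (mconv ρ F (heatK t) x) -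
        ζ x * ∑ i, fderiv ℝ (fderiv ℝ G) (mconv ρ F (heatK t) x) (mconv ρ F (heatK1 i t) x)
          (mconv ρ F (heatK1 i t) x))
      ≤ ∫ x, (d * C * (ζ x * G (mconv ρ F (heatK t) x)) +
          d * C / L * (japWeight (d + 2) x * G (mconv ρ F (heatK t) x)) +
          H * δ * japWeight (d + 2) x) := by
        refine integral_mono ?_ (((hζG.const_mul _).add (hwG.const_mul _)).add (hw.const_mul _))
          fun x => ?_
        · refine Continuous.integrable_of_hasCompactSupport ?_
            (HasCompactSupport.of_support_subset_isCompact (isCompact_closedBall 0 (2 * L))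
              fun x hx => ?_)
          · exact ((continuous_finsetSum _ fun i _ => hζ₂ i).mul cG).sub
              (hζ.mul (continuous_finsetSum _ fun i _ => cG2 i))
          · rw [mem_closedBall_zero_iff]
            by_contra h
            have h' := h0 x (not_le.1 h)
            exact hx (by simp [h'.1, fun i => (h'.2 i).2])
        · dsimp only
          have hδx : -(ζ x * ∑ i, fderiv ℝ (fderiv ℝ G) (mconv ρ F (heatK t) x)
              (mconv ρ F (heatK1 i t) x) (mconv ρ F (heatK1 i t) x)) ≤
              H * δ * japWeight (d + 2) x := by
            by_cases hx : ‖x‖ ≤ 2 * L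
            · have h1 := hGH (mconv ρ F (heatK t) x) (fun i => mconv ρ F (heatK1 i t) x)
              have h2 := mul_le_mul_of_nonneg_left (hdf t ht ht1 x hx) hH
              have h3 := mul_le_mul_of_nonneg_left (show -(∑ i, fderiv ℝ (fderiv ℝ G)
                (mconv ρ F (heatK t) x) (mconv ρ F (heatK1 i t) x) (mconv ρ F (heatK1 i t) x)) ≤ H * δ
                by linarith) (hζ0 x)
              have h4 := mul_le_mul_of_nonneg_left (hζw x) (mul_nonneg hH hδ)
              linarith
            · rw [(h0 x (not_le.1 hx)).1]
              have := japWeight_pos (d + 2) x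
              simp only [zero_mul, neg_zero]
              positivity
          have h5 : (∑ i, ζ₂ i x) ≤ d * (C * (ζ x + japWeight (d + 2) x / L)) :=
            (Finset.sum_le_sum fun i _ => hζC i x).trans_eq (by simp)
          have h6 := mul_le_mul_of_nonneg_right h5 (hG0 (mconv ρ F (heatK t) x))
          have h7 : d * (C * (ζ x + japWeight (d + 2) x / L)) * G (mconv ρ F (heatK t) x) =
            d * C * (ζ x * G (mconv ρ F (heatK t) x)) +
              d * C / L * (japWeight (d + 2) x * G (mconv ρ F (heatK t) x)) := by
            field_simp
          linarith
    _ = d * C * (∫ x, ζ x * G (mconv ρ F (heatK t) x)) +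
          d * C / L * (∫ x, japWeight (d + 2) x * G (mconv ρ F (heatK t) x)) +
          H * δ * ∫ x : EuclideanSpace ℝ (Fin d), japWeight (d + 2) x := by
        refine (integral_add ((hζG.const_mul _).add (hwG.const_mul _)) (hw.const_mul _)).trans ?_
        refine (congrArg (· + _) (integral_add (hζG.const_mul _) (hwG.const_mul _))).trans ?_
        rw [integral_const_mul, integral_const_mul, integral_const_mul]
    _ ≤ _ := by
        have : 0 ≤ d * C / L := by positivity
        linarith [mul_le_mul_of_nonneg_left hwGle this]

end

section
variable {d : ℕ} {E : Type*} [NormedAddCommGroup E] [NormedSpace ℝ E]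
variable {ρ : Measure (EuclideanSpace ℝ (Fin d))} [IsFiniteMeasure ρ]
  {F : EuclideanSpace ℝ (Fin d) → E}

lemma tendsto_mconv_heatK_zero (hF1 : ∀ y, ‖F y‖ ≤ 1) {K : Set (EuclideanSpace ℝ (Fin d))}
    (hK : IsClosed K) (hFK : ∀ y ∉ K, F y = 0) {x : EuclideanSpace ℝ (Fin d)} (hx : x ∉ K) :
    Tendsto (fun t => mconv ρ F (heatK t) x) (𝓝[>] 0) (𝓝 0) := by
  obtain ⟨r, hr, hrK⟩ := Metric.isOpen_iff.1 hK.isOpen_compl x hx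
  have hlim : Tendsto (fun t : ℝ => expConst (d + 1) * t / r ^ (2 * (d + 1)) * ρ.real univ) (𝓝[>] 0)
      (𝓝 0) := by
    have : Continuous fun t : ℝ => expConst (d + 1) * t / r ^ (2 * (d + 1)) * ρ.real univ := by
      fun_prop
    simpa using (this.tendsto 0).mono_left nhdsWithin_le_nhds
  refine squeeze_zero_norm' ?_ hlim
  filter_upwards [Ioc_mem_nhdsGT (show (0 : ℝ) < 1 from one_pos)] with t ht
  refine norm_integral_le_of_norm_le_const (ae_of_all _ fun y => ?_)
  have hb : 0 ≤ expConst (d + 1) * t / r ^ (2 * (d + 1)) := by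
    have := expConst_pos (d + 1)
    have := ht.1
    positivity
  by_cases hy : y ∈ K
  · refine norm_smul_le_of_abs_le ?_ (hF1 y)
    rw [abs_of_nonneg (heatK_nonneg ht.1 _), le_div_iff₀ (by positivity)]
    have hxy : r ≤ ‖x - y‖ := by
      by_contra h
      refine hrK (show y ∈ ball x r from ?_) hy
      rw [mem_ball', dist_eq_norm]
      exact not_le.1 h
    have h1 := heatK_mul_norm_pow_le (d := d) 1 ht.1 ht.2 (x - y)
    rw [pow_one] at h1
    exact (mul_le_mul_of_nonneg_left (by gcongr) (heatK_nonneg ht.1 _)).trans h1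
  · simpa [hFK y hy] using hb

lemma tendsto_integral_weight_mul_comp_mconv (hF : StronglyMeasurable F) (hF1 : ∀ y, ‖F y‖ ≤ 1)
    {K : Set (EuclideanSpace ℝ (Fin d))}
    (hK : IsClosed K) (hK0 : volume K = 0) (hFK : ∀ y ∉ K, F y = 0) {ψ : E → ℝ} (hψ : Continuous ψ)
    (hψ0 : ∀ Y, 0 ≤ ψ Y) (hψ1 : ∀ Y, ψ Y ≤ 1) {a : ℝ} (ha : 0 < a) (hψa : ∀ Y, ‖Y‖ < a → ψ Y = 0) :
    Tendsto (fun t => ∫ x, japWeight (d + 2) x * ψ (mconv ρ F (heatK t) x)) (𝓝[>] 0) (𝓝 0) := by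
  have key := tendsto_integral_filter_of_dominated_convergence (μ := volume) (l := 𝓝[>] (0 : ℝ))
    (F := fun t x => japWeight (d + 2) x * ψ (mconv ρ F (heatK t) x)) (f := fun _ => (0 : ℝ))
    (japWeight (d := d) (d + 2)) ?_ ?_ (integrable_japWeight (by omega)) ?_
  · simpa using key
  · filter_upwards [self_mem_nhdsWithin] with t ht
    exact ((continuous_japWeight _).mul
      (hψ.comp (continuous_mconv_heatK hF hF1 ht))).aestronglyMeasurable
  · refine Eventually.of_forall fun t => ae_of_all _ fun x => ?_
    rw [Real.norm_of_nonneg (mul_nonneg (japWeight_pos _ x).le (hψ0 _))]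
    exact mul_le_of_le_one_right (japWeight_pos _ x).le (hψ1 _)
  · have : ∀ᵐ x : EuclideanSpace ℝ (Fin d), x ∉ K := measure_eq_zero_iff_ae_notMem.1 hK0
    filter_upwards [this] with x hx
    refine tendsto_const_nhds.congr' ?_
    have h1 := (tendsto_mconv_heatK_zero (ρ := ρ) hF1 hK hFK hx).norm
    rw [norm_zero] at h1
    filter_upwards [h1.eventually_lt_const ha] with t ht
    rw [hψa _ ht, mul_zero]

lemma mconv_apply {ι : Type*} [Fintype ι] {F : EuclideanSpace ℝ (Fin d) → EuclideanSpace ℝ ι}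
    (hF : StronglyMeasurable F) (hF1 : ∀ y, ‖F y‖ ≤ 1) {g : EuclideanSpace ℝ (Fin d) → ℝ}
    (hg : Continuous g) {C : ℝ} (hC : ∀ x, |g x| ≤ C) (x : EuclideanSpace ℝ (Fin d)) (a : ι) :
    mconv ρ F g x a = mconv ρ (fun y => F y a) g x := by
  have := (EuclideanSpace.proj (𝕜 := ℝ) a : EuclideanSpace ℝ ι →L[ℝ] ℝ).integral_comp_comm
    (integrable_mconv_integrand (ρ := ρ) hF hF1 hg hC x)
  simpa [mconv] using this.symm

end

section
variable {d : ℕ} {E : Type*} [NormedAddCommGroup E] [InnerProductSpace ℝ E]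
variable {ρ : Measure (EuclideanSpace ℝ (Fin d))} [IsFiniteMeasure ρ]
  {F F' : EuclideanSpace ℝ (Fin d) → E} {M : E} {B : EuclideanSpace ℝ (Fin d) → ℝ}

lemma norm_mconv_sub_smul_le [CompleteSpace E] (hF : StronglyMeasurable F) (hF1 : ∀ y, ‖F y‖ ≤ 1)
    (hM : ‖M‖ = 1) (hB : StronglyMeasurable B) (hB1 : ∀ y, ‖B y‖ ≤ 1)
    (hFM : ∀ y, ‖F y - M‖ ≤ 4 * B y) {t : ℝ} (ht : 0 < t) (x : EuclideanSpace ℝ (Fin d)) :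
    ‖mconv ρ F (heatK t) x - mconv ρ (fun _ => (1 : ℝ)) (heatK t) x • M‖ ≤
      4 * mconv ρ B (heatK t) x := by
  rw [← mconv_const]
  exact norm_mconv_sub_le hF hF1 stronglyMeasurable_const (fun _ => hM.le) hB hB1 hFM
    (continuous_heatK t) (fun z => (abs_of_nonneg (heatK_nonneg ht z)).trans_le (heatK_le ht z))
    (heatK_nonneg ht) x

lemma energy_start_le [CompleteSpace E] (hF : StronglyMeasurable F) (hF1 : ∀ y, ‖F y‖ ≤ 1)
    (hF' : StronglyMeasurable F') (hF1' : ∀ y, ‖F' y‖ ≤ 1) (hM : ‖M‖ = 1)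
    (hB : StronglyMeasurable B) (hB0 : ∀ y, 0 ≤ B y) (hB1 : ∀ y, ‖B y‖ ≤ 1)
    (hFM : ∀ y, ‖F y - M‖ ≤ 4 * B y) (hFF' : ∀ y, ‖F y - F' y‖ ≤ 2 * B y)
    {ζ : EuclideanSpace ℝ (Fin d) → ℝ} (hζ0 : ∀ x, 0 ≤ ζ x)
    (hζw : ∀ x, ζ x ≤ japWeight (d + 2) x) {ψ G : E → ℝ} (hψ : Continuous ψ) (hψ0 : ∀ Y, 0 ≤ ψ Y)
    (hψ1 : ∀ Y, ψ Y ≤ 1) {A C ε N : ℝ} (hA : 0 ≤ A) (hC : 0 ≤ C)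
    (hψA : ∀ Y Z, |ψ Y - ψ Z| ≤ A * ‖Y - Z‖) (hψG : ∀ Y, ψ Y ≤ G Y)
    (hG : ∀ Y, G Y ≤ C * (ε + ‖Y‖ - inner ℝ M Y) + ψ Y) {s : ℝ} (hs : 0 < s)
    (hN : ∀ y : EuclideanSpace ℝ (Fin d),
      ∫ x, japWeight (d + 2) x * heatK s (x - y) ≤ N * japWeight (d + 2) y) :
    ∫ x, ζ x * G (mconv ρ F (heatK s) x) ≤
      C * ε * (∫ x : EuclideanSpace ℝ (Fin d), japWeight (d + 2) x) +
      (8 * C + 2 * A) * (N * ∫ y, japWeight (d + 2) y * B y ∂ρ) +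
      ∫ x, japWeight (d + 2) x * ψ (mconv ρ F' (heatK s) x) := by
  have hbd : ∀ z : EuclideanSpace ℝ (Fin d), |heatK s z| ≤ s ^ (-(d : ℝ) / 2) :=
    fun z => (abs_of_nonneg (heatK_nonneg hs z)).trans_le (heatK_le hs z)
  have hw : Integrable (japWeight (d := d) (d + 2)) := integrable_japWeight (by omega)
  have hb := integrable_weight_mul_mconv (ρ := ρ) hB hB1 (continuous_heatK s) hbd
  have hψi : Integrable fun x => japWeight (d + 2) x * ψ (mconv ρ F' (heatK s) x) :=
    integrable_weight_mul_comp_mconv hF' hF1' hψ hψ0 (Γ := 1)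
      (fun Y => (hψ1 Y).trans (by linarith [norm_nonneg Y])) hs
  have h1 := integral_weight_mul_mconv_le (ρ := ρ) hs hN hB hB0 hB1
  have e : ∫ x, (C * ε * japWeight (d + 2) x +
      (8 * C + 2 * A) * (japWeight (d + 2) x * mconv ρ B (heatK s) x) +
      japWeight (d + 2) x * ψ (mconv ρ F' (heatK s) x)) =
      C * ε * (∫ x : EuclideanSpace ℝ (Fin d), japWeight (d + 2) x) +
      (8 * C + 2 * A) * (∫ x, japWeight (d + 2) x * mconv ρ B (heatK s) x) +
      ∫ x, japWeight (d + 2) x * ψ (mconv ρ F' (heatK s) x) := by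
    refine (integral_add ((hw.const_mul _).add (hb.const_mul _)) hψi).trans ?_
    refine (congrArg (· + _) (integral_add (hw.const_mul _) (hb.const_mul _))).trans ?_
    rw [integral_const_mul, integral_const_mul]
  calc ∫ x, ζ x * G (mconv ρ F (heatK s) x)
      ≤ ∫ x, (C * ε * japWeight (d + 2) x +
      (8 * C + 2 * A) * (japWeight (d + 2) x * mconv ρ B (heatK s) x) +
      japWeight (d + 2) x * ψ (mconv ρ F' (heatK s) x)) := by
        refine integral_mono_of_nonneg (ae_of_all _ fun x => mul_nonneg (hζ0 x)
          ((hψ0 _).trans (hψG _))) (((hw.const_mul _).add (hb.const_mul _)).add hψi)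
          (ae_of_all _ fun x => ?_)
        dsimp only
        set Y := mconv ρ F (heatK s) x
        set n := mconv ρ (fun _ => (1 : ℝ)) (heatK s) x
        set b := mconv ρ B (heatK s) x
        have hn : 0 ≤ n := mconv_nonneg (fun _ => zero_le_one) (heatK_nonneg hs) x
        have hYn : ‖Y - n • M‖ ≤ 4 * b := norm_mconv_sub_smul_le hF hF1 hM hB hB1 hFM hs x
        have hY1 : ‖Y‖ ≤ n + 4 * b := by
          have := norm_add_le (Y - n • M) (n • M)
          rw [sub_add_cancel, norm_smul, hM, mul_one, Real.norm_of_nonneg hn] at this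
          linarith
        have hY2 : n - 4 * b ≤ inner ℝ M Y := by
          have h2 : inner ℝ M Y = n + inner ℝ M (Y - n • M) := by
            rw [inner_sub_right, inner_smul_right, real_inner_self_eq_norm_sq, hM]; ring
          have h3 := (abs_le.1 (abs_real_inner_le_norm M (Y - n • M))).1
          rw [hM, one_mul] at h3
          linarith
        have hψY : ψ Y ≤ ψ (mconv ρ F' (heatK s) x) + 2 * A * b := by
          have h2 : ‖Y - mconv ρ F' (heatK s) x‖ ≤ 2 * b :=
            norm_mconv_sub_le hF hF1 hF' hF1' hB hB1 hFF' (continuous_heatK s) hbd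
              (heatK_nonneg hs) x
          have h3 := (le_abs_self _).trans (hψA Y (mconv ρ F' (heatK s) x))
          nlinarith [mul_le_mul_of_nonneg_left h2 hA]
        have hGY : G Y ≤ C * ε + (8 * C + 2 * A) * b + ψ (mconv ρ F' (heatK s) x) := by
          have h2 := mul_le_mul_of_nonneg_left
            (show ε + ‖Y‖ - inner ℝ M Y ≤ ε + 8 * b by linarith) hC
          linarith [hG Y]
        have h2 := mul_le_mul (hζw x) hGY ((hψ0 _).trans (hψG _)) (japWeight_pos _ x).le
        exact h2.trans_eq (by ring)
    _ ≤ _ := by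
        rw [e]
        have : 0 ≤ 8 * C + 2 * A := by positivity
        linarith [mul_le_mul_of_nonneg_left h1 this]

lemma energy_one_ge [CompleteSpace E] (hF : StronglyMeasurable F) (hF1 : ∀ y, ‖F y‖ ≤ 1)
    (hM : ‖M‖ = 1)
    (hB : StronglyMeasurable B) (hB0 : ∀ y, 0 ≤ B y) (hB1 : ∀ y, ‖B y‖ ≤ 1)
    (hFM : ∀ y, ‖F y - M‖ ≤ 4 * B y)
    {ζ : EuclideanSpace ℝ (Fin d) → ℝ} (hζ : Continuous ζ) (hζ0 : ∀ x, 0 ≤ ζ x)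
    (hζw : ∀ x, ζ x ≤ japWeight (d + 2) x) {c : ℝ} (hζc : ∀ x, ‖x‖ ≤ 1 → c ≤ ζ x)
    {ψ G : E → ℝ} (hψ0 : ∀ Y, 0 ≤ ψ Y) {A Γ N a₁ a₂ : ℝ} (hA : 0 ≤ A)
    (hψ1 : ∀ s ∈ Icc a₁ a₂, ψ (s • M) = 1)
    (hψA : ∀ Y Z, |ψ Y - ψ Z| ≤ A * ‖Y - Z‖) (hG : Continuous G) (hψG : ∀ Y, ψ Y ≤ G Y)
    (hΓ : ∀ Y, G Y ≤ Γ * (1 + ‖Y‖))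
    (hn : ∀ x, ‖x‖ ≤ 1 → mconv ρ (fun _ => (1 : ℝ)) (heatK 1) x ∈ Icc a₁ a₂)
    (hN : ∀ y : EuclideanSpace ℝ (Fin d),
      ∫ x, japWeight (d + 2) x * heatK 1 (x - y) ≤ N * japWeight (d + 2) y) :
    c * volume.real (closedBall (0 : EuclideanSpace ℝ (Fin d)) 1) ≤
      (∫ x, ζ x * G (mconv ρ F (heatK 1) x)) +
      4 * A * (N * ∫ y, japWeight (d + 2) y * B y ∂ρ) := by
  have hbd : ∀ z : EuclideanSpace ℝ (Fin d), |heatK 1 z| ≤ 1 ^ (-(d : ℝ) / 2) :=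
    fun z => (abs_of_nonneg (heatK_nonneg one_pos z)).trans_le (heatK_le one_pos z)
  have hb := integrable_weight_mul_mconv (ρ := ρ) hB hB1 (continuous_heatK 1) hbd
  have hwG := integrable_weight_mul_comp_mconv (ρ := ρ) hF hF1 hG
    (fun Y => (hψ0 Y).trans (hψG Y)) hΓ one_pos
  have hζG : Integrable fun x => ζ x * G (mconv ρ F (heatK 1) x) :=
    hwG.mono' (hζ.mul (hG.comp (continuous_mconv_heatK hF hF1 one_pos))).aestronglyMeasurable
      (ae_of_all _ fun x => by
        rw [Real.norm_of_nonneg (mul_nonneg (hζ0 x) ((hψ0 _).trans (hψG _)))]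
        exact mul_le_mul_of_nonneg_right (hζw x) ((hψ0 _).trans (hψG _)))
  have h1 := integral_weight_mul_mconv_le (ρ := ρ) one_pos hN hB hB0 hB1
  have hball : c * volume.real (closedBall (0 : EuclideanSpace ℝ (Fin d)) 1) =
      ∫ x, (closedBall (0 : EuclideanSpace ℝ (Fin d)) 1).indicator (fun _ => c) x := by
    rw [integral_indicator_const _ measurableSet_closedBall, smul_eq_mul, mul_comm]
  rw [hball]
  calc ∫ x, (closedBall (0 : EuclideanSpace ℝ (Fin d)) 1).indicator (fun _ => c) x
      ≤ ∫ x, (ζ x * G (mconv ρ F (heatK 1) x) +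
          4 * A * (japWeight (d + 2) x * mconv ρ B (heatK 1) x)) := by
        refine integral_mono ((integrable_indicator_iff measurableSet_closedBall).2
          (integrableOn_const measure_closedBall_lt_top.ne)) (hζG.add (hb.const_mul _)) fun x => ?_
        dsimp only
        have hb0 : 0 ≤ mconv ρ B (heatK 1) x := mconv_nonneg hB0 (heatK_nonneg one_pos) x
        have hw0 := (japWeight_pos (d + 2) x).le
        by_cases hx : ‖x‖ ≤ 1
        · rw [indicator_of_mem (by simpa using hx)]
          have hYn := norm_mconv_sub_smul_le (ρ := ρ) hF hF1 hM hB hB1 hFM one_pos x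
          have h2 := hψA (mconv ρ F (heatK 1) x) (mconv ρ (fun _ => (1 : ℝ)) (heatK 1) x • M)
          rw [hψ1 _ (hn x hx)] at h2
          have h3 := (abs_le.1 h2).1
          have h4 : 1 - 4 * A * mconv ρ B (heatK 1) x ≤ G (mconv ρ F (heatK 1) x) := by
            nlinarith [hψG (mconv ρ F (heatK 1) x), mul_le_mul_of_nonneg_left hYn hA]
          have h5 := mul_le_mul_of_nonneg_left h4 (hζ0 x)
          have h6 := mul_le_mul_of_nonneg_right (hζw x)
            (show 0 ≤ 4 * A * mconv ρ B (heatK 1) x by positivity)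
          nlinarith [hζc x hx]
        · rw [indicator_of_notMem (by simpa using hx)]
          have := mul_nonneg (hζ0 x) ((hψ0 (mconv ρ F (heatK 1) x)).trans (hψG _))
          positivity
    _ = (∫ x, ζ x * G (mconv ρ F (heatK 1) x)) +
          4 * A * ∫ x, japWeight (d + 2) x * mconv ρ B (heatK 1) x := by
        rw [← integral_const_mul]
        exact integral_add hζG (hb.const_mul _)
    _ ≤ _ := by gcongr

end

section
variable {d : ℕ}

lemma mconv_one_mem_Icc {C : ℝ} (hC : ∀ x y : EuclideanSpace ℝ (Fin d), ‖x‖ ≤ 1 →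
      heatK 1 (x - y) ≤ C * japWeight (d + 2) y) (hC0 : 0 ≤ C)
    {ρ : Measure (EuclideanSpace ℝ (Fin d))} [IsFiniteMeasure ρ]
    (hρ : ∫ y, japWeight (d + 2) y ∂ρ ≤ 1) (hρ2 : 1 / 2 ≤ ρ.real (closedBall 0 2))
    {x : EuclideanSpace ℝ (Fin d)} (hx : ‖x‖ ≤ 1) :
    mconv ρ (fun _ => (1 : ℝ)) (heatK 1) x ∈ Icc (Real.exp (-9 / 4) / 2) C := by
  have hi := integrable_mconv_integrand (ρ := ρ) (F := fun _ => (1 : ℝ)) stronglyMeasurable_const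
    (fun _ => by simp) (continuous_heatK (d := d) 1)
    (fun z => (abs_of_nonneg (heatK_nonneg one_pos z)).trans_le (heatK_le one_pos z)) x
  unfold mconv
  constructor
  · have h1 : ∫ y, (closedBall (0 : EuclideanSpace ℝ (Fin d)) 2).indicator
        (fun _ => Real.exp (-9 / 4)) y ∂ρ = ρ.real (closedBall 0 2) * Real.exp (-9 / 4) := by
      rw [integral_indicator_const _ measurableSet_closedBall, smul_eq_mul]
    have h2 : ρ.real (closedBall 0 2) * Real.exp (-9 / 4) ≤
        ∫ y, heatK 1 (x - y) • (1 : ℝ) ∂ρ := by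
      rw [← h1]
      refine integral_mono ((integrable_const _).indicator measurableSet_closedBall) hi fun y => ?_
      by_cases hy : y ∈ closedBall (0 : EuclideanSpace ℝ (Fin d)) 2
      · rw [indicator_of_mem hy]
        have : ‖x - y‖ ≤ 3 := by
          have := norm_sub_le x y
          have := mem_closedBall_zero_iff.1 hy
          linarith
        simpa using heatK_one_ge this
      · rw [indicator_of_notMem hy]
        simpa using heatK_nonneg one_pos (x - y)
    refine le_trans ?_ h2
    have := Real.exp_pos (-9 / 4)
    nlinarith
  · refine (integral_mono hi ((integrable_japWeight_of_finite (ρ := ρ) (d + 2)).const_mul C)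
      fun y => ?_).trans ?_
    · simpa using hC x y hx
    · rw [integral_const_mul]
      exact mul_le_of_le_one_right hC0 hρ

set_option maxHeartbeats 1000000 in
/-- Quantitative form, at unit scale, of the fact that a measure with elliptic polar `M`
cannot be concentrated on a null set. -/
theorem exists_delta_of_elliptic {ι κ : Type*} [Fintype ι] [Fintype κ] (i₁ i₂ : κ → Fin d)
    (α₁ α₂ : κ → ι) {M : EuclideanSpace ℝ ι} (hM : ‖M‖ = 1) {c₀ : ℝ} (hc₀ : 0 < c₀)
    (hell : ∀ X : Fin d → EuclideanSpace ℝ ι, c₀ * ∑ i, ‖X i‖ ^ 2 ≤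
      ∑ i, ‖X i‖ ^ 2 - ∑ i, (inner ℝ M (X i)) ^ 2 +
        ∑ c, (X (i₁ c) (α₁ c) - X (i₂ c) (α₂ c)) ^ 2) :
    ∃ δ > 0, ∃ L : ℝ, 1 ≤ L ∧ ∀ (ρ : Measure (EuclideanSpace ℝ (Fin d))) [IsFiniteMeasure ρ]
      (F : EuclideanSpace ℝ (Fin d) → EuclideanSpace ℝ ι) (K : Set (EuclideanSpace ℝ (Fin d))),
      StronglyMeasurable F → (∀ y, ‖F y‖ ≤ 1) → IsClosed K → volume K = 0 →
      ∫ y, japWeight (d + 2) y ∂ρ ≤ 1 → 1 / 2 ≤ ρ.real (closedBall 0 2) →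
      (∀ c, ∀ φ : EuclideanSpace ℝ (Fin d) → ℝ, ContDiff ℝ (⊤ : ℕ∞) φ → HasCompactSupport φ →
        tsupport φ ⊆ ball 0 (9 * L) →
        ∫ y, pderiv' (i₁ c) φ y * F y (α₁ c) ∂ρ = ∫ y, pderiv' (i₂ c) φ y * F y (α₂ c) ∂ρ) →
      δ < ∫ y, japWeight (d + 2) y * ‖K.indicator F y - M‖ ∂ρ := by
  obtain ⟨N, hN0, hN⟩ := exists_integral_weight_mul_heatK_le d
  obtain ⟨Ck, hCk0, hCk⟩ := exists_heatK_one_le d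
  obtain ⟨Cd, hCd0, hCd⟩ := exists_defect_le d
  obtain ⟨Cz, c, hCz0, hc0, hcut⟩ := exists_cutoff d
  set a₁ : ℝ := Real.exp (-9 / 4) / 2 with ha₁
  have ha₁0 : 0 < a₁ := by positivity
  set a₂ : ℝ := max a₁ Ck
  set df : (Fin d → EuclideanSpace ℝ ι) → ℝ := fun X =>
    ∑ c, (X (i₁ c) (α₁ c) - X (i₂ c) (α₂ c)) ^ 2 with hdfdef
  obtain ⟨ψ, A, C, H, hA, hC, hH, hψc, hψ0, hψ1, hψM, hψa, hψA, hψG⟩ :=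
    exists_energy_density hM hc₀ ha₁0 (le_max_left a₁ Ck) df
      (fun X => Finset.sum_nonneg fun c _ => sq_nonneg _) hell
  set W := ∫ x : EuclideanSpace ℝ (Fin d), japWeight (d + 2) x
  have hW0 : 0 ≤ W := integral_nonneg fun x => (japWeight_pos _ x).le
  set D := Real.exp (d * Cz)
  have hD0 : 0 < D := Real.exp_pos _
  set X : ℝ := c * volume.real (closedBall (0 : EuclideanSpace ℝ (Fin d)) 1)
  have hX0 : 0 < X := mul_pos hc0 (ENNReal.toReal_pos (measure_closedBall_pos _ _ one_pos).ne'
    measure_closedBall_lt_top.ne)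
  set Γ : ℝ := 2 * C + 1
  set T1 := D * (C * W)
  have hT1 : 0 ≤ T1 := by positivity
  set T2' := d * Cz * (Γ * (W + N)) + H * (Fintype.card κ * Cd ^ 2) * W with hT2'
  set T2 := D * T2'
  have hT2 : 0 ≤ T2 := by positivity
  set T3 := 4 * A * N + D * ((8 * C + 2 * A) * N)
  have hT3 : 0 ≤ T3 := by positivity
  set ε := min 1 (X / (8 * (T1 + 1)))
  have hε0 : 0 < ε := lt_min one_pos (by positivity)
  have hT1ε : T1 * ε ≤ X / 8 := by
    have h1 : ε ≤ X / (8 * (T1 + 1)) := min_le_right _ _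
    rw [le_div_iff₀ (by positivity)] at h1
    nlinarith
  set L := max 1 (8 * T2 / X)
  have hL1 : 1 ≤ L := le_max_left _ _
  have hL0 : 0 < L := one_pos.trans_le hL1
  have hT2L : T2 / L ≤ X / 8 := by
    have h1 : 8 * T2 / X ≤ L := le_max_right _ _
    rw [div_le_iff₀ hX0] at h1
    rw [div_le_iff₀ hL0]
    linarith
  refine ⟨X / (8 * (T3 + 1)), by positivity, L, hL1, ?_⟩
  intro ρ _ F K hF hF1 hK hK0 hρ hρ2 hcl
  by_contra! hδ
  obtain ⟨G, hG, hGψ, hGle, hGd, hGH⟩ := hψG ε hε0 (min_le_left _ _)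
  obtain ⟨ζ, ζ₁, ζ₂, hζ, hζ₁, hζ₂, hd, hd₁, hζ0, hζw, h0, hζC, hζc⟩ := hcut L hL1
  have hF' : StronglyMeasurable (K.indicator F) := hF.indicator hK.measurableSet
  have hF1' : ∀ y, ‖K.indicator F y‖ ≤ 1 := fun y => (norm_indicator_le_norm_self _ _).trans (hF1 y)
  set B : EuclideanSpace ℝ (Fin d) → ℝ := fun y => ‖K.indicator F y - M‖ / 2 with hBdef
  have hB : StronglyMeasurable B := by
    have := (hF'.sub (stronglyMeasurable_const (b := M))).norm.mul
      (stronglyMeasurable_const (b := (1 / 2 : ℝ)))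
    convert! this using 1
    funext y
    simp [hBdef]
    ring
  have hB0 : ∀ y, 0 ≤ B y := fun y => by positivity
  have hB1 : ∀ y, ‖B y‖ ≤ 1 := fun y => by
    rw [Real.norm_of_nonneg (hB0 y)]
    have := norm_sub_le (K.indicator F y) M
    have := hF1' y
    simp only [hBdef]
    linarith
  have hFF' : ∀ y, ‖F y - K.indicator F y‖ ≤ 2 * B y := fun y => by
    by_cases hy : y ∈ K
    · simpa [hy] using hB0 y
    · simpa [hy, hBdef, hM] using hF1 y
  have hFM : ∀ y, ‖F y - M‖ ≤ 4 * B y := fun y => by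
    have h1 := norm_add_le (F y - K.indicator F y) (K.indicator F y - M)
    rw [sub_add_sub_cancel] at h1
    have h2 : ‖K.indicator F y - M‖ = 2 * B y := by simp only [hBdef]; ring
    linarith [hFF' y]
  have hG0 : ∀ Y, 0 ≤ G Y := fun Y => (hψ0 Y).trans (hGψ Y)
  have hΓ : ∀ Y, G Y ≤ Γ * (1 + ‖Y‖) := fun Y => by
    have h1 := (abs_le.1 (abs_real_inner_le_norm M Y)).1
    rw [hM, one_mul] at h1
    have h2 : ε ≤ 1 := min_le_left _ _
    have h3 := mul_le_mul_of_nonneg_left (show ε + ‖Y‖ - inner ℝ M Y ≤ 1 + 2 * ‖Y‖ by linarith) hC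
    have h4 := norm_nonneg Y
    simp only [Γ]
    nlinarith [hGle Y, hψ1 Y]
  have hdf : ∀ t, 0 < t → t ≤ 1 → ∀ x, ‖x‖ ≤ 2 * L → df (fun i => mconv ρ F (heatK1 i t) x) ≤
      Fintype.card κ * (Cd / L) ^ 2 := fun t ht ht1 x hx => by
    simp only [hdfdef]
    refine (Finset.sum_le_card_nsmul _ _ ((Cd / L) ^ 2) fun c _ => ?_).trans_eq (by simp)
    rw [mconv_apply hF hF1 (continuous_heatK1 _ t) (abs_heatK1_le ht _),
      mconv_apply hF hF1 (continuous_heatK1 _ t) (abs_heatK1_le ht _)]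
    have hm : ∀ a, StronglyMeasurable fun y => F y a := fun a =>
      (EuclideanSpace.proj (𝕜 := ℝ) a :
        EuclideanSpace ℝ ι →L[ℝ] ℝ).continuous.comp_stronglyMeasurable hF
    have hm1 : ∀ a y, ‖F y a‖ ≤ 1 := fun a y => (PiLp.norm_apply_le _ _).trans (hF1 y)
    have h1 := hCd ρ L hL1 t ht ht1 x hx _ _ (hm (α₁ c)) (hm1 _) (hm (α₂ c)) (hm1 _) _ _ (hcl c)
    refine sq_le_sq' ?_ ?_
    all_goals
      have h2 := h1.trans (mul_le_of_le_one_right (by positivity) hρ)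
      have h3 := abs_le.1 h2
      linarith [h3.1, h3.2]
  have hone := energy_one_ge (ρ := ρ) hF hF1 hM hB hB0 hB1 hFM hζ hζ0 hζw hζc hψ0 hA hψM hψA
    hG.continuous hGψ hΓ (fun x hx => Icc_subset_Icc_right (le_max_right a₁ Ck)
      (mconv_one_mem_Icc hCk hCk0.le hρ hρ2 hx)) (hN 1 one_pos le_rfl)
  set β := ∫ y, japWeight (d + 2) y * B y ∂ρ
  have hβ0 : 0 ≤ β := integral_nonneg fun y => mul_nonneg (japWeight_pos _ y).le (hB0 y)
  have hβ : T3 * β ≤ X / 8 := by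
    have h1 : β = (∫ y, japWeight (d + 2) y * ‖K.indicator F y - M‖ ∂ρ) / 2 := by
      rw [← integral_div]
      simp only [β, hBdef, mul_div_assoc]
    have h2 : 2 * β ≤ X / (8 * (T3 + 1)) := by rw [h1]; linarith
    rw [le_div_iff₀ (by positivity)] at h2
    nlinarith
  have hev := (tendsto_integral_weight_mul_comp_mconv (ρ := ρ) hF' hF1' hK hK0
    (fun y hy => indicator_of_notMem hy F) hψc hψ0 hψ1 (half_pos ha₁0) hψa).eventually_lt_const
      (show 0 < X / (8 * D) by positivity)
  obtain ⟨s, hs, hs01⟩ := (hev.and (Ioc_mem_nhdsGT (show (0 : ℝ) < 1 from one_pos))).exists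
  have hstart := energy_start_le (ρ := ρ) hF hF1 hF' hF1' hM hB hB0 hB1 hFM hFF' hζ0 hζw hψc hψ0
    hψ1 hA hC hψA hGψ hGle hs01.1 (hN s hs01.1 hs01.2)
  have hen := energy_le (ρ := ρ) hF hF1 hζ hζ₁ hζ₂ hL1 h0 hd hd₁ hζ0 hζw hCz0.le hζC hG hG0 hΓ hGd
    hH (by positivity) hGH hdf hN0.le hN hρ hs01.1 hs01.2
  rw [lt_div_iff₀ (by positivity)] at hs
  have hL2 : d * Cz / L * (Γ * (W + N)) + H * (Fintype.card κ * (Cd / L) ^ 2) * W ≤ T2' / L := by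
    have h1 : (Cd / L) ^ 2 ≤ Cd ^ 2 / L := by
      rw [div_pow]
      gcongr
      nlinarith
    have h2 : T2' / L = d * Cz / L * (Γ * (W + N)) + H * (Fintype.card κ * (Cd ^ 2 / L)) * W := by
      rw [hT2']
      ring
    rw [h2]
    gcongr
  have hDL : D * (T2' / L) = T2 / L := (mul_div_assoc _ _ _).symm
  have hfin := hen.trans (mul_le_mul_of_nonneg_left (add_le_add hstart hL2) hD0.le)
  have e1 : D * (C * ε * W + (8 * C + 2 * A) * (N * β) +
      (∫ x, japWeight (d + 2) x * ψ (mconv ρ (K.indicator F) (heatK s) x)) + T2' / L) =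
      T1 * ε + D * ((8 * C + 2 * A) * N) * β +
      (∫ x, japWeight (d + 2) x * ψ (mconv ρ (K.indicator F) (heatK s) x)) * D + T2 / L := by
    rw [← hDL]; simp only [T1]; ring
  have e2 : T3 * β = 4 * A * (N * β) + D * ((8 * C + 2 * A) * N) * β := by
    simp only [T3]; ring
  have hs8 : (∫ x, japWeight (d + 2) x * ψ (mconv ρ (K.indicator F) (heatK s) x)) * D ≤ X / 8 := by
    linarith
  linarith

end

section
variable {d : ℕ}

lemma exists_superlevel_eq_closedBall (k : ℕ) (hk : k ≠ 0) (x₀ : EuclideanSpace ℝ (Fin d)) {R r₁ t : ℝ}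
    (hR : 0 < R) (hr₁ : 0 < r₁) (ht : 0 < t) (ht1 : t ≤ 1) :
    ∃ r, 0 ≤ r ∧ {x | t ≤ japWeight k (R⁻¹ • (x - x₀))} = closedBall x₀ r ∧
      (r₁ < r → t ≤ (R / r₁) ^ (2 * k)) := by
  set q := t⁻¹ ^ ((k : ℝ)⁻¹)
  have hq : q ^ k = t⁻¹ := Real.rpow_inv_natCast_pow (inv_nonneg.2 ht.le) hk
  have hq1 : 1 ≤ q := Real.one_le_rpow ((one_le_inv₀ ht).2 ht1) (by positivity)
  refine ⟨R * √(q - 1), by positivity, ?_, fun h => ?_⟩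
  · ext x
    rw [mem_ofPred_eq, mem_closedBall, dist_eq_norm, japWeight, le_inv_comm₀ ht (by positivity), ← hq,
      pow_le_pow_iff_left₀ (by positivity) (by positivity) hk, norm_smul, norm_inv,
      Real.norm_of_nonneg hR.le, ← div_le_iff₀' hR, Real.le_sqrt (by positivity) (by linarith),
      ← le_sub_iff_add_le', div_eq_inv_mul]
  · rw [← div_lt_iff₀' hR, Real.lt_sqrt (by positivity)] at h
    have h1 : ((r₁ / R) ^ 2) ^ k ≤ q ^ k := by gcongr; linarith
    rw [hq, ← pow_mul] at h1
    have h2 := inv_anti₀ (by positivity) h1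
    rwa [inv_inv, ← inv_pow, inv_div] at h2

lemma integral_weight_mul_le {ρ : Measure (EuclideanSpace ℝ (Fin d))} [IsFiniteMeasure ρ]
    {x₀ : EuclideanSpace ℝ (Fin d)} {g : EuclideanSpace ℝ (Fin d) → ℝ} (hg : Measurable g)
    (hg0 : ∀ x, 0 ≤ g x) (hg2 : ∀ x, g x ≤ 2) (hgx : g x₀ = 0) {δ r₁ R : ℝ} (hδ : 0 ≤ δ)
    (hr₁ : 0 < r₁) (hR : 0 < R)
    (h : ∀ r, 0 < r → r ≤ r₁ → ∫ y in closedBall x₀ r, g y ∂ρ ≤ δ * ρ.real (closedBall x₀ r)) :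
    ∫ y, japWeight (d + 2) (R⁻¹ • (y - x₀)) * g y ∂ρ ≤
      δ * (∫ y, japWeight (d + 2) (R⁻¹ • (y - x₀)) ∂ρ) +
        (R / r₁) ^ (2 * (d + 2)) * (2 * ρ.real univ) := by
  set w : EuclideanSpace ℝ (Fin d) → ℝ := fun y => japWeight (d + 2) (R⁻¹ • (y - x₀)) with hw
  have hwc : Continuous w := (continuous_japWeight (d + 2)).comp (by fun_prop)
  have hw0 : ∀ y, 0 < w y := fun y => japWeight_pos _ _
  have hw1 : ∀ y, w y ≤ 1 := fun y => japWeight_le_one _ _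
  have hwi : Integrable w ρ := Integrable.of_bound hwc.aestronglyMeasurable 1
    (ae_of_all _ fun y => by rw [Real.norm_of_nonneg (hw0 y).le]; exact hw1 y)
  have hgi : Integrable g ρ := Integrable.of_bound hg.aestronglyMeasurable 2
    (ae_of_all _ fun y => by rw [Real.norm_of_nonneg (hg0 y)]; exact hg2 y)
  have hwgi : Integrable (fun y => w y * g y) ρ := by
    simpa [mul_comm] using hgi.mul_bdd (c := 1) hwc.aestronglyMeasurable
      (ae_of_all _ fun y => by rw [Real.norm_of_nonneg (hw0 y).le]; exact hw1 y)
  set τ := (R / r₁) ^ (2 * (d + 2))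
  have hτ : 0 ≤ τ := by positivity
  set β : Measure (EuclideanSpace ℝ (Fin d)) := ρ.withDensity fun y => ENNReal.ofReal (g y)
  have hβ : ∀ s, MeasurableSet s → β s = ENNReal.ofReal (∫ y in s, g y ∂ρ) := fun s hs => by
    rw [withDensity_apply _ hs, ofReal_integral_eq_lintegral_ofReal hgi.restrict (ae_of_all _ hg0)]
  have hβuniv : ∀ s, β s ≤ ENNReal.ofReal (2 * ρ.real univ) := fun s => by
    refine (measure_mono (subset_univ s)).trans ?_
    rw [hβ _ MeasurableSet.univ, setIntegral_univ]
    refine ENNReal.ofReal_le_ofReal ?_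
    refine (integral_mono hgi (integrable_const (2 : ℝ)) hg2).trans_eq ?_
    rw [integral_const, smul_eq_mul, mul_comm]
  have hlev : ∀ t, 0 < t → β {x | t ≤ w x} ≤ ENNReal.ofReal δ * ρ {x | t ≤ w x} +
      (Iic τ).indicator (fun _ => ENNReal.ofReal (2 * ρ.real univ)) t := fun t ht => by
    rcases le_or_gt t 1 with ht1 | ht1
    · obtain ⟨r, hr0, hr, hrt⟩ := exists_superlevel_eq_closedBall (d + 2) (by omega) x₀ hR hr₁ ht ht1
      rw [hr]
      rcases le_or_gt r r₁ with h1 | h1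
      · refine le_add_right ?_
        rw [hβ _ measurableSet_closedBall, ← ofReal_measureReal, ← ENNReal.ofReal_mul hδ]
        refine ENNReal.ofReal_le_ofReal ?_
        rcases hr0.eq_or_lt with rfl | hr0
        · rw [closedBall_zero, integral_singleton, hgx, smul_zero]
          positivity
        · exact h r hr0 h1
      · refine le_add_left ?_
        rw [indicator_of_mem (show t ∈ Iic τ from hrt h1)]
        exact hβuniv _
    · have : {x | t ≤ w x} = ∅ := by
        ext x
        simpa using (hw1 x).trans_lt ht1
      simp [this]
  have hcake : ENNReal.ofReal (∫ y, w y * g y ∂ρ) ≤ ENNReal.ofReal δ * ENNReal.ofReal (∫ y, w y ∂ρ) +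
      ENNReal.ofReal (2 * ρ.real univ) * ENNReal.ofReal τ := by
    rw [ofReal_integral_eq_lintegral_ofReal hwgi (ae_of_all _ fun y => mul_nonneg (hw0 y).le (hg0 y)),
      ofReal_integral_eq_lintegral_ofReal hwi (ae_of_all _ fun y => (hw0 y).le)]
    have e1 : ∫⁻ y, ENNReal.ofReal (w y * g y) ∂ρ = ∫⁻ y, ENNReal.ofReal (w y) ∂β := by
      rw [lintegral_withDensity_eq_lintegral_mul _ hg.ennreal_ofReal hwc.measurable.ennreal_ofReal]
      refine lintegral_congr fun y => ?_
      rw [Pi.mul_apply, ← ENNReal.ofReal_mul (hg0 y), mul_comm]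
    rw [e1, lintegral_eq_lintegral_meas_le β (ae_of_all _ fun y => (hw0 y).le) hwc.aemeasurable,
      lintegral_eq_lintegral_meas_le ρ (ae_of_all _ fun y => (hw0 y).le) hwc.aemeasurable]
    calc ∫⁻ t in Ioi (0 : ℝ), β {x | t ≤ w x}
        ≤ ∫⁻ t in Ioi (0 : ℝ), (ENNReal.ofReal δ * ρ {x | t ≤ w x} +
          (Iic τ).indicator (fun _ => ENNReal.ofReal (2 * ρ.real univ)) t) :=
          setLIntegral_mono' measurableSet_Ioi fun t ht => hlev t ht
      _ = _ := by
          rw [lintegral_add_right _ (measurable_const.indicator measurableSet_Iic),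
            lintegral_const_mul' _ _ ENNReal.ofReal_ne_top,
            lintegral_indicator_const measurableSet_Iic,
            Measure.restrict_apply measurableSet_Iic, Iic_inter_Ioi, Real.volume_Ioc, sub_zero]
  rw [← ENNReal.ofReal_mul hδ, ← ENNReal.ofReal_mul (by positivity),
    ← ENNReal.ofReal_add (mul_nonneg hδ (integral_nonneg fun y => (hw0 y).le)) (by positivity),
    ENNReal.ofReal_le_ofReal_iff (add_nonneg (mul_nonneg hδ (integral_nonneg fun y => (hw0 y).le))
      (by positivity))] at hcake
  exact hcake.trans_eq (by ring)

lemma integrable_scaled_japWeight {ρ : Measure (EuclideanSpace ℝ (Fin d))} [IsFiniteMeasure ρ]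
    (x₀ : EuclideanSpace ℝ (Fin d)) (R : ℝ) :
    Integrable (fun y => japWeight (d + 2) (R⁻¹ • (y - x₀))) ρ :=
  Integrable.of_bound ((continuous_japWeight (d + 2)).comp
    (by fun_prop : Continuous fun y => R⁻¹ • (y - x₀))).aestronglyMeasurable 1
    (ae_of_all _ fun y => by
      rw [Real.norm_of_nonneg (japWeight_pos _ _).le]; exact japWeight_le_one _ _)

lemma mul_measureReal_closedBall_le_integral {ρ : Measure (EuclideanSpace ℝ (Fin d))}
    [IsFiniteMeasure ρ] (x₀ : EuclideanSpace ℝ (Fin d)) {R : ℝ} (hR : 0 < R) :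
    (2 ^ (d + 2))⁻¹ * ρ.real (closedBall x₀ R) ≤ ∫ y, japWeight (d + 2) (R⁻¹ • (y - x₀)) ∂ρ := by
  have h1 : (2 ^ (d + 2))⁻¹ * ρ.real (closedBall x₀ R) =
      ∫ y, (closedBall x₀ R).indicator (fun _ => ((2 : ℝ) ^ (d + 2))⁻¹) y ∂ρ := by
    rw [integral_indicator_const _ measurableSet_closedBall, smul_eq_mul, mul_comm]
  rw [h1]
  refine integral_mono ((integrable_const _).indicator measurableSet_closedBall)
    (integrable_scaled_japWeight x₀ R) fun y => ?_
  by_cases hy : y ∈ closedBall x₀ R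
  · rw [indicator_of_mem hy]
    rw [mem_closedBall, dist_eq_norm] at hy
    have h2 : ‖R⁻¹ • (y - x₀)‖ ≤ 1 := by
      rw [norm_smul, norm_inv, Real.norm_of_nonneg hR.le, ← div_eq_inv_mul]
      exact (div_le_one hR).2 hy
    unfold japWeight
    gcongr
    nlinarith [norm_nonneg (R⁻¹ • (y - x₀))]
  · rw [indicator_of_notMem hy]
    exact (japWeight_pos _ _).le

lemma half_integral_le_of_doubling {ρ : Measure (EuclideanSpace ℝ (Fin d))}
    [IsFiniteMeasure ρ] (x₀ : EuclideanSpace ℝ (Fin d)) {R : ℝ} (hR : 0 < R)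
    (h : ∫ y, japWeight (d + 2) ((2 * R)⁻¹ • (y - x₀)) ∂ρ ≤
      2 ^ (d + 1) * ∫ y, japWeight (d + 2) (R⁻¹ • (y - x₀)) ∂ρ) :
    (∫ y, japWeight (d + 2) (R⁻¹ • (y - x₀)) ∂ρ) ≤ 2 * ρ.real (closedBall x₀ (2 * R)) := by
  have h1 : ∫ y, (closedBall x₀ (2 * R)).indicator (fun _ => (1 : ℝ)) y ∂ρ =
      ρ.real (closedBall x₀ (2 * R)) := by
    rw [integral_indicator_const _ measurableSet_closedBall, smul_eq_mul, mul_one]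
  have hI := (integrable_const (μ := ρ) (1 : ℝ)).indicator
    (measurableSet_closedBall (x := x₀) (ε := 2 * R))
  have h2 : ∫ y, japWeight (d + 2) (R⁻¹ • (y - x₀)) ∂ρ ≤
      ρ.real (closedBall x₀ (2 * R)) +
        (2 / 5) ^ (d + 2) * ∫ y, japWeight (d + 2) ((2 * R)⁻¹ • (y - x₀)) ∂ρ := by
    rw [← h1, ← integral_const_mul,
      ← integral_add hI ((integrable_scaled_japWeight x₀ (2 * R)).const_mul _)]
    refine integral_mono (integrable_scaled_japWeight x₀ R)
      (hI.add ((integrable_scaled_japWeight x₀ (2 * R)).const_mul _)) fun y => ?_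
    dsimp only
    by_cases hy : y ∈ closedBall x₀ (2 * R)
    · rw [indicator_of_mem hy]
      have := japWeight_pos (d + 2) ((2 * R)⁻¹ • (y - x₀))
      have h3 : 0 ≤ (2 / 5 : ℝ) ^ (d + 2) * japWeight (d + 2) ((2 * R)⁻¹ • (y - x₀)) := by positivity
      linarith [japWeight_le_one (d + 2) (R⁻¹ • (y - x₀))]
    · rw [indicator_of_notMem hy, zero_add]
      rw [mem_closedBall, dist_eq_norm, not_le] at hy
      have hn : ‖(2 * R)⁻¹ • (y - x₀)‖ = ‖R⁻¹ • (y - x₀)‖ / 2 := by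
        rw [norm_smul, norm_smul, norm_inv, norm_inv, norm_mul, Real.norm_of_nonneg hR.le]
        norm_num
        ring
      have hs : 2 < ‖R⁻¹ • (y - x₀)‖ := by
        rw [norm_smul, norm_inv, Real.norm_of_nonneg hR.le, ← div_eq_inv_mul, lt_div_iff₀ hR]
        exact hy
      unfold japWeight
      rw [hn]
      set s := ‖R⁻¹ • (y - x₀)‖
      rw [← inv_pow, ← inv_pow, ← mul_pow]
      gcongr
      rw [← div_eq_mul_inv, inv_eq_one_div, div_le_div_iff₀ (by positivity) (by positivity)]
      nlinarith
  have hA : 0 ≤ ∫ y, japWeight (d + 2) (R⁻¹ • (y - x₀)) ∂ρ :=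
    integral_nonneg fun y => (japWeight_pos _ _).le
  have h3 := mul_le_mul_of_nonneg_left h (show (0 : ℝ) ≤ (2 / 5) ^ (d + 2) by positivity)
  have h4 : (2 / 5 : ℝ) ^ (d + 2) * 2 ^ (d + 1) ≤ 1 / 2 := by
    have : (2 / 5 : ℝ) ^ (d + 2) * 2 ^ (d + 1) = 2 / 5 * (4 / 5) ^ (d + 1) := by
      rw [pow_succ (2 / 5 : ℝ) (d + 1), mul_right_comm, ← mul_pow]
      norm_num [mul_comm]
    rw [this]
    have : (4 / 5 : ℝ) ^ (d + 1) ≤ 1 := pow_le_one₀ (by norm_num) (by norm_num)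
    linarith
  rw [← mul_assoc] at h3
  have h5 := mul_le_mul_of_nonneg_right h4 hA
  linarith

lemma exists_doubling_radius {ρ : Measure (EuclideanSpace ℝ (Fin d))}
    [IsFiniteMeasure ρ] (x₀ : EuclideanSpace ℝ (Fin d)) {c r₀ : ℝ} (hc : 0 < c) (hr₀ : 0 < r₀)
    (h : ∀ r, 0 < r → r ≤ r₀ → c * r ^ d ≤ ρ.real (closedBall x₀ r)) :
    ∃ R, 0 < R ∧ R ≤ r₀ ∧ ∫ y, japWeight (d + 2) ((2 * R)⁻¹ • (y - x₀)) ∂ρ ≤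
      2 ^ (d + 1) * ∫ y, japWeight (d + 2) (R⁻¹ • (y - x₀)) ∂ρ := by
  by_contra! hcon
  set A : ℝ → ℝ := fun R => ∫ y, japWeight (d + 2) (R⁻¹ • (y - x₀)) ∂ρ
  have hR : ∀ n : ℕ, 0 < r₀ / 2 ^ n ∧ r₀ / 2 ^ n ≤ r₀ := fun n =>
    ⟨by positivity, div_le_self hr₀.le (one_le_pow₀ (by norm_num))⟩
  have hind : ∀ n : ℕ, (2 ^ (d + 1)) ^ n * A (r₀ / 2 ^ n) ≤ A r₀ := fun n => by
    induction n with
    | zero => simp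
    | succ n ih =>
      refine le_trans ?_ ih
      have h1 := hcon _ (hR (n + 1)).1 (hR (n + 1)).2
      have h2 : 2 * (r₀ / 2 ^ (n + 1)) = r₀ / 2 ^ n := by rw [pow_succ]; field_simp
      rw [h2] at h1
      rw [pow_succ, mul_assoc]
      exact mul_le_mul_of_nonneg_left h1.le (by positivity)
  have hlow : ∀ n : ℕ, 2 ^ n * ((2 ^ (d + 2))⁻¹ * (c * r₀ ^ d)) ≤ A r₀ := fun n => by
    refine le_trans ?_ (hind n)
    have h1 := mul_measureReal_closedBall_le_integral (ρ := ρ) x₀ (hR n).1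
    have h2 := h _ (hR n).1 (hR n).2
    have h3 : (2 ^ (d + 2))⁻¹ * (c * (r₀ / 2 ^ n) ^ d) ≤ A (r₀ / 2 ^ n) :=
      (mul_le_mul_of_nonneg_left h2 (by positivity)).trans h1
    refine le_trans (le_of_eq ?_) (mul_le_mul_of_nonneg_left h3 (by positivity))
    have e : ((2 : ℝ) ^ (d + 1)) ^ n = 2 ^ n * (2 ^ n) ^ d := by
      rw [← pow_mul, ← pow_mul, ← pow_add]; ring_nf
    rw [e, div_pow]
    field_simp
  set q := (2 ^ (d + 2))⁻¹ * (c * r₀ ^ d)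
  have hq : 0 < q := by positivity
  obtain ⟨n, hn⟩ := pow_unbounded_of_one_lt (A r₀ / q) (show (1 : ℝ) < 2 by norm_num)
  rw [div_lt_iff₀ hq] at hn
  exact absurd (hlow n) (not_le.2 hn)

lemma exists_good_radius {ρ : Measure (EuclideanSpace ℝ (Fin d))} [IsFiniteMeasure ρ]
    {x₀ : EuclideanSpace ℝ (Fin d)} {g : EuclideanSpace ℝ (Fin d) → ℝ} (hg : Measurable g)
    (hg0 : ∀ x, 0 ≤ g x) (hg2 : ∀ x, g x ≤ 2) (hgx : g x₀ = 0) {c r₀ : ℝ} (hc : 0 < c) (hr₀ : 0 < r₀)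
    (h : ∀ r, 0 < r → r ≤ r₀ → c * r ^ d ≤ ρ.real (closedBall x₀ r))
    (hleb : ∀ δ > 0, ∃ r₁ > 0, ∀ r, 0 < r → r ≤ r₁ →
      ∫ y in closedBall x₀ r, g y ∂ρ ≤ δ * ρ.real (closedBall x₀ r)) {δ R₁ : ℝ} (hδ : 0 < δ)
    (hR₁ : 0 < R₁) :
    ∃ R, 0 < R ∧ R ≤ R₁ ∧ 0 < ∫ y, japWeight (d + 2) (R⁻¹ • (y - x₀)) ∂ρ ∧
      (∫ y, japWeight (d + 2) (R⁻¹ • (y - x₀)) ∂ρ) ≤ 2 * ρ.real (closedBall x₀ (2 * R)) ∧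
      ∫ y, japWeight (d + 2) (R⁻¹ • (y - x₀)) * g y ∂ρ ≤
        δ * ∫ y, japWeight (d + 2) (R⁻¹ • (y - x₀)) ∂ρ := by
  obtain ⟨r₁, hr₁, hr₁g⟩ := hleb (δ / 2) (half_pos hδ)
  set q := δ / 2 * ((2 ^ (d + 2))⁻¹ * c) with hq
  have hq0 : 0 < q := by positivity
  set P := (2 * ρ.real univ) / r₁ ^ (2 * (d + 2)) with hP
  have hP0 : 0 ≤ P := by positivity
  set R₂ := min (min r₀ R₁) (min 1 (q / (P + 1)))
  have hR₂ : 0 < R₂ := lt_min (lt_min hr₀ hR₁) (lt_min one_pos (by positivity))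
  have hR₂' : R₂ ≤ r₀ := (min_le_left _ _).trans (min_le_left _ _)
  obtain ⟨R, hR, hRR, hdb⟩ := exists_doubling_radius (ρ := ρ) x₀ hc hR₂
    fun r hr hr' => h r hr (hr'.trans hR₂')
  have hR1 : R ≤ 1 := hRR.trans ((min_le_right _ _).trans (min_le_left _ _))
  have hRP : R * P ≤ q := by
    have h1 : R ≤ q / (P + 1) := hRR.trans ((min_le_right _ _).trans (min_le_right _ _))
    rw [le_div_iff₀ (by positivity)] at h1
    nlinarith
  have hlow : (2 ^ (d + 2))⁻¹ * (c * R ^ d) ≤ ∫ y, japWeight (d + 2) (R⁻¹ • (y - x₀)) ∂ρ :=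
    (mul_le_mul_of_nonneg_left (h R hR (hRR.trans hR₂')) (by positivity)).trans
      (mul_measureReal_closedBall_le_integral x₀ hR)
  refine ⟨R, hR, hRR.trans ((min_le_left _ _).trans (min_le_right _ _)),
    (by positivity : 0 < (2 ^ (d + 2))⁻¹ * (c * R ^ d)).trans_le hlow,
    half_integral_le_of_doubling x₀ hR hdb, ?_⟩
  refine (integral_weight_mul_le hg hg0 hg2 hgx (half_pos hδ).le hr₁ hR hr₁g).trans ?_
  have h2 : (R / r₁) ^ (2 * (d + 2)) * (2 * ρ.real univ) ≤
      δ / 2 * ∫ y, japWeight (d + 2) (R⁻¹ • (y - x₀)) ∂ρ := by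
    refine le_trans ?_ (mul_le_mul_of_nonneg_left hlow (half_pos hδ).le)
    have e1 : (R / r₁) ^ (2 * (d + 2)) * (2 * ρ.real univ) = R ^ (d + 3) * (R * P) * R ^ d := by
      rw [hP, div_pow]; ring
    have e2 : δ / 2 * ((2 ^ (d + 2))⁻¹ * (c * R ^ d)) = 1 * q * R ^ d := by rw [hq]; ring
    rw [e1, e2]
    gcongr
    exact pow_le_one₀ hR.le hR1
  linarith

end

section
variable {d : ℕ}

lemma pderiv'_comp_rescale (i : Fin d) {φ : EuclideanSpace ℝ (Fin d) → ℝ}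
    (hφ : ContDiff ℝ (⊤ : ℕ∞) φ) (R : ℝ) (x₀ x : EuclideanSpace ℝ (Fin d)) :
    pderiv' i (fun y => φ (R⁻¹ • (y - x₀))) x = R⁻¹ * pderiv' i φ (R⁻¹ • (x - x₀)) := by
  have h1 : HasFDerivAt φ (fderiv ℝ φ (R⁻¹ • (x - x₀))) (R⁻¹ • (x - x₀)) :=
    (hφ.differentiable (by simp) _).hasFDerivAt
  have h2 : HasFDerivAt (fun y : EuclideanSpace ℝ (Fin d) => R⁻¹ • (y - x₀))
      (R⁻¹ • ContinuousLinearMap.id ℝ _) x := ((hasFDerivAt_id x).sub_const x₀).const_smul R⁻¹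
  have h3 := h1.comp x h2
  unfold pderiv'
  rw [show (fun y => φ (R⁻¹ • (y - x₀))) = φ ∘ fun y => R⁻¹ • (y - x₀) from rfl, h3.fderiv]
  simp

lemma exists_delta_of_elliptic_rescaled {ι κ : Type*} [Fintype ι] [Fintype κ] (i₁ i₂ : κ → Fin d)
    (α₁ α₂ : κ → ι) {M : EuclideanSpace ℝ ι} (hM : ‖M‖ = 1) {c₀ : ℝ} (hc₀ : 0 < c₀)
    (hell : ∀ X : Fin d → EuclideanSpace ℝ ι, c₀ * ∑ i, ‖X i‖ ^ 2 ≤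
      ∑ i, ‖X i‖ ^ 2 - ∑ i, (inner ℝ M (X i)) ^ 2 +
        ∑ c, (X (i₁ c) (α₁ c) - X (i₂ c) (α₂ c)) ^ 2) :
    ∃ δ > 0, ∃ L : ℝ, 1 ≤ L ∧ ∀ (ρ : Measure (EuclideanSpace ℝ (Fin d))) [IsFiniteMeasure ρ]
      (F : EuclideanSpace ℝ (Fin d) → EuclideanSpace ℝ ι) (K : Set (EuclideanSpace ℝ (Fin d)))
      (x₀ : EuclideanSpace ℝ (Fin d)) (R : ℝ), 0 < R →
      StronglyMeasurable F → (∀ y, ‖F y‖ ≤ 1) → IsClosed K → volume K = 0 →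
      0 < ∫ y, japWeight (d + 2) (R⁻¹ • (y - x₀)) ∂ρ →
      (∫ y, japWeight (d + 2) (R⁻¹ • (y - x₀)) ∂ρ) ≤ 2 * ρ.real (closedBall x₀ (2 * R)) →
      (∀ c, ∀ φ : EuclideanSpace ℝ (Fin d) → ℝ, ContDiff ℝ (⊤ : ℕ∞) φ → HasCompactSupport φ →
        tsupport φ ⊆ ball x₀ (9 * L * R) →
        ∫ y, pderiv' (i₁ c) φ y * F y (α₁ c) ∂ρ = ∫ y, pderiv' (i₂ c) φ y * F y (α₂ c) ∂ρ) →
      δ * (∫ y, japWeight (d + 2) (R⁻¹ • (y - x₀)) ∂ρ) <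
        ∫ y, japWeight (d + 2) (R⁻¹ • (y - x₀)) * ‖K.indicator F y - M‖ ∂ρ := by
  obtain ⟨δ, hδ, L, hL, H⟩ := exists_delta_of_elliptic i₁ i₂ α₁ α₂ hM hc₀ hell
  refine ⟨δ, hδ, L, hL, fun ρ _ F K x₀ R hR hF hF1 hK hK0 hA hA2 hcl => ?_⟩
  set A := ∫ y, japWeight (d + 2) (R⁻¹ • (y - x₀)) ∂ρ with hAdef
  have hR0 : R⁻¹ ≠ 0 := inv_ne_zero hR.ne'
  let T : EuclideanSpace ℝ (Fin d) ≃ₜ EuclideanSpace ℝ (Fin d) :=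
    (Homeomorph.subRight x₀).trans (Homeomorph.smulOfNeZero R⁻¹ hR0)
  have hT : ∀ y, T y = R⁻¹ • (y - x₀) := fun y => rfl
  have hTs : ∀ y, T.symm y = R • y + x₀ := fun y => by
    rw [T.symm_apply_eq, hT]; simp [smul_smul, hR.ne']
  have hTinv : ∀ y, R • T y + x₀ = y := fun y => by rw [← hTs, T.symm_apply_apply]
  have hTe : MeasurableEmbedding T := T.measurableEmbedding
  have hintg : ∀ f : EuclideanSpace ℝ (Fin d) → ℝ,
      ∫ y, f y ∂(ENNReal.ofReal A⁻¹ • ρ.map T) = A⁻¹ * ∫ y, f (R⁻¹ • (y - x₀)) ∂ρ := by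
    intro f
    rw [integral_smul_measure, hTe.integral_map, ENNReal.toReal_ofReal (by positivity), smul_eq_mul]
    rfl
  have hfin : IsFiniteMeasure (ENNReal.ofReal A⁻¹ • ρ.map T) :=
    Measure.smul_finite _ ENNReal.ofReal_ne_top
  have hFc : Continuous fun y : EuclideanSpace ℝ (Fin d) => R • y + x₀ := by fun_prop
  have key := H (ENNReal.ofReal A⁻¹ • ρ.map T) (fun y => F (R • y + x₀)) (T '' K)
    (hF.comp_measurable hFc.measurable) (fun y => hF1 _)
    (T.isClosed_image.2 hK) ?_ ?_ ?_ ?_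
  · rw [hintg, ← div_eq_inv_mul, lt_div_iff₀ hA] at key
    refine key.trans_eq (integral_congr_ae (.of_forall fun y => ?_))
    have e : R • (R⁻¹ • (y - x₀)) + x₀ = y := hTinv y
    have e2 : R⁻¹ • (y - x₀) ∈ T '' K ↔ y ∈ K := by
      rw [← hT, T.injective.mem_set_image]
    dsimp only
    congr 3
    by_cases hy : y ∈ K
    · rw [indicator_of_mem hy, indicator_of_mem (e2.2 hy), e]
    · rw [indicator_of_notMem hy, indicator_of_notMem (mt e2.1 hy)]
  · have : T '' K = (fun y : EuclideanSpace ℝ (Fin d) => R • y) ⁻¹' ((fun y => y + x₀) ⁻¹' K) := by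
      ext y
      rw [T.image_eq_preimage_symm]
      simp [hTs]
    rw [this, Measure.addHaar_preimage_smul _ hR.ne', measure_preimage_add_right, hK0, mul_zero]
  · rw [hintg, ← hAdef, inv_mul_cancel₀ hA.ne']
  · have e : T ⁻¹' closedBall 0 2 = closedBall x₀ (2 * R) := by
      ext y
      rw [mem_preimage, hT, mem_closedBall_zero_iff, mem_closedBall, dist_eq_norm, norm_smul, norm_inv,
        Real.norm_eq_abs, abs_of_pos hR, ← div_eq_inv_mul, div_le_iff₀ hR]
    rw [measureReal_ennreal_smul_apply, map_measureReal_apply T.measurable measurableSet_closedBall, e,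
      ENNReal.toReal_ofReal (by positivity), ← div_eq_inv_mul, le_div_iff₀ hA]
    linarith
  · intro c φ hφ hφc hφs
    have h := hcl c (fun y => φ (R⁻¹ • (y - x₀))) (hφ.comp (by fun_prop)) (hφc.comp_homeomorph T) ?_
    · rw [hintg, hintg]
      simp only [pderiv'_comp_rescale _ hφ, mul_assoc, integral_const_mul] at h
      have e : ∀ y, R • (R⁻¹ • (y - x₀)) + x₀ = y := hTinv
      simp only [e]
      rw [mul_right_injective₀ hR0 h]
    · rw [show (fun y => φ (R⁻¹ • (y - x₀))) = φ ∘ T from rfl, tsupport_comp_eq_preimage]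
      intro y hy
      have := hφs hy
      rw [hT, mem_ball_zero_iff, norm_smul, norm_inv, Real.norm_eq_abs, abs_of_pos hR,
        ← div_eq_inv_mul, div_lt_iff₀ hR] at this
      rwa [mem_ball, dist_eq_norm]

end

section
variable {d : ℕ}

lemma ae_exists_mul_pow_le_measureReal_closedBall (ρ : Measure (EuclideanSpace ℝ (Fin d)))
    [IsFiniteMeasure ρ] :
    ∀ᵐ x ∂ρ, ∃ c > 0, ∃ r₀ > 0, ∀ r, 0 < r → r ≤ r₀ → c * r ^ d ≤ ρ.real (closedBall x r) := by
  filter_upwards [Besicovitch.ae_tendsto_rnDeriv (volume : Measure (EuclideanSpace ℝ (Fin d))) ρ,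
    Measure.rnDeriv_lt_top (volume : Measure (EuclideanSpace ℝ (Fin d))) ρ] with x hx hxt
  set D := (volume : Measure (EuclideanSpace ℝ (Fin d))).rnDeriv ρ x
  have h1 : D < D + 1 := ENNReal.lt_add_right hxt.ne one_ne_zero
  have hDt : D + 1 ≠ ⊤ := ENNReal.add_ne_top.2 ⟨hxt.ne, ENNReal.one_ne_top⟩
  obtain ⟨r₀, hr₀, hr⟩ := mem_nhdsGT_iff_exists_Ioc_subset.1 (hx.eventually_lt_const h1)
  have hC : 0 < (D + 1).toReal := ENNReal.toReal_pos (by simp) hDt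
  have hv : 0 < volume.real (ball (0 : EuclideanSpace ℝ (Fin d)) 1) :=
    ENNReal.toReal_pos (measure_ball_pos _ _ one_pos).ne' measure_ball_lt_top.ne
  refine ⟨volume.real (ball (0 : EuclideanSpace ℝ (Fin d)) 1) / (D + 1).toReal, by positivity, r₀, hr₀,
    fun r h0 h => ?_⟩
  have h2 : volume (closedBall x r) / ρ (closedBall x r) ≤ D + 1 := le_of_lt (hr ⟨h0, h⟩)
  rw [ENNReal.div_le_iff_le_mul (.inr hDt) (.inl (measure_ne_top _ _)),
    Measure.addHaar_closedBall _ _ h0.le, finrank_euclideanSpace_fin] at h2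
  have h3 := ENNReal.toReal_mono (ENNReal.mul_ne_top hDt (measure_ne_top _ _)) h2
  rw [ENNReal.toReal_mul, ENNReal.toReal_mul, ENNReal.toReal_ofReal (by positivity)] at h3
  rw [div_mul_eq_mul_div, div_le_iff₀ hC, mul_comm, mul_comm (ρ.real _)]
  exact h3

lemma ae_setIntegral_norm_sub_le {E : Type*} [NormedAddCommGroup E]
    (ρ : Measure (EuclideanSpace ℝ (Fin d))) [IsFiniteMeasure ρ]
    {f : EuclideanSpace ℝ (Fin d) → E} (hf : Integrable f ρ) :
    ∀ᵐ x ∂ρ, ∀ δ > 0, ∃ r₁ > 0, ∀ r, 0 < r → r ≤ r₁ →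
      ∫ y in closedBall x r, ‖f y - f x‖ ∂ρ ≤ δ * ρ.real (closedBall x r) := by
  filter_upwards [(Besicovitch.vitaliFamily ρ).ae_tendsto_average_norm_sub hf.locallyIntegrable]
    with x hx δ hδ
  have h := hx.comp (Besicovitch.tendsto_filterAt ρ x)
  obtain ⟨r₁, hr₁, hr⟩ := mem_nhdsGT_iff_exists_Ioc_subset.1 (h.eventually_lt_const hδ)
  refine ⟨r₁, hr₁, fun r h0 h1 => ?_⟩
  have h2 : ⨍ y in closedBall x r, ‖f y - f x‖ ∂ρ < δ := hr ⟨h0, h1⟩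
  rw [← measure_smul_setAverage _ (measure_ne_top _ _), smul_eq_mul, mul_comm]
  exact mul_le_mul_of_nonneg_right h2.le measureReal_nonneg

lemma ae_not_elliptic {ι κ : Type*} [Fintype ι] [Fintype κ] (i₁ i₂ : κ → Fin d)
    (α₁ α₂ : κ → ι) (ρ : Measure (EuclideanSpace ℝ (Fin d))) [IsFiniteMeasure ρ]
    {F : EuclideanSpace ℝ (Fin d) → EuclideanSpace ℝ ι} (hF : StronglyMeasurable F)
    (hF1 : ∀ y, ‖F y‖ ≤ 1) {K Ω : Set (EuclideanSpace ℝ (Fin d))} (hK : IsClosed K)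
    (hK0 : volume K = 0) (hΩ : IsOpen Ω) (hKΩ : K ⊆ Ω)
    (hcl : ∀ c, ∀ φ : EuclideanSpace ℝ (Fin d) → ℝ, ContDiff ℝ (⊤ : ℕ∞) φ → HasCompactSupport φ →
        tsupport φ ⊆ Ω →
        ∫ y, pderiv' (i₁ c) φ y * F y (α₁ c) ∂ρ = ∫ y, pderiv' (i₂ c) φ y * F y (α₂ c) ∂ρ) :
    ∀ᵐ x ∂ρ, x ∈ K → ‖F x‖ = 1 → ¬ ∃ c₀ > 0, ∀ X : Fin d → EuclideanSpace ℝ ι,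
      c₀ * ∑ i, ‖X i‖ ^ 2 ≤ ∑ i, ‖X i‖ ^ 2 - ∑ i, (inner ℝ (F x) (X i)) ^ 2 +
        ∑ c, (X (i₁ c) (α₁ c) - X (i₂ c) (α₂ c)) ^ 2 := by
  have hf : StronglyMeasurable (K.indicator F) := hF.indicator hK.measurableSet
  have hf1 : ∀ y, ‖K.indicator F y‖ ≤ 1 := fun y => (norm_indicator_le_norm_self _ _).trans (hF1 y)
  have hfi : Integrable (K.indicator F) ρ :=
    .of_bound hf.aestronglyMeasurable 1 (.of_forall hf1)
  filter_upwards [ae_exists_mul_pow_le_measureReal_closedBall ρ, ae_setIntegral_norm_sub_le ρ hfi]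
    with x ⟨c, hc, r₀, hr₀, hden⟩ hleb hxK hx1 ⟨c₀, hc₀, hell⟩
  obtain ⟨δ, hδ, L, hL, H⟩ := exists_delta_of_elliptic_rescaled i₁ i₂ α₁ α₂ hx1 hc₀ hell
  obtain ⟨ε, hε, hεΩ⟩ := Metric.isOpen_iff.1 hΩ x (hKΩ hxK)
  have hL0 : 0 < 9 * L := by linarith
  obtain ⟨R, hR, hRR, hA, hA2, hg⟩ := exists_good_radius (ρ := ρ) (x₀ := x)
    (g := fun y => ‖K.indicator F y - K.indicator F x‖)
    ((hf.sub stronglyMeasurable_const).norm.measurable) (fun _ => norm_nonneg _)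
    (fun y => (norm_sub_le _ _).trans (by linarith [hf1 y, hf1 x])) (by simp) hc hr₀ hden hleb hδ
    (R₁ := ε / (9 * L)) (by positivity)
  have hball : ball x (9 * L * R) ⊆ Ω := by
    refine (ball_subset_ball ?_).trans hεΩ
    rwa [le_div_iff₀ hL0, mul_comm] at hRR
  have := H ρ F K x R hR hF hF1 hK hK0 hA hA2
    fun c φ h1 h2 h3 => hcl c φ h1 h2 (h3.trans hball)
  simp only [indicator_of_mem hxK] at hg
  exact absurd this (not_lt.2 hg)

end

section
variable {d : ℕ}

lemma contDiff_pderiv' (j : Fin d) {φ : EuclideanSpace ℝ (Fin d) → ℝ}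
    (hφ : ContDiff ℝ (⊤ : ℕ∞) φ) : ContDiff ℝ (⊤ : ℕ∞) (pderiv' j φ) :=
  (hφ.fderiv_right (m := (⊤ : ℕ∞)) (by simp)).clm_apply contDiff_const

lemma tsupport_pderiv'_subset (j : Fin d) (φ : EuclideanSpace ℝ (Fin d) → ℝ) :
    tsupport (pderiv' j φ) ⊆ tsupport φ := by
  refine closure_minimal (fun x hx => ?_) (isClosed_tsupport φ)
  refine support_fderiv_subset ℝ (f := φ) ?_
  contrapose! hx
  simp only [Function.mem_support, not_not] at hx ⊢
  simp [pderiv', hx]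

lemma pderiv'_comm (i j : Fin d) {φ : EuclideanSpace ℝ (Fin d) → ℝ}
    (hφ : ContDiff ℝ (⊤ : ℕ∞) φ) : pderiv' i (pderiv' j φ) = pderiv' j (pderiv' i φ) := by
  have h1 : ∀ (a b : Fin d) (x), pderiv' a (pderiv' b φ) x =
      fderiv ℝ (fderiv ℝ φ) x (EuclideanSpace.single a 1) (EuclideanSpace.single b 1) := by
    intro a b x
    have hd : DifferentiableAt ℝ (fderiv ℝ φ) x :=
      (hφ.fderiv_right (m := (⊤ : ℕ∞)) (by simp)).differentiable (by simp) x
    have := (hd.hasFDerivAt.clm_apply (hasFDerivAt_const (EuclideanSpace.single b (1 : ℝ)) x)).fderiv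
    rw [pderiv', show pderiv' b φ = fun y => fderiv ℝ φ y (EuclideanSpace.single b 1) from rfl, this]
    simp
  funext x
  rw [h1, h1]
  exact (hφ.contDiffAt.isSymmSndFDerivAt (by
    rw [minSmoothness_of_isRCLikeNormedField]
    exact WithTop.coe_le_coe.2 (le_top (a := (2 : ℕ∞))))).eq _ _

lemma contDiff_foldr_pderiv' (s : List (Fin d)) {φ : EuclideanSpace ℝ (Fin d) → ℝ}
    (hφ : ContDiff ℝ (⊤ : ℕ∞) φ) :
    ContDiff ℝ (⊤ : ℕ∞) (s.foldr (fun i ψ => pderiv' i ψ) φ) := by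
  induction s with
  | nil => exact hφ
  | cons a s ih => exact contDiff_pderiv' a ih

lemma foldr_pderiv'_comm (s : List (Fin d)) (i : Fin d) {φ : EuclideanSpace ℝ (Fin d) → ℝ}
    (hφ : ContDiff ℝ (⊤ : ℕ∞) φ) :
    s.foldr (fun i ψ => pderiv' i ψ) (pderiv' i φ) =
      pderiv' i (s.foldr (fun i ψ => pderiv' i ψ) φ) := by
  induction s with
  | nil => rfl
  | cons a s ih =>
    rw [List.foldr_cons, ih, List.foldr_cons, pderiv'_comm a i (contDiff_foldr_pderiv' s hφ)]

lemma pderivSeq_cons_pderiv'_comm {n : ℕ} (i j : Fin d) (J : Fin n → Fin d)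
    {φ : EuclideanSpace ℝ (Fin d) → ℝ} (hφ : ContDiff ℝ (⊤ : ℕ∞) φ) :
    pderivSeq (Fin.cons j J : Fin (n + 1) → Fin d) (pderiv' i φ) =
      pderivSeq (Fin.cons i J : Fin (n + 1) → Fin d) (pderiv' j φ) := by
  simp only [pderivSeq, List.ofFn_cons, List.foldr_cons, foldr_pderiv'_comm _ _ hφ]
  exact pderiv'_comm _ _ (contDiff_foldr_pderiv' _ hφ)

lemma norm_sub_inner_smul_sq {ι : Type*} [Fintype ι] {M : EuclideanSpace ℝ ι} (hM : ‖M‖ = 1)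
    (Y : EuclideanSpace ℝ ι) :
    ‖Y - (inner ℝ M Y : ℝ) • M‖ ^ 2 = ‖Y‖ ^ 2 - (inner ℝ M Y : ℝ) ^ 2 := by
  rw [norm_sub_sq_real, inner_smul_right, real_inner_comm, norm_smul, hM, Real.norm_eq_abs, mul_one,
    sq_abs]
  ring

/-- The quadratic form of the constraint system given by `i₁ i₂ α₁ α₂` together with the projection
orthogonal to `M`. -/
noncomputable def constraintForm {ι κ : Type*} [Fintype ι] [Fintype κ] (i₁ i₂ : κ → Fin d)
    (α₁ α₂ : κ → ι) (M : EuclideanSpace ℝ ι) (X : Fin d → EuclideanSpace ℝ ι) : ℝ :=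
  ∑ i, ‖X i‖ ^ 2 - ∑ i, (inner ℝ M (X i)) ^ 2 + ∑ c, (X (i₁ c) (α₁ c) - X (i₂ c) (α₂ c)) ^ 2

lemma constraintForm_eq {ι κ : Type*} [Fintype ι] [Fintype κ] (i₁ i₂ : κ → Fin d)
    (α₁ α₂ : κ → ι) {M : EuclideanSpace ℝ ι} (hM : ‖M‖ = 1) (X : Fin d → EuclideanSpace ℝ ι) :
    constraintForm i₁ i₂ α₁ α₂ M X = ∑ i, ‖X i - (inner ℝ M (X i) : ℝ) • M‖ ^ 2 +
      ∑ c, (X (i₁ c) (α₁ c) - X (i₂ c) (α₂ c)) ^ 2 := by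
  simp only [constraintForm, norm_sub_inner_smul_sq hM, Finset.sum_sub_distrib]

lemma continuous_constraintForm {ι κ : Type*} [Fintype ι] [Fintype κ] (i₁ i₂ : κ → Fin d)
    (α₁ α₂ : κ → ι) (M : EuclideanSpace ℝ ι) :
    Continuous (constraintForm i₁ i₂ α₁ α₂ M) := by
  unfold constraintForm
  fun_prop

lemma constraintForm_smul {ι κ : Type*} [Fintype ι] [Fintype κ] (i₁ i₂ : κ → Fin d)
    (α₁ α₂ : κ → ι) (M : EuclideanSpace ℝ ι) (s : ℝ) (X : Fin d → EuclideanSpace ℝ ι) :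
    constraintForm i₁ i₂ α₁ α₂ M (s • X) = s ^ 2 * constraintForm i₁ i₂ α₁ α₂ M X := by
  simp only [constraintForm, Pi.smul_apply, norm_smul, mul_pow, Real.norm_eq_abs, sq_abs,
    inner_smul_right, PiLp.smul_apply, smul_eq_mul, ← mul_sub, ← Finset.mul_sum]
  ring

lemma constraintForm_pos {ι κ : Type*} [Fintype ι] [Fintype κ] {i₁ i₂ : κ → Fin d}
    {α₁ α₂ : κ → ι} {M : EuclideanSpace ℝ ι} (hM : ‖M‖ = 1)
    (h : ∀ v : Fin d → ℝ, (∀ c, v (i₁ c) * M (α₁ c) = v (i₂ c) * M (α₂ c)) → v = 0)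
    {X : Fin d → EuclideanSpace ℝ ι} (hX : 0 < ∑ i, ‖X i‖ ^ 2) :
    0 < constraintForm i₁ i₂ α₁ α₂ M X := by
  by_contra! hle
  rw [constraintForm_eq _ _ _ _ hM] at hle
  have a1 : 0 ≤ ∑ i, ‖X i - (inner ℝ M (X i) : ℝ) • M‖ ^ 2 :=
    Finset.sum_nonneg fun i _ => sq_nonneg _
  have a2 : 0 ≤ ∑ c, (X (i₁ c) (α₁ c) - X (i₂ c) (α₂ c)) ^ 2 :=
    Finset.sum_nonneg fun i _ => sq_nonneg _
  have b1 := (Finset.sum_eq_zero_iff_of_nonneg (fun i _ => sq_nonneg _)).1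
    (le_antisymm (by linarith) a1)
  have b2 := (Finset.sum_eq_zero_iff_of_nonneg (fun i _ => sq_nonneg _)).1
    (le_antisymm (by linarith) a2)
  have c1 : ∀ i, X i = (inner ℝ M (X i) : ℝ) • M := fun i => by
    have := b1 i (Finset.mem_univ i)
    rwa [sq_eq_zero_iff, norm_eq_zero, sub_eq_zero] at this
  have c2 : ∀ c, X (i₁ c) (α₁ c) = X (i₂ c) (α₂ c) := fun c => by
    have := b2 c (Finset.mem_univ c)
    rwa [sq_eq_zero_iff, sub_eq_zero] at this
  have c3 : ∀ i α, X i α = (inner ℝ M (X i) : ℝ) * M α := fun i α =>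
    congrArg (fun Y : EuclideanSpace ℝ ι => Y α) (c1 i)
  have hv := h (fun i => inner ℝ M (X i)) fun c => by
    rw [← c3, ← c3]
    exact c2 c
  refine hX.ne' (Finset.sum_eq_zero fun i _ => ?_)
  rw [c1 i, show (inner ℝ M (X i) : ℝ) = 0 from congrFun hv i]
  simp

lemma exists_elliptic_const {ι κ : Type*} [Fintype ι] [Fintype κ] (i₁ i₂ : κ → Fin d)
    (α₁ α₂ : κ → ι) {M : EuclideanSpace ℝ ι} (hM : ‖M‖ = 1)
    (h : ∀ v : Fin d → ℝ, (∀ c, v (i₁ c) * M (α₁ c) = v (i₂ c) * M (α₂ c)) → v = 0) :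
    ∃ c₀ > 0, ∀ X : Fin d → EuclideanSpace ℝ ι,
      c₀ * ∑ i, ‖X i‖ ^ 2 ≤ ∑ i, ‖X i‖ ^ 2 - ∑ i, (inner ℝ M (X i)) ^ 2 +
        ∑ c, (X (i₁ c) (α₁ c) - X (i₂ c) (α₂ c)) ^ 2 := by
  have hcomp : IsCompact {X : Fin d → EuclideanSpace ℝ ι | ∑ i, ‖X i‖ ^ 2 = 1} := by
    refine Metric.isCompact_of_isClosed_isBounded (isClosed_eq (by fun_prop) (by fun_prop)) ?_
    refine (Metric.isBounded_closedBall (x := 0) (r := 1)).subset fun X hX => ?_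
    rw [mem_closedBall_zero_iff, pi_norm_le_iff_of_nonneg zero_le_one]
    intro i
    have : ‖X i‖ ^ 2 ≤ 1 := by
      rw [← show ∑ i, ‖X i‖ ^ 2 = 1 from hX]
      exact Finset.single_le_sum (f := fun i => ‖X i‖ ^ 2) (fun _ _ => by positivity)
        (Finset.mem_univ i)
    nlinarith [norm_nonneg (X i)]
  obtain ⟨c₀, hc₀, hmin⟩ := hcomp.exists_forall_le'
    (continuous_constraintForm i₁ i₂ α₁ α₂ M).continuousOn
    (a := 0) fun X hX => constraintForm_pos hM h
      (by rw [show ∑ i, ‖X i‖ ^ 2 = 1 from hX]; exact one_pos)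
  refine ⟨c₀, hc₀, fun X => ?_⟩
  change _ ≤ constraintForm i₁ i₂ α₁ α₂ M X
  have hS : 0 ≤ ∑ i, ‖X i‖ ^ 2 := Finset.sum_nonneg fun i _ => sq_nonneg _
  rcases hS.eq_or_lt with h0 | h0
  · rw [← h0, mul_zero, constraintForm_eq _ _ _ _ hM]
    exact add_nonneg (Finset.sum_nonneg fun i _ => sq_nonneg _)
      (Finset.sum_nonneg fun i _ => sq_nonneg _)
  · have hs : (√(∑ i, ‖X i‖ ^ 2))⁻¹ ^ 2 = (∑ i, ‖X i‖ ^ 2)⁻¹ := by rw [inv_pow, Real.sq_sqrt h0.le]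
    have e1 := hmin ((√(∑ i, ‖X i‖ ^ 2))⁻¹ • X) (by
      simp only [Set.mem_ofPred_eq, Pi.smul_apply, norm_smul, mul_pow, Real.norm_eq_abs, sq_abs, hs,
        ← Finset.mul_sum]
      rw [inv_mul_cancel₀ h0.ne'])
    rw [constraintForm_smul, hs, ← div_eq_inv_mul, le_div_iff₀ h0] at e1
    exact e1

lemma apply_eq_prod_of_symm_of_mul_eq {n : ℕ} {G : (Fin (n + 1) → Fin d) → ℝ}
    (hsymm : ∀ iv, ∀ σ : Equiv.Perm (Fin (n + 1)), G (iv ∘ σ) = G iv) {v : Fin d → ℝ}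
    (hv : ∀ i j (J : Fin n → Fin d), v i * G (Fin.cons j J) = v j * G (Fin.cons i J))
    {i₀ : Fin d} (hi₀ : v i₀ ≠ 0) (iv : Fin (n + 1) → Fin d) :
    G iv = G (fun _ => i₀) / v i₀ ^ (n + 1) * ∏ t, v (iv t) := by
  have hup : ∀ t j (iv : Fin (n + 1) → Fin d), G (Function.update iv t j) =
      G (Fin.cons j (Fin.tail (iv ∘ Equiv.swap 0 t))) := by
    intro t j iv
    rw [← hsymm _ (Equiv.swap 0 t)]
    congr 1
    funext s
    refine Fin.cases ?_ (fun s => ?_) s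
    · simp
    · have : Equiv.swap 0 t s.succ ≠ t := by
        rw [Ne, Equiv.swap_apply_eq_iff, Equiv.swap_apply_right]
        exact Fin.succ_ne_zero s
      simp [Fin.tail, Function.update_of_ne this]
  have hstep : ∀ s : Finset (Fin (n + 1)), G iv =
      (∏ t ∈ s, v (iv t) / v i₀) * G (s.piecewise (fun _ => i₀) iv) := by
    intro s
    induction s using Finset.induction_on with
    | empty => simp
    | insert t s ht ih =>
      rw [ih, Finset.prod_insert ht, Finset.piecewise_insert, hup]
      have e : s.piecewise (fun _ => i₀) iv =
          Function.update (s.piecewise (fun _ => i₀) iv) t (iv t) := by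
        rw [Function.eq_update_iff]
        simp [ht]
      rw [e, hup, ← e]
      have := hv i₀ (iv t) (Fin.tail (s.piecewise (fun _ => i₀) iv ∘ Equiv.swap 0 t))
      field_simp
      linear_combination (∏ t ∈ s, v (iv t) / v i₀) * this
  rw [hstep Finset.univ, Finset.piecewise_univ, Finset.prod_div_distrib, Finset.prod_const]
  simp
  ring

end

section
variable {d : ℕ}

lemma exists_rank_one_of_mul_eq {l n : ℕ} {G : Fin l → (Fin (n + 1) → Fin d) → ℝ}
    (hsymm : ∀ k iv, ∀ σ : Equiv.Perm (Fin (n + 1)), G k (iv ∘ σ) = G k iv)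
    (hG : ∑ k, ∑ iv, G k iv ^ 2 = 1) {v : Fin d → ℝ} (hv0 : v ≠ 0)
    (hv : ∀ k i j (J : Fin n → Fin d), v i * G k (Fin.cons j J) = v j * G k (Fin.cons i J)) :
    ∃ (a : Fin l → ℝ) (b : Fin d → ℝ), a ≠ 0 ∧ b ≠ 0 ∧
      ∀ (k : Fin l) (iv : Fin (n + 1) → Fin d), G k iv = a k * ∏ t, b (iv t) := by
  obtain ⟨i₀, hi₀⟩ := Function.ne_iff.1 hv0
  have h := fun k => apply_eq_prod_of_symm_of_mul_eq (hsymm k) (hv k) hi₀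
  refine ⟨fun k => G k (fun _ => i₀) / v i₀ ^ (n + 1), v, fun ha => ?_, hv0, h⟩
  have h0 : ∀ k iv, G k iv = 0 := fun k iv => by
    rw [h k iv, show G k (fun _ => i₀) / v i₀ ^ (n + 1) = 0 from congrFun ha k, zero_mul]
  simp [h0] at hG

lemma integral_pderiv'_mul_eq {l n : ℕ} {Ω : Set (EuclideanSpace ℝ (Fin d))}
    {u : EuclideanSpace ℝ (Fin d) → EuclideanSpace ℝ (Fin l)}
    {ρ : Measure (EuclideanSpace ℝ (Fin d))}
    {F : EuclideanSpace ℝ (Fin d) → (Fin l → (Fin (n + 1) → Fin d) → ℝ)}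
    (hDru : ∀ φ : EuclideanSpace ℝ (Fin d) → ℝ,
      ContDiff ℝ (⊤ : ℕ∞) φ → HasCompactSupport φ → tsupport φ ⊆ Ω →
      ∀ (k : Fin l) (iv : Fin (n + 1) → Fin d),
        ∫ x in Ω, u x k * pderivSeq iv φ x ∂volume
          = (-1 : ℝ) ^ (n + 1) * ∫ x, φ x * F x k iv ∂ρ)
    {φ : EuclideanSpace ℝ (Fin d) → ℝ} (hφ : ContDiff ℝ (⊤ : ℕ∞) φ) (hφc : HasCompactSupport φ)
    (hφΩ : tsupport φ ⊆ Ω) (k : Fin l) (i j : Fin d) (J : Fin n → Fin d) :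
    ∫ y, pderiv' i φ y * F y k (Fin.cons j J) ∂ρ = ∫ y, pderiv' j φ y * F y k (Fin.cons i J) ∂ρ := by
  have h : ∀ i j : Fin d, ∫ x in Ω, u x k * pderivSeq (Fin.cons j J : Fin (n + 1) → Fin d)
      (pderiv' i φ) x = (-1 : ℝ) ^ (n + 1) * ∫ y, pderiv' i φ y * F y k (Fin.cons j J) ∂ρ :=
    fun i j => hDru _ (contDiff_pderiv' i hφ)
      (hφc.of_isClosed_subset (isClosed_tsupport _) (tsupport_pderiv'_subset i φ))
      ((tsupport_pderiv'_subset i φ).trans hφΩ) k _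
  have h1 := h i j
  rw [pderivSeq_cons_pderiv'_comm i j J hφ, h j i] at h1
  exact (mul_right_injective₀ (pow_ne_zero _ (by norm_num)) h1).symm

/-- If a property holds almost everywhere on each closed Lebesgue-null subset of `Ω`, it holds almost
everywhere for the singular part of a finite measure concentrated on `Ω`. -/
lemma ae_singularPart_of_closed {ρ : Measure (EuclideanSpace ℝ (Fin d))} [IsFiniteMeasure ρ]
    {Ω : Set (EuclideanSpace ℝ (Fin d))} (hΩ : IsOpen Ω) (hρΩ : ρ Ωᶜ = 0)
    {P : EuclideanSpace ℝ (Fin d) → Prop}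
    (h : ∀ K, IsClosed K → volume K = 0 → K ⊆ Ω → ∀ᵐ x ∂ρ, x ∈ K → P x) :
    ∀ᵐ x ∂(ρ.singularPart volume), P x := by
  have hac : ρ.singularPart volume ≪ ρ :=
    Measure.absolutelyContinuous_of_le (Measure.singularPart_le _ _)
  obtain ⟨s, hs, hs0, hsv⟩ := ρ.mutuallySingular_singularPart volume
  have hN : MeasurableSet (sᶜ ∩ Ω) := hs.compl.inter hΩ.measurableSet
  choose K hKN hKc hKε using fun n : ℕ => hN.exists_isCompact_sdiff_lt (μ := ρ) (measure_ne_top _ _)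
    (ε := ((n : ENNReal) + 1)⁻¹) (by simp)
  have hrest : ρ ((sᶜ ∩ Ω) \ ⋃ n, K n) = 0 := by
    by_contra hne
    obtain ⟨n, hn⟩ := ENNReal.exists_inv_nat_lt hne
    refine absurd (hKε n) (not_lt.2 ?_)
    calc ((n : ENNReal) + 1)⁻¹ ≤ (n : ENNReal)⁻¹ := ENNReal.inv_le_inv.2 le_self_add
      _ ≤ ρ ((sᶜ ∩ Ω) \ ⋃ n, K n) := hn.le
      _ ≤ ρ ((sᶜ ∩ Ω) \ K n) := measure_mono (sdiff_subset_sdiff_right (subset_iUnion K n))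
  have hP : ∀ᵐ x ∂ρ, ∀ n, x ∈ K n → P x := ae_all_iff.2 fun n =>
    h _ (hKc n).isClosed (measure_mono_null ((hKN n).trans inter_subset_left) hsv)
      ((hKN n).trans inter_subset_right)
  filter_upwards [hac.ae_le hP, hac.ae_le (measure_eq_zero_iff_ae_notMem.1 hrest),
    hac.ae_le (measure_eq_zero_iff_ae_notMem.1 hρΩ), measure_eq_zero_iff_ae_notMem.1 hs0]
    with x h1 h2 h3 h4
  obtain ⟨n, hn⟩ := mem_iUnion.1 (not_not.1 fun hx => h2 ⟨⟨h4, not_not.1 h3⟩, hx⟩)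
  exact h1 n hn

lemma rank_one_succ {l n : ℕ} {Ω : Set (EuclideanSpace ℝ (Fin d))} (hΩ : IsOpen Ω)
    {u : EuclideanSpace ℝ (Fin d) → EuclideanSpace ℝ (Fin l)}
    {ρ : Measure (EuclideanSpace ℝ (Fin d))} [IsFiniteMeasure ρ] (hρΩ : ρ Ωᶜ = 0)
    {F : EuclideanSpace ℝ (Fin d) → (Fin l → (Fin (n + 1) → Fin d) → ℝ)}
    (hF : AEStronglyMeasurable F ρ)
    (hsymm : ∀ x, ∀ k : Fin l, ∀ iv : Fin (n + 1) → Fin d, ∀ σ : Equiv.Perm (Fin (n + 1)),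
      F x k (iv ∘ σ) = F x k iv)
    (hpolar : ∀ᵐ x ∂ρ, ∑ k, ∑ iv : Fin (n + 1) → Fin d, (F x k iv) ^ 2 = 1)
    (hDru : ∀ φ : EuclideanSpace ℝ (Fin d) → ℝ,
      ContDiff ℝ (⊤ : ℕ∞) φ → HasCompactSupport φ → tsupport φ ⊆ Ω →
      ∀ (k : Fin l) (iv : Fin (n + 1) → Fin d),
        ∫ x in Ω, u x k * pderivSeq iv φ x ∂volume
          = (-1 : ℝ) ^ (n + 1) * ∫ x, φ x * F x k iv ∂ρ) :
    ∀ᵐ x ∂(ρ.singularPart volume),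
      ∃ (a : Fin l → ℝ) (b : Fin d → ℝ), a ≠ 0 ∧ b ≠ 0 ∧
        ∀ (k : Fin l) (iv : Fin (n + 1) → Fin d), F x k iv = a k * ∏ t, b (iv t) := by
  let toE : (Fin l → (Fin (n + 1) → Fin d) → ℝ) →
    EuclideanSpace ℝ (Fin l × (Fin (n + 1) → Fin d)) := fun G => WithLp.toLp 2 fun p => G p.1 p.2
  have htoE : Continuous toE := by
    refine (PiLp.continuous_toLp 2 _).comp (continuous_pi fun p => ?_)
    fun_prop
  have hnorm : ∀ G, ‖toE G‖ ^ 2 = ∑ k, ∑ iv, G k iv ^ 2 := fun G => by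
    rw [EuclideanSpace.norm_sq_eq, Fintype.sum_prod_type]
    simp [toE]
  obtain ⟨F₀, hF₀, hFF₀⟩ := hF
  have hE : StronglyMeasurable fun x => toE (F₀ x) := htoE.comp_stronglyMeasurable hF₀
  set S := {x | ‖toE (F₀ x)‖ ≤ 1}
  have hS : MeasurableSet S := measurableSet_le hE.norm.measurable measurable_const
  set F₁ := S.indicator fun x => toE (F₀ x)
  have hF₁ : StronglyMeasurable F₁ := hE.indicator hS
  have hF₁1 : ∀ x, ‖F₁ x‖ ≤ 1 := fun x => by
    by_cases hx : x ∈ S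
    · rw [show F₁ x = toE (F₀ x) from indicator_of_mem hx _]
      exact hx
    · rw [show F₁ x = 0 from indicator_of_notMem hx _]
      simp
  have hone : ∀ᵐ x ∂ρ, ‖toE (F x)‖ = 1 := by
    filter_upwards [hpolar] with x hx
    have := hnorm (F x)
    rw [hx] at this
    exact (pow_eq_one_iff_of_nonneg (norm_nonneg _) two_ne_zero).1 this
  have hFF₁ : ∀ᵐ x ∂ρ, F₁ x = toE (F x) := by
    filter_upwards [hFF₀, hone] with x hx h1
    have : x ∈ S := by
      change ‖toE (F₀ x)‖ ≤ 1
      rw [← hx, h1]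
    rw [show F₁ x = toE (F₀ x) from indicator_of_mem this _, hx]
  refine ae_singularPart_of_closed hΩ hρΩ fun K hK hK0 hKΩ => ?_
  have key := ae_not_elliptic (κ := Fin l × Fin d × Fin d × (Fin n → Fin d))
    (fun c => c.2.1) (fun c => c.2.2.1) (fun c => (c.1, Fin.cons c.2.2.1 c.2.2.2))
    (fun c => (c.1, Fin.cons c.2.1 c.2.2.2)) ρ hF₁ hF₁1 hK hK0 hΩ hKΩ
    fun c φ h1 h2 h3 => by
      have e : ∀ (ψ : EuclideanSpace ℝ (Fin d) → ℝ) (p : Fin l × (Fin (n + 1) → Fin d)),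
          ∫ y, ψ y * F₁ y p ∂ρ = ∫ y, ψ y * F y p.1 p.2 ∂ρ := fun ψ p =>
        integral_congr_ae (hFF₁.mono fun y hy => by dsimp only; rw [hy])
      rw [e, e]
      exact integral_pderiv'_mul_eq hDru h1 h2 h3 _ _ _ _
  filter_upwards [key, hFF₁, hone, hpolar] with x hx h1 h2 h3 hxK
  have hM : ‖F₁ x‖ = 1 := by rw [h1, h2]
  have := mt (exists_elliptic_const _ _ _ _ hM) (hx hxK hM)
  push Not at this
  obtain ⟨v, hv, hv0⟩ := this
  rw [h1] at hv
  exact exists_rank_one_of_mul_eq (hsymm x) h3 hv0 fun k i j J => hv (k, i, j, J)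

lemma singularPart_eq_zero_of_dim_zero (ρ : Measure (EuclideanSpace ℝ (Fin 0))) :
    ρ.singularPart volume = 0 := by
  refine Measure.singularPart_eq_zero_of_ac fun s hs => ?_
  rcases s.eq_empty_or_nonempty with rfl | h
  · simp
  · rw [Subsingleton.eq_univ_of_nonempty h] at hs
    exact absurd hs (NeZero.ne _)

end

end

/-- **Rank-one theorem for higher-order derivatives.**
Let `u ∈ L¹(Ω; ℝ^ℓ)` with `D^r u ∈ ℳ(Ω; SLin^r(ℝ^d; ℝ^ℓ))`: the `r`-th distributional
derivative of `u` is represented by the finite positive measure `ρ = |D^r u|`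
(concentrated on `Ω`) and the polar `F = d(D^r u)/d|D^r u|`, whose values are symmetric
in the `r` directional indices and have (Euclidean) norm one `ρ`-a.e.  Then at
`|(D^r u)^s|`-a.e. point the polar equals `a ⊗ b ⊗ ⋯ ⊗ b` with `a ≠ 0`, `b ≠ 0`. -/
theorem statement3 {d l r : ℕ}
    (Ω : Set (EuclideanSpace ℝ (Fin d))) (hΩ : IsOpen Ω)
    (u : EuclideanSpace ℝ (Fin d) → EuclideanSpace ℝ (Fin l))
    (hu : IntegrableOn u Ω volume)
    (ρ : Measure (EuclideanSpace ℝ (Fin d))) [IsFiniteMeasure ρ]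
    (hρΩ : ρ Ωᶜ = 0)
    (F : EuclideanSpace ℝ (Fin d) → (Fin l → (Fin r → Fin d) → ℝ))
    (hF : AEStronglyMeasurable F ρ)
    (hsymm : ∀ x, ∀ k : Fin l, ∀ iv : Fin r → Fin d, ∀ σ : Equiv.Perm (Fin r),
      F x k (iv ∘ σ) = F x k iv)
    (hpolar : ∀ᵐ x ∂ρ, ∑ k, ∑ iv : Fin r → Fin d, (F x k iv) ^ 2 = 1)
    (hDru : ∀ φ : EuclideanSpace ℝ (Fin d) → ℝ,
      ContDiff ℝ (⊤ : ℕ∞) φ → HasCompactSupport φ → tsupport φ ⊆ Ω →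
      ∀ (k : Fin l) (iv : Fin r → Fin d),
        ∫ x in Ω, u x k * pderivSeq iv φ x ∂volume
          = (-1 : ℝ) ^ r * ∫ x, φ x * F x k iv ∂ρ) :
    ∀ᵐ x ∂(ρ.singularPart volume),
      ∃ (a : Fin l → ℝ) (b : Fin d → ℝ), a ≠ 0 ∧ b ≠ 0 ∧
        ∀ (k : Fin l) (iv : Fin r → Fin d), F x k iv = a k * ∏ t, b (iv t) := by
  rcases r with _ | n
  · rcases d with _ | d
    · rw [singularPart_eq_zero_of_dim_zero]
      simp
    · filter_upwards [(Measure.absolutelyContinuous_of_le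
        (Measure.singularPart_le ρ volume)).ae_le hpolar] with x hx
      refine ⟨fun k => F x k Fin.elim0, 1, fun ha => ?_, one_ne_zero, fun k iv => ?_⟩
      · have h0 : ∀ k iv, F x k iv = 0 := fun k iv => by
          rw [Subsingleton.elim iv Fin.elim0]
          exact congrFun ha k
        simp [h0] at hx
      · rw [Subsingleton.elim iv Fin.elim0]
        simp
  · exact rank_one_succ hΩ hρΩ hF hsymm hpolar hDru
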